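/- For every odd natural number n with 61 ≤ n ≤ 75000, the quantity Ẽ_n := (2n - 1) + 2·L(n-2) - 2·L(n) satisfies Ẽ_n ∈ {1, 3}. -/

import Mathlib

open Polynomial

/-- `a n i` is the coefficient of `q^i` in `(q;q)_n = ∏_{k=1}^n (1 - q^k)` over `ℤ`. -/
noncomputable def a (n i : ℕ) : ℤ :=
  (∏ k ∈ Finset.Icc 1 n, (1 - (X : Polynomial ℤ) ^ k)).coeff i

/-- `M n` is the maximum of `|a n i|` over `0 ≤ i ≤ n(n+1)/2`. -/
noncomputable def M (n : ℕ) : ℕ :=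
  (Finset.range (n * (n + 1) / 2 + 1)).sup fun i => (a n i).natAbs

/-- `L n` is the least index `i` with `|a n i| = M n`. -/
noncomputable def L (n : ℕ) : ℕ :=
  sInf {i : ℕ | (a n i).natAbs = M n}

namespace QP

/-- product tree for `∏_{k=lo+1}^{lo+len} (2^(w*k) - 1)` -/
def pr (w : ℕ) : ℕ → ℕ → ℕ → ℕ
  | 0, _, _ => 1
  | f+1, lo, len => cond (Nat.beq len 0) 1 (cond (Nat.beq len 1) (Nat.sub (Nat.shiftLeft 1 (Nat.mul w (Nat.add lo 1))) 1)
    (Nat.mul (pr w f lo (Nat.div len 2)) (pr w f (Nat.add lo (Nat.div len 2)) (Nat.sub len (Nat.div len 2)))))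
def stepA (w A k : ℕ) : ℕ := Nat.sub (Nat.shiftLeft A (Nat.mul w k)) A
/-- the lowest `l` digits -/
def lowd (w A l : ℕ) : ℕ := Nat.land A (Nat.sub (Nat.shiftLeft 1 (Nat.mul w l)) 1)
def absd (h D : ℕ) : ℕ := Nat.add (Nat.sub D h) (Nat.sub h D)
def mxv (w H A l : ℕ) : ℕ :=
  absd (Nat.shiftLeft 1 (Nat.sub w 1)) (Nat.div (lowd w (Nat.add A H) (Nat.add l 1)) (Nat.shiftLeft 1 (Nat.mul w l)))
def chkU (H A U : ℕ) : Bool :=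
  cond (Nat.ble A U) (cond (Nat.beq (Nat.land (Nat.add U A) H) 0) (Nat.beq (Nat.land (Nat.sub U A) H) 0) false) false
def chk (w T R H A l C m : ℕ) : Bool :=
  cond (Nat.ble (Nat.add (Nat.mul 4 C) (Nat.add m 1)) (Nat.shiftLeft 1 (Nat.sub w 1)))
    (cond (Nat.ble (Nat.add l 1) T) (cond (Nat.ble 1 m)
    (chkU H A (Nat.sub (Nat.mul m R) (lowd w R l))) false) false) false
/-- the loop: state `n, A, l, C, bits` -/
def run (w T R H le Ce : ℕ) : ℕ → ℕ → ℕ → ℕ → ℕ → ℕ → Bool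
  | 0, _, _, l, C, _ => cond (Nat.beq l le) (Nat.ble C Ce) false
  | f+1, n, A, l, C, bits =>
    (fun A' l' => (fun m => cond (chk w T R H A' l' C m)
      (run w T R H le Ce f (Nat.add n 2) A' l' m (Nat.div bits 2)) false) (mxv w H A' l'))
    (stepA w (stepA w A (Nat.add n 1)) (Nat.add n 2)) (Nat.sub (Nat.add l (Nat.add n 1)) (Nat.mod bits 2))
def runR (w T R n f l C bits le Ce : ℕ) : Bool :=
  run w T R (Nat.shiftLeft R (Nat.sub w 1)) le Ce f n (pr w 12 0 n) l C bits
/-- one chunk of the verification: odd `n`, then `f` double steps -/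
def chunk (w n f l C bits le Ce T : ℕ) : Bool :=
  runR w T (Nat.div (Nat.sub (Nat.shiftLeft 1 (Nat.mul w T)) 1) (Nat.sub (Nat.shiftLeft 1 w) 1)) n f l C bits le Ce

/-- `Q n = ∏ (X^k - 1)` -/
noncomputable def Q (n : ℕ) : ℤ[X] := ∏ k ∈ Finset.range n, ((X : ℤ[X]) ^ (k + 1) - 1)

theorem Q_succ (n : ℕ) : Q (n + 1) = Q n * (X ^ (n + 1) - 1) := Finset.prod_range_succ _ _

theorem prod_Icc_eq (n : ℕ) : (∏ k ∈ Finset.Icc 1 n, (1 - (X : ℤ[X]) ^ k)) = (-1) ^ n * Q n := by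
  induction n with
  | zero => simp [Q]
  | succ n ih =>
    rw [Finset.prod_Icc_succ_top (by omega), ih, Q_succ, pow_succ]; ring

theorem a_natAbs (n i : ℕ) : (a n i).natAbs = ((Q n).coeff i).natAbs := by
  unfold a
  rw [prod_Icc_eq]
  rcases Nat.even_or_odd n with h | h
  · rw [h.neg_one_pow, one_mul]
  · rw [h.neg_one_pow, neg_one_mul, coeff_neg, Int.natAbs_neg]

theorem Q_coeff_succ (n i : ℕ) : (Q (n + 1)).coeff i = (if n + 1 ≤ i then (Q n).coeff (i - (n + 1)) else 0) - (Q n).coeff i := by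
  rw [Q_succ, mul_sub, mul_one, coeff_sub, coeff_mul_X_pow']

theorem Q_bound_succ {n C : ℕ} (h : ∀ i, |(Q n).coeff i| ≤ C) (i : ℕ) : |(Q (n + 1)).coeff i| ≤ (2 * C : ℕ) := by
  rw [Q_coeff_succ]
  have h1 := abs_le.1 (h i)
  have h2 := abs_le.1 (h (i - (n + 1)))
  rw [abs_le]; push_cast
  split_ifs <;> constructor <;> linarith

theorem Q_bound (n i : ℕ) : |(Q n).coeff i| ≤ (2 ^ n : ℕ) := by
  induction n generalizing i with
  | zero =>
    simp only [Q, Finset.range_zero, Finset.prod_empty, coeff_one]; split_ifs <;> simp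
  | succ n ih =>
    have := Q_bound_succ ih i
    rwa [pow_succ, mul_comm]

theorem Q_deg (n : ℕ) : (Q n).natDegree ≤ n * (n + 1) / 2 := by
  induction n with
  | zero => simp [Q]
  | succ n ih =>
    rw [Q_succ]
    refine natDegree_mul_le.trans ?_
    have h2 : ((X : ℤ[X]) ^ (n + 1) - 1).natDegree ≤ n + 1 := by
      refine (natDegree_sub_le _ _).trans ?_
      simp
    have : (n + 1) * (n + 1 + 1) / 2 = n * (n + 1) / 2 + (n + 1) := by
      rw [show (n + 1) * (n + 1 + 1) = n * (n + 1) + (n + 1) * 2 by ring, Nat.add_mul_div_right _ _ (by norm_num)]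
    omega

/-- value at `2^w` -/
def Av (w n : ℕ) : ℕ := ∏ k ∈ Finset.range n, (2 ^ (w * (k + 1)) - 1)

theorem Av_eval (w n : ℕ) : (Av w n : ℤ) = (Q n).eval ((2:ℤ) ^ w) := by
  unfold Av Q
  rw [eval_prod, Nat.cast_prod]
  refine Finset.prod_congr rfl fun k _ => ?_
  rw [Nat.cast_sub Nat.one_le_two_pow]; simp [pow_mul]

theorem Av_sum (w n T : ℕ) (hT : n * (n + 1) / 2 < T) :
    (Av w n : ℤ) = ∑ i ∈ Finset.range T, (Q n).coeff i * ((2:ℤ) ^ w) ^ i := by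
  rw [Av_eval, eval_eq_sum_range' (lt_of_le_of_lt (Q_deg n) hT)]

theorem stepA_eq (w n : ℕ) : stepA w (Av w n) (n + 1) = Av w (n + 1) := by
  unfold stepA
  rw [show Av w (n + 1) = Av w n * (2 ^ (w * (n + 1)) - 1) from Finset.prod_range_succ _ _, Nat.mul_sub, mul_one]
  show (Av w n) <<< (w * (n + 1)) - Av w n = _
  rw [Nat.shiftLeft_eq]

theorem pr_small (w f lo len : ℕ) (h2 : len < 2) :
    pr w (f + 1) lo len = ∏ k ∈ Finset.range len, (2 ^ (w * (lo + k + 1)) - 1) := by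
  rw [pr]
  have e1 : Nat.beq 1 0 = false := rfl
  have e2 : Nat.beq 1 1 = true := rfl
  interval_cases len
  · simp
  · rw [e1, e2]; simp [Nat.shiftLeft_eq]

theorem pr_eq (w : ℕ) : ∀ f lo len : ℕ, len ≤ 2 ^ f →
    pr w (f + 1) lo len = ∏ k ∈ Finset.range len, (2 ^ (w * (lo + k + 1)) - 1) := by
  intro f
  induction f with
  | zero => intro lo len h; exact pr_small _ _ _ _ (by omega)
  | succ f ih =>
    intro lo len h
    rcases Nat.lt_or_ge len 2 with h2 | h2
    · exact pr_small _ _ _ _ h2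
    · have e0 : Nat.beq len 0 = false := by rw [← Bool.not_eq_true, Nat.beq_eq]; omega
      have e1 : Nat.beq len 1 = false := by rw [← Bool.not_eq_true, Nat.beq_eq]; omega
      rw [pr, e0, e1, cond_false, cond_false]
      have hp : 2 ^ (f + 1) = 2 * 2 ^ f := by ring
      show pr w (f + 1) lo (len / 2) * pr w (f + 1) (lo + len / 2) (len - len / 2) = _
      rw [ih lo (len / 2) (by omega), ih (lo + len / 2) (len - len / 2) (by omega)]
      conv_rhs => rw [show len = len / 2 + (len - len / 2) by omega, Finset.prod_range_add]
      simp only [add_assoc]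

/-- repunit -/
def rpu (w : ℕ) : ℕ → ℕ
  | 0 => 0
  | T + 1 => 1 + 2 ^ w * rpu w T

theorem rpu_mul (w T : ℕ) : rpu w T * (2 ^ w - 1) + 1 = 2 ^ (w * T) := by
  have h1 : 1 ≤ 2 ^ w := Nat.one_le_two_pow
  obtain ⟨b, hb⟩ : ∃ b, 2 ^ w = b + 1 := ⟨2 ^ w - 1, by omega⟩
  rw [pow_mul, hb, Nat.add_sub_cancel]
  induction T with
  | zero => simp [rpu]
  | succ T ih => rw [rpu, pow_succ, ← ih, hb]; ring

theorem rpu_div {w : ℕ} (hw : 1 ≤ w) (T : ℕ) :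
    Nat.div (Nat.sub (Nat.shiftLeft 1 (Nat.mul w T)) 1) (Nat.sub (Nat.shiftLeft 1 w) 1) = rpu w T := by
  show (1 <<< (w * T) - 1) / (1 <<< w - 1) = _
  rw [Nat.shiftLeft_eq, Nat.shiftLeft_eq, one_mul, one_mul, ← rpu_mul, Nat.add_sub_cancel]
  refine Nat.mul_div_cancel _ ?_
  have : 2 ^ 1 ≤ 2 ^ w := Nat.pow_le_pow_right (by norm_num) hw
  omega

theorem rpu_sum (w T : ℕ) : (rpu w T : ℤ) = ∑ i ∈ Finset.range T, ((2:ℤ) ^ w) ^ i := by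
  induction T with
  | zero => simp [rpu]
  | succ T ih =>
    rw [rpu, Finset.sum_range_succ']; push_cast; rw [ih, Finset.mul_sum]
    simp only [pow_succ, pow_zero]
    rw [add_comm]; congr 1
    refine Finset.sum_congr rfl fun i _ => by ring

theorem sum_shift (B : ℤ) (d : ℕ → ℤ) (T : ℕ) :
    ∑ i ∈ Finset.range (T + 1), d i * B ^ i = d 0 + B * ∑ i ∈ Finset.range T, d (i + 1) * B ^ i := by
  rw [Finset.sum_range_succ', Finset.mul_sum, add_comm, pow_zero, mul_one]
  congr 1
  refine Finset.sum_congr rfl fun i _ => by ring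

theorem lowd_eq (w A l : ℕ) : lowd w A l = A % 2 ^ (w * l) := by
  show A &&& (1 <<< (w * l) - 1) = _
  rw [Nat.shiftLeft_eq, one_mul, Nat.and_two_pow_sub_one_eq_mod]

theorem rpu_add (w l s : ℕ) : rpu w (l + s) = rpu w l + 2 ^ (w * l) * rpu w s := by
  induction l with
  | zero => simp [rpu]
  | succ l ih =>
    rw [show l + 1 + s = (l + s) + 1 by ring, rpu, ih, rpu, mul_add w l 1, pow_add]; ring

theorem rpu_low {w : ℕ} (hw : 1 ≤ w) {l T : ℕ} (h : l ≤ T) : lowd w (rpu w T) l = rpu w l := by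
  obtain ⟨s, rfl⟩ := Nat.exists_eq_add_of_le h
  rw [lowd_eq, rpu_add, Nat.add_mul_mod_self_left, Nat.mod_eq_of_lt]
  have h1 := rpu_mul w l
  have h2 : 2 ^ 1 ≤ 2 ^ w := Nat.pow_le_pow_right (by norm_num) hw
  have : rpu w l * 1 ≤ rpu w l * (2 ^ w - 1) := Nat.mul_le_mul_left _ (by omega)
  omega

/-- if no digit has its top bit set, the balanced digits are nonnegative -/
theorem digits_nonneg {w : ℕ} (hw : 1 ≤ w) : ∀ (T W : ℕ) (d : ℕ → ℤ),
    (∀ i, |d i| < 2 ^ (w - 1)) → (W : ℤ) = ∑ i ∈ Finset.range T, d i * ((2:ℤ) ^ w) ^ i →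
    W &&& (rpu w T * 2 ^ (w - 1)) = 0 → ∀ i < T, 0 ≤ d i := by
  intro T
  induction T with
  | zero => intro W d _ _ _ i hi; omega
  | succ T ih =>
    intro W d hd hW hl i hi
    obtain ⟨u, rfl⟩ : ∃ u, w = u + 1 := ⟨w - 1, by omega⟩
    rw [Nat.add_sub_cancel] at *
    rw [sum_shift] at hW
    have hH : rpu (u + 1) (T + 1) * 2 ^ u = 2 ^ u + 2 ^ (u + 1) * (rpu (u + 1) T * 2 ^ u) := by rw [rpu]; ring
    rw [hH] at hl
    have hbit : W.testBit u = false := by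
      have h1 := congrArg (fun x => x.testBit u) hl
      simp only [Nat.testBit_and, Nat.zero_testBit] at h1
      have h2 : (2 ^ u + 2 ^ (u + 1) * (rpu (u + 1) T * 2 ^ u)).testBit u = true := by
        rw [Nat.testBit_eq_decide_div_mod_eq, pow_succ, mul_assoc, Nat.add_mul_div_left _ _ (by positivity),
          Nat.div_self (by positivity)]
        simp
      rwa [h2, Bool.and_true] at h1
    have hmod : W % 2 ^ (u + 1) < 2 ^ u := by
      rw [Nat.testBit_eq_decide_div_mod_eq, decide_eq_false_iff_not] at hbit
      have h3 : W / 2 ^ u % 2 = 0 := by omega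
      rw [Nat.pow_succ, Nat.mod_mul, h3, mul_zero, add_zero]
      exact Nat.mod_lt _ (by positivity)
    have hdm : (W : ℤ) = 2 ^ (u + 1) * (W / 2 ^ (u + 1) : ℕ) + (W % 2 ^ (u + 1) : ℕ) := by
      have := Nat.div_add_mod W (2 ^ (u + 1))
      exact_mod_cast this.symm
    set S := ∑ i ∈ Finset.range T, d (i + 1) * ((2:ℤ) ^ (u + 1)) ^ i with hS
    set q := W / 2 ^ (u + 1) with hq
    set r := W % 2 ^ (u + 1) with hr
    have hr' : (r : ℤ) < 2 ^ u := by exact_mod_cast hmod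
    have h0 := abs_lt.1 (hd 0)
    have hpos : (0:ℤ) < 2 ^ u := by positivity
    have hz : d 0 - r = 2 ^ (u + 1) * (q - S) := by linarith
    have hpw : (2:ℤ) ^ (u + 1) = 2 * 2 ^ u := by ring
    have hqs : (q : ℤ) - S = 0 := by
      by_contra hne
      have hr0 : (0:ℤ) ≤ r := by positivity
      rcases lt_or_gt_of_ne hne with hlt | hgt
      · have : (q : ℤ) - S ≤ -1 := by omega
        nlinarith
      · have : (1:ℤ) ≤ (q : ℤ) - S := by omega
        nlinarith
    have hd0 : d 0 = r := by rw [hqs] at hz; linarith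
    cases i with
    | zero => rw [hd0]; positivity
    | succ i =>
      refine ih q (fun i => d (i + 1)) (fun i => hd _) (by rw [← hS]; linarith) ?_ i (by omega)
      have h1 := congrArg (fun x => x >>> (u + 1)) hl
      simp only [Nat.shiftRight_and_distrib, Nat.zero_shiftRight] at h1
      have hlt : 2 ^ u < 2 ^ (u + 1) := Nat.pow_lt_pow_right (by norm_num) (by omega)
      rw [Nat.shiftRight_eq_div_pow, Nat.shiftRight_eq_div_pow, Nat.add_mul_div_left _ _ (by positivity),
        Nat.div_eq_of_lt hlt, zero_add] at h1
      exact h1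

theorem digit_get {w : ℕ} : ∀ (l T V : ℕ) (e : ℕ → ℤ), (∀ i, 0 ≤ e i) → (∀ i, e i < 2 ^ w) →
    (V : ℤ) = ∑ i ∈ Finset.range T, e i * ((2:ℤ) ^ w) ^ i → l < T →
    ((V % 2 ^ (w * (l + 1)) / 2 ^ (w * l) : ℕ) : ℤ) = e l := by
  intro l T V e h0 h1 hV hl
  rw [Nat.mul_succ, pow_add, Nat.mod_mul_right_div_self]
  induction l generalizing T V e with
  | zero =>
    obtain ⟨T, rfl⟩ : ∃ t, T = t + 1 := ⟨T - 1, by omega⟩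
    rw [sum_shift] at hV
    rw [mul_zero, pow_zero, Nat.div_one]; push_cast
    rw [hV, Int.add_mul_emod_self_left, Int.emod_eq_of_lt (h0 0) (h1 0)]
  | succ l ih =>
    obtain ⟨T, rfl⟩ : ∃ t, T = t + 1 := ⟨T - 1, by omega⟩
    rw [sum_shift] at hV
    rw [mul_add, mul_one, add_comm (w * l), pow_add, ← Nat.div_div_eq_div_mul]
    refine ih T (V / 2 ^ w) (fun i => e (i + 1)) (fun i => h0 _) (fun i => h1 _) ?_ (by omega)
    push_cast
    rw [hV, Int.add_mul_ediv_left _ _ (by positivity), Int.ediv_eq_zero_of_lt (h0 0) (h1 0), zero_add]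

theorem cond_false_eq {b c : Bool} (h : cond b c false = true) : b = true ∧ c = true := by
  cases b <;> simp_all

/-- correctness of one check -/
theorem chk_ok {w T n l C : ℕ} (hw : 1 ≤ w) (hT : n * (n + 1) / 2 < T) (hC : ∀ i, |(Q n).coeff i| ≤ (4 * C : ℕ))
    (h : chk w T (rpu w T) (rpu w T * 2 ^ (w - 1)) (Av w n) l C (mxv w (rpu w T * 2 ^ (w - 1)) (Av w n) l) = true) :
    L n = l ∧ ∀ i, |(Q n).coeff i| ≤ (mxv w (rpu w T * 2 ^ (w - 1)) (Av w n) l : ℕ) := by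
  set m := mxv w (rpu w T * 2 ^ (w - 1)) (Av w n) l with hm
  set A := Av w n with hA
  obtain ⟨g1, h⟩ := cond_false_eq h
  obtain ⟨g2, h⟩ := cond_false_eq h
  obtain ⟨g3, h⟩ := cond_false_eq h
  obtain ⟨g4, h⟩ := cond_false_eq h
  obtain ⟨g5, g6⟩ := cond_false_eq h
  clear h
  have g1 := Nat.le_of_ble_eq_true g1
  have g2 := Nat.le_of_ble_eq_true g2
  have g3 := Nat.le_of_ble_eq_true g3
  have g4 := Nat.le_of_ble_eq_true g4
  have g5 := Nat.eq_of_beq_eq_true g5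
  have g6 := Nat.eq_of_beq_eq_true g6
  change 4 * C + (m + 1) ≤ 1 <<< (w - 1) at g1
  change l + 1 ≤ T at g2
  rw [rpu_low hw (by omega)] at g4 g5 g6
  change A ≤ m * rpu w T - rpu w l at g4
  change (m * rpu w T - rpu w l) + A &&& _ = 0 at g5
  change (m * rpu w T - rpu w l) - A &&& _ = 0 at g6
  rw [Nat.shiftLeft_eq, one_mul] at g1
  have g1z : 4 * (C : ℤ) + (m + 1) ≤ 2 ^ (w - 1) := by exact_mod_cast g1
  have hAs := Av_sum w n T hT
  rw [← hA] at hAs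
  set f := fun i => (Q n).coeff i with hf
  have hfC : ∀ i, |f i| ≤ 4 * C := fun i => by have := hC i; push_cast at this; exact this
  have hrl : rpu w l ≤ m * rpu w T := by
    have : rpu w l ≤ rpu w T := by
      obtain ⟨s, rfl⟩ := Nat.exists_eq_add_of_le (show l ≤ T by omega)
      rw [rpu_add]; omega
    calc rpu w l ≤ 1 * rpu w T := by omega
      _ ≤ _ := Nat.mul_le_mul_right _ g3
  set u : ℕ → ℤ := fun i => if i < l then (m : ℤ) - 1 else m with hu
  have hu1 : ∀ i, 0 ≤ u i ∧ u i ≤ m := fun i => by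
    simp only [hu]; have : (1:ℤ) ≤ m := by exact_mod_cast g3
    split_ifs <;> constructor <;> linarith
  have hUs : ((m * rpu w T - rpu w l : ℕ) : ℤ) = ∑ i ∈ Finset.range T, u i * ((2:ℤ) ^ w) ^ i := by
    rw [Nat.cast_sub hrl, Nat.cast_mul, rpu_sum, rpu_sum, Finset.mul_sum]
    have : ∑ i ∈ Finset.range l, ((2:ℤ) ^ w) ^ i = ∑ i ∈ Finset.range T, (if i < l then ((2:ℤ) ^ w) ^ i else 0) := by
      rw [← Finset.sum_filter]
      refine Finset.sum_congr ?_ fun _ _ => rfl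
      ext i; simp only [Finset.mem_range, Finset.mem_filter]; omega
    rw [this, ← Finset.sum_sub_distrib]
    refine Finset.sum_congr rfl fun i _ => ?_
    simp only [hu]; split_ifs <;> ring
  have p1 := digits_nonneg hw T _ (fun i => u i + f i) (fun i => by
    have := abs_le.1 (hfC i); have := hu1 i; rw [abs_lt]; constructor <;> linarith) (by
    rw [Nat.cast_add, hUs, hAs, ← Finset.sum_add_distrib]
    refine Finset.sum_congr rfl fun i _ => by ring) g5
  have p2 := digits_nonneg hw T _ (fun i => u i - f i) (fun i => by
    have := abs_le.1 (hfC i); have := hu1 i; rw [abs_lt]; constructor <;> linarith) (by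
    rw [Nat.cast_sub g4, hUs, hAs, ← Finset.sum_sub_distrib]
    refine Finset.sum_congr rfl fun i _ => by ring) g6
  have hfz : ∀ i, T ≤ i → f i = 0 := fun i hi =>
    coeff_eq_zero_of_natDegree_lt (lt_of_le_of_lt (Q_deg n) (lt_of_lt_of_le hT hi))
  have hfu : ∀ i, |f i| ≤ u i := fun i => by
    rcases Nat.lt_or_ge i T with hi | hi
    · have := p1 i hi; have := p2 i hi
      rw [abs_le]; constructor <;> linarith
    · rw [hfz i hi, abs_zero]; exact (hu1 i).1
  have hfl : |f l| = m := by
    have hd := digit_get (w := w) l T (A + rpu w T * 2 ^ (w - 1)) (fun i => f i + 2 ^ (w - 1))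
      (fun i => by have := abs_le.1 (hfC i); linarith) (fun i => by
        have := abs_le.1 (hfC i)
        have : (2:ℤ) ^ w = 2 * 2 ^ (w - 1) := by rw [← pow_succ']; congr 1; omega
        linarith) (by
        push_cast
        rw [hAs, rpu_sum, Finset.sum_mul, ← Finset.sum_add_distrib]
        refine Finset.sum_congr rfl fun i _ => by ring) (by omega)
    have hm' : m = absd (2 ^ (w - 1)) ((A + rpu w T * 2 ^ (w - 1)) % 2 ^ (w * (l + 1)) / 2 ^ (w * l)) := by
      rw [hm]; unfold mxv
      rw [lowd_eq]
      show absd (1 <<< (w - 1)) (_ / 1 <<< (w * l)) = _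
      rw [Nat.shiftLeft_eq, Nat.shiftLeft_eq, one_mul, one_mul]; rfl
    set D := (A + rpu w T * 2 ^ (w - 1)) % 2 ^ (w * (l + 1)) / 2 ^ (w * l)
    rw [hm']
    show |f l| = ((D - 2 ^ (w - 1) + (2 ^ (w - 1) - D) : ℕ) : ℤ)
    generalize hh : 2 ^ (w - 1) = h
    have hd' : (D : ℤ) = f l + (h : ℕ) := by rw [hd, ← hh]; push_cast; rfl
    have : f l = D - (h : ℕ) := by linarith
    rw [this]
    rcases le_total D h with hle | hle
    · rw [abs_of_nonpos (by have : (D:ℤ) ≤ h := by exact_mod_cast hle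
                            linarith)]; omega
    · rw [abs_of_nonneg (by have : (h:ℤ) ≤ D := by exact_mod_cast hle
                            linarith)]; omega
  have key : ∀ i, (a n i).natAbs ≤ m := fun i => by
    rw [a_natAbs]; have := (hfu i).trans (hu1 i).2
    have h2 : ((f i).natAbs : ℤ) = |f i| := Int.natCast_natAbs _
    show (f i).natAbs ≤ m
    omega
  have keyl : (a n l).natAbs = m := by
    rw [a_natAbs]
    have h2 : ((f l).natAbs : ℤ) = |f l| := Int.natCast_natAbs _
    show (f l).natAbs = m
    omega
  have keylt : ∀ i < l, (a n i).natAbs < m := fun i hi => by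
    rw [a_natAbs]
    have h1 := hfu i
    simp only [hu, if_pos hi] at h1
    have h2 : ((f i).natAbs : ℤ) = |f i| := Int.natCast_natAbs _
    show (f i).natAbs < m
    omega
  have hlN : l ≤ n * (n + 1) / 2 := by
    by_contra hc
    have : f l = 0 := coeff_eq_zero_of_natDegree_lt (lt_of_le_of_lt (Q_deg n) (by omega))
    rw [this, abs_zero] at hfl
    omega
  have hM : M n = m := by
    refine le_antisymm (Finset.sup_le fun i _ => key i) ?_
    rw [← keyl]
    exact Finset.le_sup (f := fun i => (a n i).natAbs) (Finset.mem_range.2 (by omega))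
  refine ⟨?_, fun i => (hfu i).trans (hu1 i).2⟩
  unfold L
  rw [hM]
  refine le_antisymm (Nat.sInf_le keyl) ?_
  by_contra hc
  have := Nat.sInf_mem (s := {i : ℕ | (a n i).natAbs = m}) ⟨l, keyl⟩
  have h3 := keylt _ (not_le.1 hc)
  simp only [Set.mem_ofPred_eq] at this
  omega

theorem run_ok {w T le Ce : ℕ} (hw : 1 ≤ w) : ∀ (f n l C bits : ℕ), (n + 2 * f) * (n + 2 * f + 1) / 2 < T →
    (∀ i, |(Q n).coeff i| ≤ C) → run w T (rpu w T) (rpu w T * 2 ^ (w - 1)) le Ce f n (Av w n) l C bits = true →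
    (1 ≤ f ∨ L n = l → L (n + 2 * f) = le) ∧ (∀ i, |(Q (n + 2 * f)).coeff i| ≤ Ce) ∧
    (L n = l → ∀ j < f, ∃ b ≤ 1, L (n + 2 * j + 2) + b = L (n + 2 * j) + (n + 2 * j + 1)) := by
  intro f
  induction f with
  | zero =>
    intro n l C bits _ hC h
    obtain ⟨h1, h2⟩ := cond_false_eq h
    have h1 := Nat.eq_of_beq_eq_true h1
    have h2 := Nat.le_of_ble_eq_true h2
    refine ⟨fun h => by simp at h; rw [← h1]; simpa using h, fun i => (hC i).trans (by exact_mod_cast h2), fun _ j hj => by omega⟩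
  | succ f ih =>
    intro n l C bits hT hC h
    rw [run] at h
    change cond (chk w T (rpu w T) (rpu w T * 2 ^ (w - 1)) (stepA w (stepA w (Av w n) (n + 1)) (n + 1 + 1)) (l + (n + 1) - bits % 2) C _) _ _ = true at h
    rw [stepA_eq, stepA_eq] at h
    obtain ⟨h1, h2⟩ := cond_false_eq h
    have hmono : (n + 2) * (n + 2 + 1) / 2 < T := by
      refine lt_of_le_of_lt (Nat.div_le_div_right ?_) hT
      apply Nat.mul_le_mul <;> omega
    have hC2 : ∀ i, |(Q (n + 2)).coeff i| ≤ (4 * C : ℕ) := fun i => by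
      have := Q_bound_succ (Q_bound_succ hC) i
      rwa [← mul_assoc] at this
    obtain ⟨c1, c2⟩ := chk_ok hw hmono hC2 h1
    obtain ⟨i1, i2, i3⟩ := ih (n + 2) _ _ _ (by rwa [show n + 2 + 2 * f = n + 2 * (f + 1) by ring]) c2 h2
    rw [show n + 2 + 2 * f = n + 2 * (f + 1) by ring] at i1 i2
    refine ⟨fun _ => i1 (Or.inr c1), i2, fun hL j hj => ?_⟩
    cases j with
    | zero =>
      refine ⟨bits % 2, by omega, ?_⟩
      rw [mul_zero, add_zero, c1, hL]; omega
    | succ j =>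
      have := i3 c1 j (by omega)
      rwa [show n + 2 + 2 * j = n + 2 * (j + 1) by ring] at this

theorem chunk_ok {w n f l C bits le Ce T : ℕ} (h : chunk w n f l C bits le Ce T = true) (hw : 1 ≤ w) (hn : n ≤ 2 ^ 11)
    (hT : (n + 2 * f) * (n + 2 * f + 1) / 2 < T) (hC : ∀ i, |(Q n).coeff i| ≤ C) :
    (1 ≤ f ∨ L n = l → L (n + 2 * f) = le) ∧ (∀ i, |(Q (n + 2 * f)).coeff i| ≤ Ce) ∧
    (L n = l → ∀ j < f, ∃ b ≤ 1, L (n + 2 * j + 2) + b = L (n + 2 * j) + (n + 2 * j + 1)) := by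
  unfold chunk runR at h
  rw [rpu_div hw, pr_eq w 11 0 n hn] at h
  have e1 : Nat.shiftLeft (rpu w T) (Nat.sub w 1) = rpu w T * 2 ^ (w - 1) := Nat.shiftLeft_eq _ _
  rw [e1] at h
  have e2 : (∏ k ∈ Finset.range n, (2 ^ (w * (0 + k + 1)) - 1)) = Av w n := by simp [Av]
  rw [e2] at h
  exact run_ok hw f n l C bits hT hC h

end QP

namespace QP

set_option linter.defProp false

def ch57 : chunk 64 57 1 809 (2^57) 0 867 (2^13) 1771 = true := by decide +kernel
def ch59 : chunk 84 59 121 867 (2^13) 333615254290449175513124264682721289 22630 (2^80) 45452 = true := by decide +kernel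
def ch301 : chunk 126 301 75 22630 (2^80) 9481915818993356116000 50820 (2^122) 101927 = true := by decide +kernel
def ch451 : chunk 155 451 50 50820 (2^122) 8865083039776 75864 (2^151) 152077 = true := by decide +kernel
def ch551 : chunk 180 551 45 75864 (2^151) 551920140802 102678 (2^176) 205762 = true := by decide +kernel
def ch641 : chunk 200 641 35 102678 (2^176) 4311876098 126333 (2^196) 253117 = true := by decide +kernel
def ch711 : chunk 217 711 30 126333 (2^196) 134746128 148559 (2^213) 297607 = true := by decide +kernel
def ch771 : chunk 232 771 25 148559 (2^213) 1052704 168456 (2^228) 337432 = true := by decide +kernel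
def ch821 : chunk 243 821 21 168456 (2^228) 263172 186135 (2^239) 372817 = true := by decide +kernel
def ch863 : chunk 254 863 19 186135 (2^239) 4112 202891 (2^250) 406352 = true := by decide +kernel

theorem small_step {n j l f : ℕ} (hL : L n = l)
    (h : L n = l → ∀ j < f, ∃ b ≤ 1, L (n + 2 * j + 2) + b = L (n + 2 * j) + (n + 2 * j + 1)) (hj : j < f) :
    (2 * ((n + 2 * j + 2 : ℕ) : ℤ) - 1 + 2 * (L (n + 2 * j + 2 - 2) : ℤ) - 2 * (L (n + 2 * j + 2) : ℤ)) ∈ ({1, 3} : Set ℤ) := by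
  obtain ⟨b, hb, h1⟩ := h hL j hj
  rw [Nat.add_sub_cancel]
  simp only [Set.mem_insert_iff, Set.mem_singleton_iff]
  push_cast
  omega

theorem small (n : ℕ) (hodd : Odd n) (h1 : 61 ≤ n) (h2 : n ≤ 901) :
    (2 * (n : ℤ) - 1 + 2 * (L (n - 2) : ℤ) - 2 * (L n : ℤ)) ∈ ({1, 3} : Set ℤ) := by
  obtain ⟨t, rfl⟩ := hodd
  obtain ⟨L59, C59, -⟩ := chunk_ok ch57 (by norm_num) (by norm_num) (by norm_num) (Q_bound 57)
  have L59 := L59 (Or.inl (by norm_num))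
  obtain ⟨L301, C301, S301⟩ := chunk_ok ch59 (by norm_num) (by norm_num) (by norm_num) C59
  rcases Nat.lt_or_ge (2 * t + 1) 303 with h | h301
  · have := small_step (j := (2 * t + 1 - 61) / 2) L59 S301 (by omega)
    rwa [show 59 + 2 * ((2 * t + 1 - 61) / 2) + 2 = 2 * t + 1 by omega] at this
  have L301 := L301 (Or.inl (by norm_num))
  clear S301
  obtain ⟨L451, C451, S451⟩ := chunk_ok ch301 (by norm_num) (by norm_num) (by norm_num) C301
  rcases Nat.lt_or_ge (2 * t + 1) 453 with h | h451
  · have := small_step (j := (2 * t + 1 - 303) / 2) L301 S451 (by omega)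
    rwa [show 301 + 2 * ((2 * t + 1 - 303) / 2) + 2 = 2 * t + 1 by omega] at this
  have L451 := L451 (Or.inl (by norm_num))
  clear S451
  obtain ⟨L551, C551, S551⟩ := chunk_ok ch451 (by norm_num) (by norm_num) (by norm_num) C451
  rcases Nat.lt_or_ge (2 * t + 1) 553 with h | h551
  · have := small_step (j := (2 * t + 1 - 453) / 2) L451 S551 (by omega)
    rwa [show 451 + 2 * ((2 * t + 1 - 453) / 2) + 2 = 2 * t + 1 by omega] at this
  have L551 := L551 (Or.inl (by norm_num))
  clear S551
  obtain ⟨L641, C641, S641⟩ := chunk_ok ch551 (by norm_num) (by norm_num) (by norm_num) C551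
  rcases Nat.lt_or_ge (2 * t + 1) 643 with h | h641
  · have := small_step (j := (2 * t + 1 - 553) / 2) L551 S641 (by omega)
    rwa [show 551 + 2 * ((2 * t + 1 - 553) / 2) + 2 = 2 * t + 1 by omega] at this
  have L641 := L641 (Or.inl (by norm_num))
  clear S641
  obtain ⟨L711, C711, S711⟩ := chunk_ok ch641 (by norm_num) (by norm_num) (by norm_num) C641
  rcases Nat.lt_or_ge (2 * t + 1) 713 with h | h711
  · have := small_step (j := (2 * t + 1 - 643) / 2) L641 S711 (by omega)
    rwa [show 641 + 2 * ((2 * t + 1 - 643) / 2) + 2 = 2 * t + 1 by omega] at this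
  have L711 := L711 (Or.inl (by norm_num))
  clear S711
  obtain ⟨L771, C771, S771⟩ := chunk_ok ch711 (by norm_num) (by norm_num) (by norm_num) C711
  rcases Nat.lt_or_ge (2 * t + 1) 773 with h | h771
  · have := small_step (j := (2 * t + 1 - 713) / 2) L711 S771 (by omega)
    rwa [show 711 + 2 * ((2 * t + 1 - 713) / 2) + 2 = 2 * t + 1 by omega] at this
  have L771 := L771 (Or.inl (by norm_num))
  clear S771
  obtain ⟨L821, C821, S821⟩ := chunk_ok ch771 (by norm_num) (by norm_num) (by norm_num) C771
  rcases Nat.lt_or_ge (2 * t + 1) 823 with h | h821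
  · have := small_step (j := (2 * t + 1 - 773) / 2) L771 S821 (by omega)
    rwa [show 771 + 2 * ((2 * t + 1 - 773) / 2) + 2 = 2 * t + 1 by omega] at this
  have L821 := L821 (Or.inl (by norm_num))
  clear S821
  obtain ⟨L863, C863, S863⟩ := chunk_ok ch821 (by norm_num) (by norm_num) (by norm_num) C821
  rcases Nat.lt_or_ge (2 * t + 1) 865 with h | h863
  · have := small_step (j := (2 * t + 1 - 823) / 2) L821 S863 (by omega)
    rwa [show 821 + 2 * ((2 * t + 1 - 823) / 2) + 2 = 2 * t + 1 by omega] at this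
  have L863 := L863 (Or.inl (by norm_num))
  clear S863
  obtain ⟨L901, C901, S901⟩ := chunk_ok ch863 (by norm_num) (by norm_num) (by norm_num) C863
  rcases Nat.lt_or_ge (2 * t + 1) 903 with h | h901
  · have := small_step (j := (2 * t + 1 - 865) / 2) L863 S901 (by omega)
    rwa [show 863 + 2 * ((2 * t + 1 - 865) / 2) + 2 = 2 * t + 1 by omega] at this
  have L901 := L901 (Or.inl (by norm_num))
  clear S901
  omega

end QP

namespace QP

open intervalIntegral MeasureTheory Set

/-- A strongly log-concave weight `v` on `(0,b)` with score `s`, mode `c`. -/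
structure SLC (v s : ℝ → ℝ) (b m c : ℝ) : Prop where
  hb : 0 < b
  hm : 0 < m
  hc0 : 0 < c
  hcb : c < b
  smooth : ContDiff ℝ 1 v
  v0 : v 0 = 0
  vb : v b = 0
  pos : ∀ x, 0 < x → x < b → 0 < v x
  der : ∀ x, 0 < x → x < b → deriv v x = s x * v x
  mono : ∀ x y, 0 < x → x < y → y < b → s y - s x ≤ -m * (y - x)
  sc : s c = 0

variable {v s : ℝ → ℝ} {b m c : ℝ}

theorem SLC.cont (H : SLC v s b m c) : Continuous v := H.smooth.continuous
theorem SLC.dcont (H : SLC v s b m c) : Continuous (deriv v) :=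
  H.smooth.continuous_deriv (le_refl _)

theorem SLC.nonneg (H : SLC v s b m c) {x : ℝ} (h0 : 0 ≤ x) (hb : x ≤ b) : 0 ≤ v x := by
  rcases h0.eq_or_lt with h | h
  · rw [← h, H.v0]
  rcases hb.eq_or_lt with h' | h'
  · rw [h', H.vb]
  exact (H.pos x h h').le

theorem SLC.int_mono (H : SLC v s b m c) {f g : ℝ → ℝ} (hf : Continuous f) (hg : Continuous g)
    (h : ∀ x, 0 < x → x < b → f x ≤ g x) :
    ∫ x in (0:ℝ)..b, f x ≤ ∫ x in (0:ℝ)..b, g x := by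
  apply intervalIntegral.integral_mono_on_of_le_Ioo H.hb.le
    (hf.intervalIntegrable _ _) (hg.intervalIntegrable _ _)
  intro x hx
  exact h x hx.1 hx.2

theorem SLC.Zpos (H : SLC v s b m c) : 0 < ∫ x in (0:ℝ)..b, v x :=
  intervalIntegral.intervalIntegral_pos_of_pos_on (H.cont.intervalIntegrable _ _)
    (fun x hx => H.pos x hx.1 hx.2) H.hb

theorem SLC.ibp (H : SLC v s b m c) {h h' : ℝ → ℝ} (hh : ∀ x, HasDerivAt h (h' x) x)
    (hc : Continuous h') :
    ∫ x in (0:ℝ)..b, h x * deriv v x = - ∫ x in (0:ℝ)..b, h' x * v x := by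
  have := intervalIntegral.integral_mul_deriv_eq_deriv_mul (a := 0) (b := b)
    (u := h) (v := v) (u' := h') (v' := deriv v)
    (fun x _ => hh x)
    (fun x _ => (H.smooth.differentiable (by norm_num) x).hasDerivAt)
    (hc.intervalIntegrable _ _) (H.dcont.intervalIntegrable _ _)
  rw [this, H.v0, H.vb]; ring

theorem SLC.s_mul (H : SLC v s b m c) {x : ℝ} (h0 : 0 < x) (hb : x < b) :
    (x - c) * s x ≤ -m * (x - c) ^ 2 := by
  rcases lt_trichotomy x c with h | h | h
  · have := H.mono x c h0 h H.hcb
    rw [H.sc] at this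
    nlinarith
  · subst h; simp
  · have := H.mono c x H.hc0 h hb
    rw [H.sc] at this
    nlinarith

theorem SLC.moment_step (H : SLC v s b m c) (k : ℕ) :
    m * ∫ x in (0:ℝ)..b, (x - c) ^ (2 * k + 2) * v x ≤
      (2 * k + 1) * ∫ x in (0:ℝ)..b, (x - c) ^ (2 * k) * v x := by
  have hv := H.cont
  have hd := H.dcont
  have h1 := H.ibp (h := fun x => (x - c) ^ (2 * k + 1))
    (h' := fun x => (2 * k + 1) * (x - c) ^ (2 * k))
    (by
      intro x
      have := ((hasDerivAt_id' x).sub_const c).fun_pow (2 * k + 1)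
      simpa using this)
    (by fun_prop)
  have h2 : ∫ x in (0:ℝ)..b, (x - c) ^ (2 * k + 1) * deriv v x ≤
      ∫ x in (0:ℝ)..b, -m * ((x - c) ^ (2 * k + 2) * v x) := by
    apply H.int_mono (by fun_prop) (by fun_prop)
    intro x h0 hb
    rw [H.der x h0 hb]
    have e1 := H.s_mul h0 hb
    have e2 := H.pos x h0 hb
    have e3 : 0 ≤ (x - c) ^ (2 * k) := by rw [pow_mul]; positivity
    have e4 := mul_le_mul_of_nonneg_left e1 (mul_nonneg e3 e2.le)
    have e5 : (x - c) ^ (2 * k + 1) = (x - c) ^ (2 * k) * (x - c) := pow_succ _ _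
    have e6 : (x - c) ^ (2 * k + 2) = (x - c) ^ (2 * k) * (x - c) ^ 2 := pow_add _ _ _
    rw [e5, e6]
    nlinarith
  rw [h1, intervalIntegral.integral_const_mul] at h2
  have h3 : ∫ x in (0:ℝ)..b, (2 * (k:ℝ) + 1) * (x - c) ^ (2 * k) * v x =
      (2 * k + 1) * ∫ x in (0:ℝ)..b, (x - c) ^ (2 * k) * v x := by
    rw [← intervalIntegral.integral_const_mul]
    congr 1; ext x; ring
  rw [h3] at h2
  linarith

/-- normalised expectation -/
noncomputable def Ex (v : ℝ → ℝ) (b : ℝ) (h : ℝ → ℝ) : ℝ :=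
  (∫ x in (0:ℝ)..b, h x * v x) / ∫ x in (0:ℝ)..b, v x

theorem SLC.Ex_mono (H : SLC v s b m c) {f g : ℝ → ℝ} (hf : Continuous f) (hg : Continuous g)
    (h : ∀ x, 0 < x → x < b → f x ≤ g x) : Ex v b f ≤ Ex v b g := by
  have hv := H.cont
  unfold Ex
  apply div_le_div_of_nonneg_right _ H.Zpos.le
  apply H.int_mono (by fun_prop) (by fun_prop)
  intro x h0 hb
  exact mul_le_mul_of_nonneg_right (h x h0 hb) (H.pos x h0 hb).le

theorem SLC.Ex_add (H : SLC v s b m c) {f g : ℝ → ℝ} (hf : Continuous f) (hg : Continuous g) :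
    Ex v b (fun x => f x + g x) = Ex v b f + Ex v b g := by
  have hv := H.cont
  unfold Ex
  rw [← add_div, ← intervalIntegral.integral_add]
  · congr 2; ext x; ring
  · exact Continuous.intervalIntegrable (by fun_prop) _ _
  · exact Continuous.intervalIntegrable (by fun_prop) _ _

theorem Ex_const_mul (r : ℝ) (f : ℝ → ℝ) :
    Ex v b (fun x => r * f x) = r * Ex v b f := by
  unfold Ex
  rw [mul_div_assoc', ← intervalIntegral.integral_const_mul]
  congr 2; ext x; ring

theorem SLC.Ex_const (H : SLC v s b m c) (r : ℝ) : Ex v b (fun _ => r) = r := by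
  unfold Ex
  rw [intervalIntegral.integral_const_mul]
  exact mul_div_cancel_right₀ _ H.Zpos.ne'

theorem SLC.Ex_sub (H : SLC v s b m c) {f g : ℝ → ℝ} (hf : Continuous f) (hg : Continuous g) :
    Ex v b (fun x => f x - g x) = Ex v b f - Ex v b g := by
  have := H.Ex_add hf (g := fun x => (-1) * g x) (by fun_prop)
  rw [Ex_const_mul] at this
  rw [sub_eq_add_neg, ← neg_one_mul, ← this]
  congr 1; ext x; ring

theorem SLC.Ex_nonneg (H : SLC v s b m c) {f : ℝ → ℝ} (hf : Continuous f)
    (h : ∀ x, 0 < x → x < b → 0 ≤ f x) : 0 ≤ Ex v b f := by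
  have := H.Ex_mono (f := fun _ => 0) continuous_const hf h
  rwa [H.Ex_const] at this

theorem SLC.Ex_abs (H : SLC v s b m c) {f g : ℝ → ℝ} (hf : Continuous f) (hg : Continuous g)
    (h : ∀ x, 0 < x → x < b → |f x| ≤ g x) : |Ex v b f| ≤ Ex v b g := by
  rw [abs_le]
  constructor
  · have := H.Ex_mono (f := fun x => (-1) * g x) (g := f) (by fun_prop) hf
      (fun x h0 hb => by have := (abs_le.1 (h x h0 hb)).1; linarith)
    rw [Ex_const_mul] at this; linarith
  · exact H.Ex_mono hf hg (fun x h0 hb => (abs_le.1 (h x h0 hb)).2)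

/-- Cauchy–Schwarz -/
theorem SLC.Ex_cs (H : SLC v s b m c) {f g : ℝ → ℝ} (hf : Continuous f) (hg : Continuous g) :
    (Ex v b (fun x => f x * g x)) ^ 2 ≤ Ex v b (fun x => f x ^ 2) * Ex v b (fun x => g x ^ 2) := by
  set A := Ex v b (fun x => f x ^ 2)
  set B := Ex v b (fun x => f x * g x)
  set C := Ex v b (fun x => g x ^ 2)
  have key : ∀ t : ℝ, 0 ≤ A * (t * t) + (2 * B) * t + C := by
    intro t
    have h := H.Ex_nonneg (f := fun x => (t * f x + g x) ^ 2) (by fun_prop) (fun x _ _ => sq_nonneg _)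
    have e : (fun x => (t * f x + g x) ^ 2) =
        fun x => ((t * t) * (f x ^ 2) + (2 * t) * (f x * g x)) + g x ^ 2 := by ext x; ring
    rw [e, H.Ex_add (by fun_prop) (by fun_prop), H.Ex_add (by fun_prop) (by fun_prop),
      Ex_const_mul, Ex_const_mul] at h
    show 0 ≤ A * (t * t) + (2 * B) * t + C
    nlinarith
  have := discrim_le_zero key
  unfold discrim at this
  nlinarith

theorem SLC.m2 (H : SLC v s b m c) : Ex v b (fun x => (x - c) ^ 2) ≤ 1 / m := by
  have h := H.moment_step 0
  simp at h
  unfold Ex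
  rw [div_le_div_iff₀ H.Zpos H.hm]
  linarith

theorem SLC.m4 (H : SLC v s b m c) : Ex v b (fun x => (x - c) ^ 4) ≤ 3 / m ^ 2 := by
  have h := H.moment_step 1
  have h0 := H.moment_step 0
  norm_num at h h0
  have hm := H.hm
  unfold Ex
  rw [div_le_div_iff₀ H.Zpos (by positivity)]
  nlinarith

/-- mean -/
noncomputable def mean (v : ℝ → ℝ) (b : ℝ) : ℝ := Ex v b (fun x => x)

theorem SLC.Ex_t (H : SLC v s b m c) : Ex v b (fun x => x - c) = mean v b - c := by
  rw [H.Ex_sub (f := fun x => x) (by fun_prop) continuous_const, H.Ex_const]; rfl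

theorem SLC.mean_sq (H : SLC v s b m c) : (mean v b - c) ^ 2 ≤ 1 / m := by
  have h := H.Ex_cs (f := fun x => x - c) (g := fun _ => 1) (by fun_prop) (by fun_prop)
  simp only [mul_one, one_pow] at h
  rw [H.Ex_t, H.Ex_const] at h
  have := H.m2
  linarith

noncomputable def var (v : ℝ → ℝ) (b : ℝ) : ℝ := Ex v b (fun x => (x - mean v b) ^ 2)

theorem SLC.var_eq (H : SLC v s b m c) (d : ℝ) :
    Ex v b (fun x => (x - d) ^ 2) = var v b + (mean v b - d) ^ 2 := by
  unfold var
  set e := mean v b with he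
  have e1 : (fun x : ℝ => (x - d) ^ 2) =
      fun x => ((x - e) ^ 2 + (2 * (e - d)) * x) + ((e - d) ^ 2 - 2 * (e - d) * e) := by
    ext x; ring
  rw [e1, H.Ex_add (by fun_prop) (by fun_prop), H.Ex_add (by fun_prop) (by fun_prop),
    Ex_const_mul, H.Ex_const]
  have : Ex v b (fun x => x) = e := rfl
  rw [this]; ring

theorem SLC.var_le (H : SLC v s b m c) : var v b ≤ 1 / m := by
  have := H.var_eq c
  have h2 := H.m2
  nlinarith [sq_nonneg (mean v b - c)]

theorem SLC.var_nonneg (H : SLC v s b m c) : 0 ≤ var v b :=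
  H.Ex_nonneg (by fun_prop) (fun x _ _ => sq_nonneg _)

theorem SLC.k4 (H : SLC v s b m c) : Ex v b (fun x => (x - mean v b) ^ 4) ≤ 16 / m ^ 2 := by
  set e := mean v b with he
  set d := e - c with hd
  have hm := H.hm
  have hd2 : d ^ 2 ≤ 1 / m := H.mean_sq
  have e1 : (fun x : ℝ => (x - e) ^ 4) = fun x => (((x-c)^4 + (-4 * d) * (x - c)^3 +
      (6 * d ^2) * (x-c)^2) + (-4 * d^3) * (x - c)) + d^4 := by
    ext x; simp only [hd]; ring
  rw [e1, H.Ex_add (by fun_prop) (by fun_prop), H.Ex_add (by fun_prop) (by fun_prop),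
      H.Ex_const, Ex_const_mul (-4 * d ^ 3), H.Ex_t, ← he, ← hd]
  have h2 : Ex v b (fun x => (x - c)^4 + (-4*d)*(x-c)^3 + (6 * d ^2) * (x-c)^2) ≤
       Ex v b (fun x => 2 * (x - c) ^ 4 + (10 / m) * (x - c)^2) := by
    apply H.Ex_mono (by fun_prop) (by fun_prop)
    intro x _ _
    set t := x - c
    have h3 : 0 ≤ (t^2 + 2 * d * t)^2 := sq_nonneg _
    have h4 : 10 * d^2 * t^2 ≤ (10 / m) * t^2 := by
      have := mul_le_mul_of_nonneg_right hd2 (sq_nonneg t)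
      have e : (10 / m) * t^2 = 10 * (1 / m * t^2) := by ring
      rw [e]; linarith
    nlinarith
  rw [H.Ex_add (f := fun x => 2 * (x - c) ^ 4) (by fun_prop) (by fun_prop), Ex_const_mul 2, Ex_const_mul (10 / m)] at h2
  have h2' := H.m2
  have h4 := H.m4
  have h5 : (10 / m) * Ex v b (fun x => (x - c) ^ 2) ≤ 10 / m * (1 / m) :=
    mul_le_mul_of_nonneg_left h2' (by positivity)
  have e3 : 10 / m * (1 / m) = 10 / m ^ 2 := by field_simp
  have e4 : 3 / m ^ 2 * 2 + 10 / m ^ 2 = 16 / m ^ 2 := by ring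
  have : 0 ≤ d ^ 4 := by positivity
  nlinarith

end QP

namespace QP

open intervalIntegral MeasureTheory Set

variable {v s : ℝ → ℝ} {b m c : ℝ}

theorem cos_le_quartic (x : ℝ) : Real.cos x ≤ 1 - x ^ 2 / 2 + x ^ 4 / 24 := by
  wlog hx : 0 ≤ x
  · have := this (-x) (by linarith)
    rw [Real.cos_neg] at this
    have e1 : (-x) ^ 2 = x ^ 2 := by ring
    have e2 : (-x) ^ 4 = x ^ 4 := by ring
    rwa [e1, e2] at this
  have h1 : Real.cos x = 1 - 2 * Real.sin (x / 2) ^ 2 := by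
    have := Real.cos_sq' (x / 2)
    have h2 := Real.cos_two_mul (x / 2)
    have e : 2 * (x / 2) = x := by ring
    rw [e] at h2; linarith
  have h3 := Real.sin_ge_sub_cube (x := x / 2) (by linarith)
  have h4 : (x / 2) ^ 2 - (x / 2) ^ 4 / 3 ≤ Real.sin (x / 2) ^ 2 := by
    by_cases h : (x / 2) ^ 2 ≤ 6
    · have h5 : 0 ≤ x / 2 - (x / 2) ^ 3 / 6 := by nlinarith
      have := pow_le_pow_left₀ h5 h3 2
      nlinarith [sq_nonneg ((x / 2) ^ 3)]
    · push Not at h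
      nlinarith [sq_nonneg (Real.sin (x / 2))]
  rw [h1]; nlinarith

theorem SLC.Ex_tau (H : SLC v s b m c) : Ex v b (fun x => x - mean v b) = 0 := by
  rw [H.Ex_sub (f := fun x => x) (by fun_prop) continuous_const, H.Ex_const]
  exact sub_self _

theorem SLC.k3 (H : SLC v s b m c) :
    (Ex v b (fun x => |x - mean v b| ^ 3)) ^ 2 ≤ 16 / m ^ 3 := by
  have hm := H.hm
  have h := H.Ex_cs (f := fun x => |x - mean v b|) (g := fun x => |x - mean v b| ^ 2)
    (by fun_prop) (by fun_prop)
  have e1 : (fun x => |x - mean v b| * |x - mean v b| ^ 2) = fun x => |x - mean v b| ^ 3 := by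
    ext x; ring
  have e2 : (fun x => |x - mean v b| ^ 2) = fun x => (x - mean v b) ^ 2 := by
    ext x; exact sq_abs _
  have e3 : (fun x => (|x - mean v b| ^ 2) ^ 2) = fun x => (x - mean v b) ^ 4 := by
    ext x; rw [sq_abs]; ring
  rw [e1, e2, e3] at h
  refine h.trans ?_
  have h1 := H.var_le
  have h2 := H.k4
  have h3 : 0 ≤ Ex v b (fun x => (x - mean v b) ^ 4) :=
    H.Ex_nonneg (by fun_prop) (fun x _ _ => by positivity)
  calc _ ≤ (1 / m) * (16 / m ^ 2) := mul_le_mul h1 h2 h3 (by positivity)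
    _ = _ := by field_simp

theorem SLC.sin_tau (H : SLC v s b m c) {w : ℝ} (hw : 0 ≤ w) :
    (Ex v b (fun x => Real.sin (w * (x - mean v b)))) ^ 2 ≤ w ^ 6 / 36 * (16 / m ^ 3) := by
  have hm := H.hm
  have h := H.Ex_abs (f := fun x => Real.sin (w * (x - mean v b)) - w * (x - mean v b))
    (g := fun x => (w ^ 3 / 6) * |x - mean v b| ^ 3) (by fun_prop) (by fun_prop)
    (by
      intro x _ _
      rw [abs_sub_comm]
      have := Real.abs_sub_sin_le (w * (x - mean v b))
      rw [abs_mul, abs_of_nonneg hw] at this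
      calc _ ≤ _ := this
        _ = _ := by ring)
  rw [H.Ex_sub (by fun_prop) (by fun_prop), Ex_const_mul w, H.Ex_tau, Ex_const_mul] at h
  simp only [mul_zero, sub_zero] at h
  have h2 := H.k3
  have h3 := pow_le_pow_left₀ (abs_nonneg _) h 2
  rw [sq_abs] at h3
  refine h3.trans ?_
  rw [mul_pow]
  have : (w ^ 3 / 6) ^ 2 = w ^ 6 / 36 := by ring
  rw [this]
  exact mul_le_mul_of_nonneg_left h2 (by positivity)

theorem SLC.cos_tau_lower (H : SLC v s b m c) (w : ℝ) :
    1 - w ^ 2 / 2 * var v b ≤ Ex v b (fun x => Real.cos (w * (x - mean v b))) := by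
  have h := H.Ex_mono (f := fun x => 1 - (w ^ 2 / 2) * (x - mean v b) ^ 2)
    (g := fun x => Real.cos (w * (x - mean v b))) (by fun_prop) (by fun_prop)
    (by
      intro x _ _
      have := Real.one_sub_sq_div_two_le_cos (x := w * (x - mean v b))
      nlinarith)
  rw [H.Ex_sub (by fun_prop) (by fun_prop), H.Ex_const, Ex_const_mul] at h
  exact h

theorem SLC.cos_tau_le_one (H : SLC v s b m c) (w : ℝ) :
    Ex v b (fun x => Real.cos (w * (x - mean v b))) ≤ 1 := by
  have := H.Ex_mono (f := fun x => Real.cos (w * (x - mean v b))) (g := fun _ => 1) (by fun_prop)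
    (by fun_prop) (fun x _ _ => Real.cos_le_one _)
  rwa [H.Ex_const] at this

theorem SLC.cos_tau_upper (H : SLC v s b m c) (w : ℝ) :
    Ex v b (fun x => Real.cos (w * (x - mean v b))) ≤
      1 - w ^ 2 / 2 * var v b + w ^ 4 / 24 * (16 / m ^ 2) := by
  have h := H.Ex_mono (g := fun x => 1 - (w ^ 2 / 2) * (x - mean v b) ^ 2
      + (w ^ 4 / 24) * (x - mean v b) ^ 4)
    (f := fun x => Real.cos (w * (x - mean v b))) (by fun_prop) (by fun_prop)
    (by
      intro x _ _
      have := cos_le_quartic (w * (x - mean v b))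
      nlinarith)
  rw [H.Ex_add (by fun_prop) (by fun_prop),
    H.Ex_sub (by fun_prop) (by fun_prop), H.Ex_const, Ex_const_mul, Ex_const_mul] at h
  have h2 := H.k4
  have h3 := mul_le_mul_of_nonneg_left h2 (show 0 ≤ w ^ 4 / 24 by positivity)
  have e : Ex v b (fun x => (x - mean v b) ^ 2) = var v b := rfl
  rw [e] at h
  linarith

theorem SLC.Ex_cos (H : SLC v s b m c) (w : ℝ) :
    Ex v b (fun x => Real.cos (w * x)) =
      Real.cos (w * mean v b) * Ex v b (fun x => Real.cos (w * (x - mean v b))) -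
      Real.sin (w * mean v b) * Ex v b (fun x => Real.sin (w * (x - mean v b))) := by
  rw [← Ex_const_mul, ← Ex_const_mul, ← H.Ex_sub (by fun_prop) (by fun_prop)]
  congr 1; ext x
  rw [← Real.cos_add]; congr 1; ring

theorem SLC.Ex_sin (H : SLC v s b m c) (w : ℝ) :
    Ex v b (fun x => Real.sin (w * x)) =
      Real.sin (w * mean v b) * Ex v b (fun x => Real.cos (w * (x - mean v b))) +
      Real.cos (w * mean v b) * Ex v b (fun x => Real.sin (w * (x - mean v b))) := by
  rw [← Ex_const_mul, ← Ex_const_mul, ← H.Ex_add (by fun_prop) (by fun_prop)]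
  congr 1; ext x
  rw [← Real.sin_add]; congr 1; ring

theorem SLC.Ex_sin_sq (H : SLC v s b m c) (w : ℝ) :
    (Ex v b (fun x => Real.sin (w * x))) ^ 2 ≤
      (Ex v b (fun x => Real.cos (w * (x - mean v b)))) ^ 2 +
      (Ex v b (fun x => Real.sin (w * (x - mean v b)))) ^ 2 := by
  rw [H.Ex_sin]
  set C := Ex v b (fun x => Real.cos (w * (x - mean v b)))
  set S := Ex v b (fun x => Real.sin (w * (x - mean v b)))
  have := Real.sin_sq_add_cos_sq (w * mean v b)
  set p := Real.sin (w * mean v b)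
  set q := Real.cos (w * mean v b)
  have e : C ^ 2 + S ^ 2 = (p ^ 2 + q ^ 2) * (C ^ 2 + S ^ 2) := by rw [this]; ring
  rw [e]
  nlinarith [sq_nonneg (p * S - q * C)]

/-! Stein -/

/-- tail first moment -/
noncomputable def tailm (v : ℝ → ℝ) (b : ℝ) (x : ℝ) : ℝ := - ∫ y in (0:ℝ)..x, (y - mean v b) * v y

theorem SLC.tailm_deriv (H : SLC v s b m c) (x : ℝ) :
    HasDerivAt (tailm v b) (-((x - mean v b) * v x)) x := by
  have hv := H.cont
  have hc : Continuous (fun y => (y - mean v b) * v y) := by fun_prop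
  exact (intervalIntegral.integral_hasDerivAt_right (hc.intervalIntegrable _ _)
    hc.aestronglyMeasurable.stronglyMeasurableAtFilter hc.continuousAt).fun_neg

theorem tailm_zero (v : ℝ → ℝ) (b : ℝ) : tailm v b 0 = 0 := by simp [tailm]

theorem SLC.tailm_b (H : SLC v s b m c) : tailm v b b = 0 := by
  have := H.Ex_tau
  unfold Ex at this
  rw [div_eq_zero_iff] at this
  rcases this with h | h
  · unfold tailm; rw [h]; simp
  · exact absurd h H.Zpos.ne'

theorem nonneg_of_shape {f f' : ℝ → ℝ} {b : ℝ} (hd : ∀ x, HasDerivAt f (f' x) x)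
    (h0 : f 0 = 0) (hb : f b = 0)
    (hs : ∀ x y, 0 < x → x < y → y < b → f' x < 0 → 0 < f' y → False)
    {x : ℝ} (hx0 : 0 < x) (hxb : x < b) : 0 ≤ f x := by
  by_contra hneg
  push Not at hneg
  have hcont : Continuous f := continuous_iff_continuousAt.2 fun x => (hd x).continuousAt
  obtain ⟨p, hp, hp'⟩ := exists_hasDerivAt_eq_slope f f' hx0 hcont.continuousOn (fun x _ => hd x)
  obtain ⟨q, hq, hq'⟩ := exists_hasDerivAt_eq_slope f f' hxb hcont.continuousOn (fun x _ => hd x)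
  refine hs p q hp.1 (hp.2.trans hq.1) hq.2 ?_ ?_
  · rw [hp', h0]; apply div_neg_of_neg_of_pos <;> linarith
  · rw [hq', hb]; apply div_pos <;> linarith

theorem SLC.tailm_nonneg (H : SLC v s b m c) {x : ℝ} (hx0 : 0 < x) (hxb : x < b) :
    0 ≤ tailm v b x := by
  refine nonneg_of_shape H.tailm_deriv (tailm_zero _ _) H.tailm_b ?_ hx0 hxb
  intro x y hx hxy hy h1 h2
  have p1 := H.pos x hx (hxy.trans hy)
  have p2 := H.pos y (hx.trans hxy) hy
  have q1 : 0 < x - mean v b := by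
    by_contra h; push Not at h; nlinarith
  have q2 : y - mean v b < 0 := by
    by_contra h; push Not at h; nlinarith
  linarith

theorem SLC.tailm_le (H : SLC v s b m c) {x : ℝ} (hx0 : 0 < x) (hxb : x < b) :
    tailm v b x ≤ v x / m := by
  have hm := H.hm
  have := nonneg_of_shape (f := fun x => v x / m - tailm v b x)
    (f' := fun x => deriv v x / m - (-((x - mean v b) * v x))) (b := b)
    (fun x => (((H.smooth.differentiable (by norm_num) x).hasDerivAt).div_const m).fun_sub
      (H.tailm_deriv x)) (by rw [H.v0, tailm_zero]; simp) (by rw [H.vb, H.tailm_b]; simp) ?_ hx0 hxb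
  · simpa using this
  intro x y hx hxy hy h1 h2
  have p1 := H.pos x hx (hxy.trans hy)
  have p2 := H.pos y (hx.trans hxy) hy
  rw [H.der x hx (hxy.trans hy)] at h1
  rw [H.der y (hx.trans hxy) hy] at h2
  have h3 := H.mono x y hx hxy hy
  have q1 : s x / m + (x - mean v b) < 0 := by
    by_contra h; push Not at h
    have := mul_nonneg h p1.le
    have e : (s x / m + (x - mean v b)) * v x = s x * v x / m - (-((x - mean v b) * v x)) := by ring
    linarith
  have q2 : 0 < s y / m + (y - mean v b) := by
    by_contra h; push Not at h
    have := mul_nonneg_of_nonpos_of_nonpos h (neg_nonpos.2 p2.le)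
    have e : (s y / m + (y - mean v b)) * -v y = -(s y * v y / m - (-((y - mean v b) * v y))) := by
      ring
    linarith
  have q3 : (s y - s x) / m ≤ - (y - x) := by
    rw [div_le_iff₀ hm]; linarith
  have e : (s y - s x) / m = s y / m - s x / m := by ring
  linarith

section stein
variable {u su : ℝ → ℝ} {mu cu : ℝ}

/-- the Stein quotient function -/
noncomputable def steinF (u v : ℝ → ℝ) (b : ℝ) (x : ℝ) : ℝ := tailm u b x * v x / u x

theorem stein_bd (Hu : SLC u su b mu cu) (Hv : SLC v s b m c) {x : ℝ} (h0 : 0 < x) (h1 : x < b) :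
    0 ≤ steinF u v b x ∧ steinF u v b x ≤ v x / mu := by
  have p1 := Hu.pos x h0 h1
  have p2 := Hv.pos x h0 h1
  have q1 := Hu.tailm_nonneg h0 h1
  have q2 := Hu.tailm_le h0 h1
  have hm := Hu.hm
  unfold steinF
  constructor
  · positivity
  · rw [div_le_div_iff₀ p1 hm]
    rw [le_div_iff₀ hm] at q2
    nlinarith

theorem stein_cont (Hu : SLC u su b mu cu) (Hv : SLC v s b m c) :
    ContinuousOn (steinF u v b) (Icc 0 b) := by
  have hv := Hv.cont
  have hu := Hu.cont
  have hbd : ∀ x ∈ Icc 0 b, |steinF u v b x| ≤ v x / mu := by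
    intro x hx
    rcases hx.1.eq_or_lt with h | h
    · rw [← h]; unfold steinF; rw [Hv.v0]; simp
    rcases hx.2.eq_or_lt with h' | h'
    · rw [h']; unfold steinF; rw [Hv.vb]; simp
    have := stein_bd Hu Hv h h'
    rw [abs_of_nonneg this.1]; exact this.2
  have hend : ∀ p ∈ Icc 0 b, v p = 0 → ContinuousWithinAt (steinF u v b) (Icc 0 b) p := by
    intro p hp hvp
    have e : steinF u v b p = 0 := by unfold steinF; rw [hvp]; simp
    unfold ContinuousWithinAt
    rw [e]
    apply squeeze_zero_norm' (a := fun x => v x / mu)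
    · filter_upwards [self_mem_nhdsWithin] with x hx
      exact hbd x hx
    · have : Filter.Tendsto (fun x => v x / mu) (nhds p) (nhds (v p / mu)) :=
        (hv.div_const mu).tendsto p
      rw [hvp, zero_div] at this
      exact this.mono_left nhdsWithin_le_nhds
  intro x hx
  rcases hx.1.eq_or_lt with h | h
  · exact hend x hx (by rw [← h, Hv.v0])
  rcases hx.2.eq_or_lt with h' | h'
  · exact hend x hx (by rw [h', Hv.vb])
  apply ContinuousAt.continuousWithinAt
  unfold steinF
  exact ((Hu.tailm_deriv x).continuousAt.mul hv.continuousAt).div hu.continuousAt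
    (Hu.pos x h h').ne'

theorem stein_deriv (Hu : SLC u su b mu cu) (Hv : SLC v s b m c) {x : ℝ} (h0 : 0 < x) (h1 : x < b) :
    HasDerivAt (steinF u v b)
      (-((x - mean u b) * v x) - (steinF u v b x / v x) * ((su x - s x) * v x)) x := by
  have p1 := Hu.pos x h0 h1
  have p2 := Hv.pos x h0 h1
  have d1 : HasDerivAt u (su x * u x) x := by
    rw [← Hu.der x h0 h1]; exact (Hu.smooth.differentiable (by norm_num) x).hasDerivAt
  have d2 : HasDerivAt v (s x * v x) x := by
    rw [← Hv.der x h0 h1]; exact (Hv.smooth.differentiable (by norm_num) x).hasDerivAt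
  have := ((Hu.tailm_deriv x).fun_mul d2).fun_div d1 p1.ne'
  refine HasDerivAt.congr_deriv (f := steinF u v b) this ?_
  unfold steinF
  field_simp
  ring

theorem stein_ratio (Hu : SLC u su b mu cu) (Hv : SLC v s b m c) {x : ℝ} (h0 : 0 < x) (h1 : x < b) :
    0 ≤ steinF u v b x / v x ∧ steinF u v b x / v x ≤ 1 / mu := by
  have p2 := Hv.pos x h0 h1
  have := stein_bd Hu Hv h0 h1
  refine ⟨div_nonneg this.1 p2.le, ?_⟩
  rw [div_le_iff₀ p2]
  calc _ ≤ _ := this.2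
    _ = _ := by ring

theorem stein_int (Hv : SLC v s b m c) (e : ℝ) :
    ∫ x in (0:ℝ)..b, ((x - e) * v x) = (mean v b - e) * ∫ x in (0:ℝ)..b, v x := by
  have h := Hv.Ex_sub (f := fun x => x) (g := fun _ => e) (by fun_prop) (by fun_prop)
  rw [Hv.Ex_const] at h
  have hz := Hv.Zpos.ne'
  unfold Ex at h
  rw [div_eq_iff hz] at h
  rw [h]; rfl

theorem stein_upper (Hu : SLC u su b mu cu) (Hv : SLC v s b m c) {w : ℝ → ℝ} (hw : Continuous w)
    (hw0 : ∀ x, 0 < x → x < b → 0 ≤ w x)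
    (h : ∀ x, 0 < x → x < b → (su x - s x) * v x ≤ w x) :
    (mean u b - mean v b) * ∫ x in (0:ℝ)..b, v x ≤ (1 / mu) * ∫ x in (0:ℝ)..b, w x := by
  have hv := Hv.cont
  have key := intervalIntegral.integral_le_sub_of_hasDeriv_right_of_le (g := steinF u v b)
    (g' := fun x => -((x - mean u b) * v x) - (steinF u v b x / v x) * ((su x - s x) * v x))
    (φ := fun x => -((x - mean u b) * v x) - (1 / mu) * w x) Hv.hb.le (stein_cont Hu Hv)
    (fun x hx => (stein_deriv Hu Hv hx.1 hx.2).hasDerivWithinAt)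
    (Continuous.integrableOn_Icc (by fun_prop))
    (by
      intro x hx
      have r := stein_ratio Hu Hv hx.1 hx.2
      have a1 := hw0 x hx.1 hx.2
      have a2 := h x hx.1 hx.2
      have : (steinF u v b x / v x) * ((su x - s x) * v x) ≤ (1 / mu) * w x :=
        (mul_le_mul_of_nonneg_left a2 r.1).trans (mul_le_mul_of_nonneg_right r.2 a1)
      linarith)
  rw [intervalIntegral.integral_sub, intervalIntegral.integral_neg, stein_int Hv,
    intervalIntegral.integral_const_mul] at key
  · have z0 : steinF u v b 0 = 0 := by unfold steinF; rw [Hv.v0]; simp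
    have z1 : steinF u v b b = 0 := by unfold steinF; rw [Hv.vb]; simp
    rw [z0, z1] at key
    nlinarith
  · exact Continuous.intervalIntegrable (by fun_prop) _ _
  · exact Continuous.intervalIntegrable (by fun_prop) _ _

theorem stein_lower (Hu : SLC u su b mu cu) (Hv : SLC v s b m c) {w : ℝ → ℝ} (hw : Continuous w)
    (hw0 : ∀ x, 0 < x → x < b → 0 ≤ w x)
    (h : ∀ x, 0 < x → x < b → -(su x - s x) * v x ≤ w x) :
    (mean v b - mean u b) * ∫ x in (0:ℝ)..b, v x ≤ (1 / mu) * ∫ x in (0:ℝ)..b, w x := by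
  have hv := Hv.cont
  have key := intervalIntegral.sub_le_integral_of_hasDeriv_right_of_le (g := steinF u v b)
    (g' := fun x => -((x - mean u b) * v x) - (steinF u v b x / v x) * ((su x - s x) * v x))
    (φ := fun x => -((x - mean u b) * v x) + (1 / mu) * w x) Hv.hb.le (stein_cont Hu Hv)
    (fun x hx => (stein_deriv Hu Hv hx.1 hx.2).hasDerivWithinAt)
    (Continuous.integrableOn_Icc (by fun_prop))
    (by
      intro x hx
      have r := stein_ratio Hu Hv hx.1 hx.2
      have a1 := hw0 x hx.1 hx.2
      have a2 := h x hx.1 hx.2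
      have : (steinF u v b x / v x) * (-(su x - s x) * v x) ≤ (1 / mu) * w x :=
        (mul_le_mul_of_nonneg_left a2 r.1).trans (mul_le_mul_of_nonneg_right r.2 a1)
      linarith)
  rw [intervalIntegral.integral_add, intervalIntegral.integral_neg, stein_int Hv,
    intervalIntegral.integral_const_mul] at key
  · have z0 : steinF u v b 0 = 0 := by unfold steinF; rw [Hv.v0]; simp
    have z1 : steinF u v b b = 0 := by unfold steinF; rw [Hv.vb]; simp
    rw [z0, z1] at key
    nlinarith
  · exact Continuous.intervalIntegrable (by fun_prop) _ _
  · exact Continuous.intervalIntegrable (by fun_prop) _ _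

end stein

end QP

namespace QP

open intervalIntegral MeasureTheory Set

variable {v s : ℝ → ℝ} {b m c : ℝ}

/-- `v` times an inverse Gaussian -/
noncomputable def vg (v : ℝ → ℝ) (K c x : ℝ) : ℝ := v x * Real.exp (K * (x - c) ^ 2 / 2)

theorem SLC.vg_deriv (H : SLC v s b m c) (K : ℝ) {x : ℝ} (h0 : 0 < x) (h1 : x < b) :
    HasDerivAt (vg v K c) ((s x + K * (x - c)) * vg v K c x) x := by
  have d2 : HasDerivAt v (s x * v x) x := by
    rw [← H.der x h0 h1]; exact (H.smooth.differentiable (by norm_num) x).hasDerivAt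
  have d3 : HasDerivAt (fun x => K * (x - c) ^ 2 / 2) (K * (x - c)) x := by
    have := ((((hasDerivAt_id' x).sub_const c).fun_pow 2).const_mul K).div_const 2
    refine this.congr_deriv ?_
    simp; ring
  have := d2.fun_mul d3.exp
  refine HasDerivAt.congr_deriv (f := vg v K c) this ?_
  unfold vg; ring

theorem SLC.vg_pos (H : SLC v s b m c) (K : ℝ) {x : ℝ} (h0 : 0 < x) (h1 : x < b) :
    0 < vg v K c x := mul_pos (H.pos x h0 h1) (Real.exp_pos _)

theorem SLC.vg_le (H : SLC v s b m c) (K : ℝ) {x y : ℝ} (h0 : 0 < x) (hxy : x ≤ y) (h1 : y < b)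
    (h : ∀ t, x < t → t < y → 0 ≤ s t + K * (t - c)) : vg v K c x ≤ vg v K c y := by
  have := monotoneOn_of_deriv_nonneg (convex_Icc x y) (f := vg v K c)
    (fun t ht => (H.vg_deriv K (h0.trans_le ht.1) (ht.2.trans_lt h1)).continuousAt.continuousWithinAt)
    (fun t ht => by
      rw [interior_Icc] at ht
      exact (H.vg_deriv K (h0.trans ht.1) (ht.2.trans h1)).differentiableAt.differentiableWithinAt)
    (fun t ht => by
      rw [interior_Icc] at ht
      rw [(H.vg_deriv K (h0.trans ht.1) (ht.2.trans h1)).deriv]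
      exact mul_nonneg (h t ht.1 ht.2) (H.vg_pos K (h0.trans ht.1) (ht.2.trans h1)).le)
  exact this ⟨le_refl _, hxy⟩ ⟨hxy, le_refl _⟩ hxy

theorem SLC.vg_ge (H : SLC v s b m c) (K : ℝ) {x y : ℝ} (h0 : 0 < x) (hxy : x ≤ y) (h1 : y < b)
    (h : ∀ t, x < t → t < y → s t + K * (t - c) ≤ 0) : vg v K c y ≤ vg v K c x := by
  have := antitoneOn_of_deriv_nonpos (convex_Icc x y) (f := vg v K c)
    (fun t ht => (H.vg_deriv K (h0.trans_le ht.1) (ht.2.trans_lt h1)).continuousAt.continuousWithinAt)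
    (fun t ht => by
      rw [interior_Icc] at ht
      exact (H.vg_deriv K (h0.trans ht.1) (ht.2.trans h1)).differentiableAt.differentiableWithinAt)
    (fun t ht => by
      rw [interior_Icc] at ht
      rw [(H.vg_deriv K (h0.trans ht.1) (ht.2.trans h1)).deriv]
      exact mul_nonpos_of_nonpos_of_nonneg (h t ht.1 ht.2)
        (H.vg_pos K (h0.trans ht.1) (ht.2.trans h1)).le)
  exact this ⟨le_refl _, hxy⟩ ⟨hxy, le_refl _⟩ hxy

theorem vg_c (v : ℝ → ℝ) (K c : ℝ) : vg v K c c = v c := by simp [vg]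

theorem vg_mul (v : ℝ → ℝ) (K c x : ℝ) : vg v K c x * Real.exp (-(K * (x - c) ^ 2 / 2)) = v x := by
  unfold vg
  rw [mul_assoc, ← Real.exp_add]; simp

theorem SLC.v_le (H : SLC v s b m c) {x : ℝ} (h0 : 0 < x) (h1 : x < b) :
    v x ≤ v c * Real.exp (-(m / 2) * (x - c) ^ 2) := by
  rw [← vg_mul v m c x]
  have e : -(m / 2) * (x - c) ^ 2 = -(m * (x - c) ^ 2 / 2) := by ring
  rw [e]
  apply mul_le_mul_of_nonneg_right _ (Real.exp_pos _).le
  rw [← vg_c v m c]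
  rcases le_total x c with h | h
  · apply H.vg_le m h0 h H.hcb
    intro t ht ht'
    have := H.mono t c (h0.trans ht) ht' H.hcb
    rw [H.sc] at this; linarith
  · apply H.vg_ge m H.hc0 h h1
    intro t ht ht'
    have := H.mono c t H.hc0 ht (ht'.trans h1)
    rw [H.sc] at this; linarith

/-- upper curvature on a window -/
def Win (s : ℝ → ℝ) (c a K : ℝ) : Prop :=
  (∀ t, c - a < t → t < c → s t ≤ K * (c - t)) ∧ (∀ t, c < t → t < c + a → -(K * (t - c)) ≤ s t)

theorem SLC.v_ge (H : SLC v s b m c) {a K : ℝ} (hW : Win s c a K) (ha0 : 0 < c - a) (hab : c + a < b)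
    {x : ℝ} (h0 : c - a ≤ x) (h1 : x ≤ c + a) :
    v c * Real.exp (-(K * (x - c) ^ 2 / 2)) ≤ v x := by
  rw [← vg_mul v K c x]
  apply mul_le_mul_of_nonneg_right _ (Real.exp_pos _).le
  rw [← vg_c v K c]
  rcases le_total x c with h | h
  · apply H.vg_ge K (ha0.trans_le h0) h H.hcb
    intro t ht ht'
    have := hW.1 t (h0.trans_lt ht) ht'
    linarith
  · apply H.vg_le K H.hc0 h (h1.trans_lt hab)
    intro t ht ht'
    have := hW.2 t ht (ht'.trans_le h1)
    linarith

theorem SLC.vc_pos (H : SLC v s b m c) : 0 < v c := H.pos c H.hc0 H.hcb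

theorem SLC.Z_le (H : SLC v s b m c) :
    ∫ x in (0:ℝ)..b, v x ≤ v c * Real.sqrt (Real.pi / (m / 2)) := by
  have hm := H.hm
  have hv := H.cont
  have h1 : ∫ x in (0:ℝ)..b, v x ≤
      ∫ x in (0:ℝ)..b, v c * Real.exp (-(m / 2) * (x - c) ^ 2) :=
    H.int_mono hv (by fun_prop) (fun x h0 h1 => H.v_le h0 h1)
  refine h1.trans ?_
  rw [intervalIntegral.integral_const_mul]
  apply mul_le_mul_of_nonneg_left _ H.vc_pos.le
  rw [intervalIntegral.integral_of_le H.hb.le]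
  have hintg : Integrable (fun x : ℝ => Real.exp (-(m / 2) * (x - c) ^ 2)) :=
    (integrable_exp_neg_mul_sq (by positivity : 0 < m / 2)).comp_sub_right c
  calc _ ≤ ∫ x : ℝ, Real.exp (-(m / 2) * (x - c) ^ 2) :=
        setIntegral_le_integral hintg (Filter.Eventually.of_forall fun x => (Real.exp_pos _).le)
    _ = ∫ x : ℝ, Real.exp (-(m / 2) * x ^ 2) :=
        integral_sub_right_eq_self (fun x : ℝ => Real.exp (-(m / 2) * x ^ 2)) c
    _ = _ := integral_gaussian _

theorem SLC.int_window (H : SLC v s b m c) {a K : ℝ} (hK : 0 ≤ K) (hW : Win s c a K) (ha : 0 ≤ a)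
    (ha0 : 0 < c - a) (hab : c + a < b) {h : ℝ → ℝ} (hc : Continuous h) (hpos : ∀ x, 0 ≤ h x) :
    v c * Real.exp (-(K * a ^ 2 / 2)) * ∫ x in (c - a)..(c + a), h x ≤
      ∫ x in (0:ℝ)..b, h x * v x := by
  have hv := H.cont
  rw [← intervalIntegral.integral_const_mul]
  calc _ ≤ ∫ x in (c - a)..(c + a), h x * v x := by
        apply intervalIntegral.integral_mono_on (by linarith)
          (Continuous.intervalIntegrable (by fun_prop) _ _)
          (Continuous.intervalIntegrable (by fun_prop) _ _)
        intro x hx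
        rw [mul_comm (h x)]
        apply mul_le_mul_of_nonneg_right _ (hpos x)
        refine le_trans ?_ (H.v_ge hW ha0 hab hx.1 hx.2)
        apply mul_le_mul_of_nonneg_left _ H.vc_pos.le
        apply Real.exp_le_exp.2
        have : (x - c) ^ 2 ≤ a ^ 2 := by
          apply sq_le_sq'
          · linarith [hx.1]
          · linarith [hx.2]
        nlinarith
    _ ≤ _ := by
        apply intervalIntegral.integral_mono_interval ha0.le (by linarith) hab.le
        · rw [Filter.EventuallyLE, ae_restrict_iff' measurableSet_Ioc]
          exact Filter.Eventually.of_forall fun x hx =>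
            mul_nonneg (hpos x) (H.nonneg hx.1.le hx.2)
        · exact Continuous.intervalIntegrable (by fun_prop) _ _

theorem SLC.Ex_window (H : SLC v s b m c) {a K : ℝ} (hK : 0 ≤ K) (hW : Win s c a K) (ha : 0 ≤ a)
    (ha0 : 0 < c - a) (hab : c + a < b) {h : ℝ → ℝ} (hc : Continuous h) (hpos : ∀ x, 0 ≤ h x) :
    Real.exp (-(K * a ^ 2 / 2)) / Real.sqrt (Real.pi / (m / 2)) * ∫ x in (c - a)..(c + a), h x ≤
      Ex v b h := by
  have h1 := H.int_window hK hW ha ha0 hab hc hpos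
  have h2 := H.Z_le
  have hm := H.hm
  have h3 : 0 < Real.sqrt (Real.pi / (m / 2)) := Real.sqrt_pos.2 (by positivity)
  unfold Ex
  rw [le_div_iff₀ H.Zpos]
  have h4 : 0 ≤ ∫ x in (c - a)..(c + a), h x :=
    intervalIntegral.integral_nonneg (by linarith) (fun x _ => hpos x)
  set I := ∫ x in (c - a)..(c + a), h x
  set E := Real.exp (-(K * a ^ 2 / 2))
  have hE : 0 < E := Real.exp_pos _
  calc E / √(Real.pi / (m / 2)) * I * ∫ x in (0:ℝ)..b, v x
      ≤ E / √(Real.pi / (m / 2)) * I * (v c * √(Real.pi / (m / 2))) :=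
        mul_le_mul_of_nonneg_left h2 (by positivity)
    _ = v c * E * I := by field_simp
    _ ≤ _ := h1

/-- amplitude bound by the window -/
theorem SLC.sin_window (H : SLC v s b m c) {a K w : ℝ} (hK : 0 ≤ K) (hW : Win s c a K) (ha : 0 < a)
    (ha0 : 0 < c - a) (hab : c + a < b) (hw : 0 < w) :
    |Ex v b (fun x => Real.sin (w * x))| ≤ 1 -
      Real.exp (-(K * a ^ 2 / 2)) / Real.sqrt (Real.pi / (m / 2)) *
        (2 * a - 2 * |Real.sin (w * a)| / w) := by
  have hm := H.hm
  set q := Real.exp (-(K * a ^ 2 / 2)) / Real.sqrt (Real.pi / (m / 2)) with hq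
  have hq0 : 0 ≤ q := by positivity
  have hintg : ∫ x in (c - a)..(c + a), Real.sin (w * x) = 2 * Real.sin (w * c) * Real.sin (w * a) / w := by
    rw [intervalIntegral.integral_comp_mul_left (fun x => Real.sin x) hw.ne', integral_sin]
    have e1 : w * (c - a) = w * c - w * a := by ring
    have e2 : w * (c + a) = w * c + w * a := by ring
    rw [e1, e2, Real.cos_sub, Real.cos_add, smul_eq_mul]
    field_simp; ring
  have hbd : |2 * Real.sin (w * c) * Real.sin (w * a) / w| ≤ 2 * |Real.sin (w * a)| / w := by
    rw [abs_div, abs_mul, abs_mul, abs_of_pos hw]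
    apply div_le_div_of_nonneg_right _ hw.le
    have := Real.abs_sin_le_one (w * c)
    have h2 : |(2:ℝ)| = 2 := by norm_num
    rw [h2]
    nlinarith [abs_nonneg (Real.sin (w * a))]
  rw [abs_le] at hbd
  have hlen : ∫ x in (c - a)..(c + a), (1:ℝ) = 2 * a := by simp; ring
  have p1 := H.Ex_window hK hW ha.le ha0 hab (h := fun x => 1 - Real.sin (w * x)) (by fun_prop)
    (fun x => by linarith [Real.sin_le_one (w * x)])
  have p2 := H.Ex_window hK hW ha.le ha0 hab (h := fun x => 1 + Real.sin (w * x)) (by fun_prop)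
    (fun x => by linarith [Real.neg_one_le_sin (w * x)])
  rw [H.Ex_sub (by fun_prop) (by fun_prop), H.Ex_const, intervalIntegral.integral_sub, hlen,
    hintg, ← hq] at p1
  rotate_left
  · exact Continuous.intervalIntegrable (by fun_prop) _ _
  · exact Continuous.intervalIntegrable (by fun_prop) _ _
  rw [H.Ex_add (by fun_prop) (by fun_prop), H.Ex_const, intervalIntegral.integral_add, hlen,
    hintg, ← hq] at p2
  rotate_left
  · exact Continuous.intervalIntegrable (by fun_prop) _ _
  · exact Continuous.intervalIntegrable (by fun_prop) _ _
  rw [abs_le]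
  constructor
  · have := mul_le_mul_of_nonneg_left hbd.1 hq0
    nlinarith
  · have := mul_le_mul_of_nonneg_left hbd.2 hq0
    nlinarith

/-- variance lower bound by the window -/
theorem SLC.var_window (H : SLC v s b m c) {a K : ℝ} (hK : 0 ≤ K) (hW : Win s c a K) (ha : 0 < a)
    (ha0 : 0 < c - a) (hab : c + a < b) :
    Real.exp (-(K * a ^ 2 / 2)) / Real.sqrt (Real.pi / (m / 2)) * (2 * a ^ 3 / 3) ≤ var v b := by
  have hm := H.hm
  have p1 := H.Ex_window hK hW ha.le ha0 hab (h := fun x => (x - mean v b) ^ 2) (by fun_prop)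
    (fun x => sq_nonneg _)
  refine le_trans ?_ p1
  apply mul_le_mul_of_nonneg_left _ (by positivity)
  rw [intervalIntegral.integral_comp_sub_right (fun x => x ^ 2), integral_pow]
  set e := mean v b
  norm_num
  have : (c + a - e) ^ 3 - (c - a - e) ^ 3 = 2 * a ^ 3 + 6 * a * (c - e) ^ 2 := by ring
  rw [this]
  have : 0 ≤ a * (c - e) ^ 2 := by positivity
  linarith

/-- mass lower bound -/
theorem SLC.Z_ge (H : SLC v s b m c) {a K : ℝ} (hK : 0 ≤ K) (hW : Win s c a K) (ha : 0 < a)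
    (ha0 : 0 < c - a) (hab : c + a < b) :
    v c * Real.exp (-(K * a ^ 2 / 2)) * (2 * a) ≤ ∫ x in (0:ℝ)..b, v x := by
  have p1 := H.int_window hK hW ha.le ha0 hab (h := fun x => 1) (by fun_prop)
    (fun x => zero_le_one)
  have hlen : ∫ x in (c - a)..(c + a), (1:ℝ) = 2 * a := by simp; ring
  rw [hlen] at p1
  simpa using p1

end QP

namespace QP

open Set Real

/-- `x cot x`, with value 1 at 0 -/
noncomputable def phi (x : ℝ) : ℝ := cos x / sinc x
/-- its derivative -/
noncomputable def phid (x : ℝ) : ℝ := cos x / sin x - x / sin x ^ 2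

theorem phi_zero : phi 0 = 1 := by simp [phi]

theorem phi_eq {x : ℝ} (h : x ≠ 0) : phi x = x * (cos x / sin x) := by
  unfold phi
  rw [sinc_of_ne_zero h, div_div_eq_mul_div]; ring

theorem phi_cont : ContinuousOn phi (Ico 0 π) := by
  intro x hx
  apply ContinuousAt.continuousWithinAt
  apply ContinuousAt.div continuous_cos.continuousAt continuous_sinc.continuousAt
  rcases hx.1.eq_or_lt with h | h
  · rw [← h]; simp
  · rw [sinc_of_ne_zero h.ne']
    exact (div_pos (sin_pos_of_pos_of_lt_pi h hx.2) h).ne'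

theorem mul_cos_le_sin {x : ℝ} (h0 : 0 ≤ x) (h1 : x ≤ π) : x * cos x ≤ sin x := by
  rcases lt_or_ge x (π / 2) with h | h
  · have hc := cos_pos_of_mem_Ioo (x := x) ⟨by linarith [pi_pos], h⟩
    have := le_tan h0 h
    rw [tan_eq_sin_div_cos, le_div_iff₀ hc] at this
    exact this
  · have := cos_nonpos_of_pi_div_two_le_of_le h (by linarith)
    have := sin_nonneg_of_nonneg_of_le_pi h0 h1
    nlinarith

theorem phi_hasDeriv {x : ℝ} (h0 : 0 < x) (h1 : x < π) : HasDerivAt phi (phid x) x := by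
  have hs := sin_pos_of_pos_of_lt_pi h0 h1
  have : HasDerivAt (fun x => x * (cos x / sin x)) (phid x) x := by
    have := (hasDerivAt_id' x).fun_mul ((hasDerivAt_cos x).fun_div (hasDerivAt_sin x) hs.ne')
    refine this.congr_deriv ?_
    unfold phid
    have := sin_sq_add_cos_sq x
    field_simp
    linear_combination x * (-1) * this
  refine this.congr_of_eventuallyEq ?_
  filter_upwards [lt_mem_nhds h0] with y hy
  exact phi_eq hy.ne'

theorem phid_hasDeriv {x : ℝ} (h0 : 0 < x) (h1 : x < π) :
    HasDerivAt phid (2 * (x * cos x - sin x) / sin x ^ 3) x := by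
  have hs := sin_pos_of_pos_of_lt_pi h0 h1
  have := ((hasDerivAt_cos x).fun_div (hasDerivAt_sin x) hs.ne').fun_sub
    ((hasDerivAt_id' x).fun_div ((hasDerivAt_sin x).fun_pow 2) (by positivity))
  refine HasDerivAt.congr_deriv (f := phid) this ?_
  have := sin_sq_add_cos_sq x
  field_simp
  simp
  linear_combination sin x ^ 2 * (-1) * this

theorem phi_concave : ConcaveOn ℝ (Ico 0 π) phi := by
  apply concaveOn_of_hasDerivWithinAt2_nonpos (convex_Ico 0 π) phi_cont (f' := phid)
    (f'' := fun x => 2 * (x * cos x - sin x) / sin x ^ 3)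
  · intro x hx; rw [interior_Ico] at *
    exact (phi_hasDeriv hx.1 hx.2).hasDerivWithinAt
  · intro x hx; rw [interior_Ico] at *
    exact (phid_hasDeriv hx.1 hx.2).hasDerivWithinAt
  · intro x hx; rw [interior_Ico] at *
    have hs := sin_pos_of_pos_of_lt_pi hx.1 hx.2
    have := mul_cos_le_sin hx.1.le hx.2.le
    apply div_nonpos_of_nonpos_of_nonneg
    · linarith
    · positivity

theorem phid_anti : AntitoneOn phid (Ioo 0 π) := by
  apply antitoneOn_of_deriv_nonpos (convex_Ioo 0 π)
  · intro x hx; exact (phid_hasDeriv hx.1 hx.2).continuousAt.continuousWithinAt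
  · intro x hx; rw [interior_Ioo] at *
    exact (phid_hasDeriv hx.1 hx.2).differentiableAt.differentiableWithinAt
  · intro x hx; rw [interior_Ioo] at *
    rw [(phid_hasDeriv hx.1 hx.2).deriv]
    have hs := sin_pos_of_pos_of_lt_pi hx.1 hx.2
    have := mul_cos_le_sin hx.1.le hx.2.le
    apply div_nonpos_of_nonpos_of_nonneg
    · linarith
    · positivity

theorem phi_tangent {t x : ℝ} (ht0 : 0 < t) (ht1 : t < π) (hx0 : 0 ≤ x) (hx1 : x < π) :
    phi x ≤ phi t + phid t * (x - t) := by
  rcases lt_trichotomy x t with h | h | h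
  · obtain ⟨p, hp, hp'⟩ := exists_hasDerivAt_eq_slope phi phid h
      (phi_cont.mono fun y hy => ⟨hx0.trans hy.1, hy.2.trans_lt ht1⟩)
      (fun y hy => phi_hasDeriv (hx0.trans_lt hy.1) (hy.2.trans ht1))
    have h2 := phid_anti ⟨hx0.trans_lt hp.1, hp.2.trans ht1⟩ ⟨ht0, ht1⟩ hp.2.le
    rw [eq_div_iff (by linarith)] at hp'
    nlinarith
  · subst h; simp
  · obtain ⟨p, hp, hp'⟩ := exists_hasDerivAt_eq_slope phi phid h
      (phi_cont.mono fun y hy => ⟨ht0.le.trans hy.1, hy.2.trans_lt hx1⟩)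
      (fun y hy => phi_hasDeriv (ht0.trans hy.1) (hy.2.trans hx1))
    have h2 := phid_anti ⟨ht0, ht1⟩ ⟨ht0.trans hp.1, hp.2.trans hx1⟩ hp.1.le
    rw [eq_div_iff (by linarith)] at hp'
    nlinarith

theorem phid_nonpos {t : ℝ} (h0 : 0 < t) (h1 : t < π) : phid t ≤ 0 := by
  have hs := sin_pos_of_pos_of_lt_pi h0 h1
  have e : phid t = (sin t * cos t - t) / sin t ^ 2 := by unfold phid; field_simp
  rw [e]
  apply div_nonpos_of_nonpos_of_nonneg _ (by positivity)
  have := sin_lt h0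
  have := cos_le_one t
  nlinarith

theorem phi_anti {x y : ℝ} (h0 : 0 ≤ x) (hxy : x ≤ y) (h1 : y < π) : phi y ≤ phi x := by
  rcases hxy.eq_or_lt with h | h
  · rw [h]
  have hy := h0.trans_lt h
  have h2 := phi_tangent hy h1 h0 (hxy.trans_lt h1)
  obtain ⟨p, hp, hp'⟩ := exists_hasDerivAt_eq_slope phi phid h
      (phi_cont.mono fun y hy => ⟨h0.trans hy.1, hy.2.trans_lt h1⟩)
      (fun y hy => phi_hasDeriv (h0.trans_lt hy.1) (hy.2.trans h1))
  have h2 := phid_nonpos (h0.trans_lt hp.1) (hp.2.trans h1)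
  rw [eq_div_iff (by linarith)] at hp'
  nlinarith

theorem phi_le_one {x : ℝ} (h0 : 0 ≤ x) (h1 : x < π) : phi x ≤ 1 := by
  rw [← phi_zero]; exact phi_anti (le_refl _) h0 h1

theorem phi_cot_half {t : ℝ} (h0 : 0 < t) (h1 : t < π) (h2 : sin (2 * t) ≠ 0) :
    phi t = t * ((1 + cos (2 * t)) / sin (2 * t)) := by
  rw [phi_eq h0.ne']
  congr 1
  have hs := sin_pos_of_pos_of_lt_pi h0 h1
  rw [div_eq_div_iff hs.ne' h2, cos_two_mul, sin_two_mul]; ring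

theorem phi_lower_small {x : ℝ} (h0 : 0 ≤ x) (h1 : x ≤ 1) : 1 - x ^ 2 / 2 ≤ phi x := by
  unfold phi
  have h2 : 0 < sinc x := by
    rcases h0.eq_or_lt with h | h
    · rw [← h]; simp
    · rw [sinc_of_ne_zero h.ne']
      exact div_pos (sin_pos_of_pos_of_lt_pi h (by linarith [pi_gt_three])) h
  rw [le_div_iff₀ h2]
  have h3 := sinc_le_one x
  have h4 := one_sub_sq_div_two_le_cos (x := x)
  have : 0 ≤ 1 - x ^ 2 / 2 := by nlinarith
  nlinarith

/-! Bennett–Jameson -/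

theorem bj_up {f : ℝ → ℝ} (hf : ConcaveOn ℝ (Ico 0 π) f) {y : ℝ} (hy0 : 0 < y) (hy1 : y < π)
    (p : ℕ) :
    (p + 1 : ℝ) * ∑ k ∈ Finset.range (p + 2), f ((k + 1 : ℕ) * (y / (p + 3))) ≤
      (p + 2 : ℝ) * ∑ k ∈ Finset.range (p + 1), f ((k + 1 : ℕ) * (y / (p + 2))) := by
  -- n = p + 3
  have key : ∀ k ∈ Finset.range (p + 1),
      (p + 1 - k : ℝ) * f ((k + 1 : ℕ) * (y / (p + 3))) + (k + 1) * f ((k + 2 : ℕ) * (y / (p + 3)))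
      ≤ (p + 2 : ℝ) * f ((k + 1 : ℕ) * (y / (p + 2))) := by
    intro k hk
    have hk : (k : ℝ) + 1 ≤ p + 1 := by exact_mod_cast Finset.mem_range.1 hk
    have hk0 : (0:ℝ) ≤ k := Nat.cast_nonneg k
    have hp : (0:ℝ) ≤ p := Nat.cast_nonneg p
    have c1 : ∀ q : ℕ, (q : ℝ) ≤ p + 3 → (q : ℝ) * (y / (p + 3)) ∈ Ico 0 π := by
      intro q hq
      refine ⟨by positivity, ?_⟩
      have : (q : ℝ) * (y / (p + 3)) ≤ (p + 3) * (y / (p + 3)) :=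
        mul_le_mul_of_nonneg_right hq (by positivity)
      have e : ((p:ℝ) + 3) * (y / (p + 3)) = y := by field_simp
      linarith
    have := hf.2 (c1 (k + 1) (by push_cast; linarith)) (c1 (k + 2) (by push_cast; linarith))
      (show (0:ℝ) ≤ (p + 1 - k : ℝ) / (p + 2) by apply div_nonneg <;> linarith)
      (show (0:ℝ) ≤ (k + 1 : ℝ) / (p + 2) by positivity) (by field_simp; ring)
    simp only [smul_eq_mul] at this
    have e : (p + 1 - k : ℝ) / (p + 2) * (((k + 1 : ℕ) : ℝ) * (y / (p + 3))) +
        (k + 1) / (p + 2) * (((k + 2 : ℕ) : ℝ) * (y / (p + 3))) = (k + 1 : ℕ) * (y / (p + 2)) := by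
      push_cast; field_simp; ring
    rw [e] at this
    have h2 : (0:ℝ) < p + 2 := by linarith
    have := mul_le_mul_of_nonneg_left this h2.le
    refine le_trans (le_of_eq ?_) this
    field_simp
  have hs := Finset.sum_le_sum key
  rw [← Finset.mul_sum] at hs
  refine le_trans (le_of_eq ?_) hs
  rw [Finset.sum_add_distrib]
  have e1 : ∑ k ∈ Finset.range (p + 1), (p + 1 - k : ℝ) * f ((k + 1 : ℕ) * (y / (p + 3))) =
      ∑ k ∈ Finset.range (p + 2), (p + 1 - k : ℝ) * f ((k + 1 : ℕ) * (y / (p + 3))) := by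
    rw [Finset.sum_range_succ _ (p + 1)]; push_cast; ring
  have e2 : ∑ k ∈ Finset.range (p + 1), (k + 1 : ℝ) * f ((k + 2 : ℕ) * (y / (p + 3))) =
      ∑ k ∈ Finset.range (p + 2), (k : ℝ) * f ((k + 1 : ℕ) * (y / (p + 3))) := by
    rw [Finset.sum_range_succ' _ (p + 1)]; push_cast; simp [add_assoc, one_add_one_eq_two]
  rw [e1, e2, ← Finset.sum_add_distrib, Finset.mul_sum]
  apply Finset.sum_congr rfl
  intro k _; ring

theorem bj_down {f : ℝ → ℝ} (hf : ConcaveOn ℝ (Ico 0 π) f) {y : ℝ} (hy0 : 0 < y) (hy1 : y < π)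
    (p : ℕ) :
    (p + 3 : ℝ) * ∑ k ∈ Finset.range (p + 2), f ((k : ℕ) * (y / (p + 1))) ≤
      (p + 2 : ℝ) * ∑ k ∈ Finset.range (p + 3), f ((k : ℕ) * (y / (p + 2))) := by
  -- n = p + 2
  have hp : (0:ℝ) ≤ p := Nat.cast_nonneg p
  have c1 : ∀ q : ℕ, (q : ℝ) ≤ p + 1 → (q : ℝ) * (y / (p + 1)) ∈ Ico 0 π := by
    intro q hq
    refine ⟨by positivity, ?_⟩
    have : (q : ℝ) * (y / (p + 1)) ≤ (p + 1) * (y / (p + 1)) :=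
      mul_le_mul_of_nonneg_right hq (by positivity)
    have e : ((p:ℝ) + 1) * (y / (p + 1)) = y := by field_simp
    linarith
  have h2 : (0:ℝ) < p + 2 := by linarith
  have key : ∀ k ∈ Finset.range (p + 3),
      (k : ℝ) * f ((k - 1 : ℕ) * (y / (p + 1))) + (p + 2 - k) * f ((k : ℕ) * (y / (p + 1)))
      ≤ (p + 2 : ℝ) * f ((k : ℕ) * (y / (p + 2))) := by
    intro k hk
    have hk : (k : ℝ) + 1 ≤ p + 3 := by exact_mod_cast Finset.mem_range.1 hk
    have hk0 : (0:ℝ) ≤ k := Nat.cast_nonneg k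
    rcases Nat.eq_zero_or_pos k with h | h
    · subst h; simp
    rcases eq_or_lt_of_le (show (k:ℝ) ≤ p + 2 by linarith) with h' | h'
    · have hkn : k = p + 2 := by exact_mod_cast h'
      subst hkn
      have e : ((p + 2 - 1 : ℕ) : ℝ) * (y / (p + 1)) = ((p + 2 : ℕ) : ℝ) * (y / (p + 2)) := by
        have : p + 2 - 1 = p + 1 := rfl
        rw [this]; push_cast; field_simp
      rw [e]; push_cast; simp
    have hkp : k ≤ p + 1 := by
      have : k < p + 2 := by exact_mod_cast h'
      omega
    have hkp' : (k : ℝ) ≤ p + 1 := by exact_mod_cast hkp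
    have e0 : ((k - 1 : ℕ) : ℝ) = k - 1 := by push_cast [h]; ring
    have := hf.2 (c1 (k - 1) (by rw [e0]; linarith)) (c1 k hkp')
      (show (0:ℝ) ≤ (k : ℝ) / (p + 2) by positivity)
      (show (0:ℝ) ≤ (p + 2 - k : ℝ) / (p + 2) by apply div_nonneg <;> linarith) (by field_simp; ring)
    simp only [smul_eq_mul] at this
    have e : (k : ℝ) / (p + 2) * (((k - 1 : ℕ) : ℝ) * (y / (p + 1))) +
        (p + 2 - k) / (p + 2) * ((k : ℝ) * (y / (p + 1))) = k * (y / (p + 2)) := by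
      rw [e0]; field_simp; ring
    rw [e] at this
    have := mul_le_mul_of_nonneg_left this h2.le
    refine le_trans (le_of_eq ?_) this
    field_simp
  have hs := Finset.sum_le_sum key
  rw [← Finset.mul_sum] at hs
  refine le_trans (le_of_eq ?_) hs
  rw [Finset.sum_add_distrib]
  have e1 : ∑ k ∈ Finset.range (p + 3), (k : ℝ) * f ((k - 1 : ℕ) * (y / (p + 1))) =
      ∑ k ∈ Finset.range (p + 2), (k + 1 : ℝ) * f (k * (y / (p + 1))) := by
    rw [Finset.sum_range_succ' _ (p + 2)]; push_cast; simp
  have e2 : ∑ k ∈ Finset.range (p + 3), (p + 2 - k : ℝ) * f (k * (y / (p + 1))) =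
      ∑ k ∈ Finset.range (p + 2), (p + 2 - k : ℝ) * f (k * (y / (p + 1))) := by
    rw [Finset.sum_range_succ _ (p + 2)]; push_cast; simp
  rw [e1, e2, ← Finset.sum_add_distrib, Finset.mul_sum]
  apply Finset.sum_congr rfl
  intro k _; ring

end QP

namespace QP

open Set Real

noncomputable def Gs (n : ℕ) (y : ℝ) : ℝ := ∑ k ∈ Finset.range n, phi ((k + 1 : ℕ) * (y / n))
noncomputable def Lam (n : ℕ) (y : ℝ) : ℝ := ∑ k ∈ Finset.range (n - 1), phi ((k + 1 : ℕ) * (y / n))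
noncomputable def Rs (n : ℕ) (y : ℝ) : ℝ := ∑ k ∈ Finset.range (n + 1), phi ((k : ℕ) * (y / n))

theorem Lam_mono {y : ℝ} (hy0 : 0 < y) (hy1 : y < π) {q n : ℕ} (hq : 2 ≤ q) (hqn : q ≤ n) :
    (q - 1 : ℝ) * Lam n y ≤ (n - 1 : ℝ) * Lam q y := by
  induction n, hqn using Nat.le_induction with
  | base => exact le_refl _
  | succ n hn ih =>
    obtain ⟨p, rfl⟩ : ∃ p, n = p + 2 := ⟨n - 2, by omega⟩
    have h := bj_up phi_concave hy0 hy1 p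
    have e1 : Lam (p + 2 + 1) y = ∑ k ∈ Finset.range (p + 2), phi ((k + 1 : ℕ) * (y / (p + 3))) := by
      unfold Lam
      have : p + 2 + 1 - 1 = p + 2 := rfl
      rw [this]; push_cast; congr 1; ext k; congr 3; ring
    have e2 : Lam (p + 2) y = ∑ k ∈ Finset.range (p + 1), phi ((k + 1 : ℕ) * (y / (p + 2))) := by
      unfold Lam
      have : p + 2 - 1 = p + 1 := rfl
      rw [this]; push_cast; rfl
    rw [← e1, ← e2] at h
    push_cast at ih ⊢
    have hp : (0:ℝ) ≤ p := Nat.cast_nonneg p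
    have hq' : (2:ℝ) ≤ q := by exact_mod_cast hq
    have a1 := mul_le_mul_of_nonneg_left h (show (0:ℝ) ≤ q - 1 by linarith)
    have a2 := mul_le_mul_of_nonneg_left ih (show (0:ℝ) ≤ p + 2 by linarith)
    have : (p + 1 : ℝ) * ((q - 1 : ℝ) * Lam (p + 2 + 1) y) ≤ (p + 1) * ((p + 2 + 1 - 1) * Lam q y) := by
      nlinarith
    exact le_of_mul_le_mul_left this (by linarith)

theorem Rs_mono {y : ℝ} (hy0 : 0 < y) (hy1 : y < π) {q n : ℕ} (hq : 1 ≤ q) (hqn : q ≤ n) :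
    (n + 1 : ℝ) * Rs q y ≤ (q + 1 : ℝ) * Rs n y := by
  induction n, hqn using Nat.le_induction with
  | base => exact le_refl _
  | succ n hn ih =>
    obtain ⟨p, rfl⟩ : ∃ p, n = p + 1 := ⟨n - 1, by omega⟩
    have h := bj_down phi_concave hy0 hy1 p
    have e1 : Rs (p + 1 + 1) y = ∑ k ∈ Finset.range (p + 3), phi ((k : ℕ) * (y / (p + 2))) := by
      unfold Rs
      push_cast; congr 1; ext k; congr 3; ring
    have e2 : Rs (p + 1) y = ∑ k ∈ Finset.range (p + 2), phi ((k : ℕ) * (y / (p + 1))) := by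
      unfold Rs
      push_cast; rfl
    rw [← e1, ← e2] at h
    push_cast at ih ⊢
    have hp : (0:ℝ) ≤ p := Nat.cast_nonneg p
    have hq' : (1:ℝ) ≤ q := by exact_mod_cast hq
    have a1 := mul_le_mul_of_nonneg_left h (show (0:ℝ) ≤ q + 1 by linarith)
    have a2 := mul_le_mul_of_nonneg_left ih (show (0:ℝ) ≤ p + 3 by linarith)
    have : (p + 2 : ℝ) * ((p + 1 + 1 + 1 : ℝ) * Rs q y) ≤ (p + 2) * ((q + 1) * Rs (p + 1 + 1) y) := by
      nlinarith
    exact le_of_mul_le_mul_left this (by linarith)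

theorem Gs_eq_Lam {n : ℕ} (hn : 1 ≤ n) (y : ℝ) : Gs n y = Lam n y + phi y := by
  obtain ⟨p, rfl⟩ : ∃ p, n = p + 1 := ⟨n - 1, by omega⟩
  unfold Gs Lam
  rw [Finset.sum_range_succ]
  have : ((p + 1 : ℕ) : ℝ) * (y / (p + 1 : ℕ)) = y := by push_cast; field_simp
  rw [this]; rfl

theorem Rs_eq_Gs (n : ℕ) (y : ℝ) : Rs n y = 1 + Gs n y := by
  unfold Rs Gs
  rw [Finset.sum_range_succ']; simp [phi_zero]; ring

theorem phi_half {t S C : ℝ} (h0 : 0 < t) (h1 : t < π) (hS : sin (2 * t) = S) (hC : cos (2 * t) = C)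
    (h2 : S ≠ 0) : phi t = t * ((1 + C) / S) := by
  rw [phi_cot_half h0 h1 (by rw [hS]; exact h2), hS, hC]

theorem Lam_ten : Lam 10 (5 * π / 6) ≤ -(2/5) := by
  have hpi := pi_pos
  have e : Lam 10 (5 * π / 6) = ∑ k ∈ Finset.range 9, phi ((k + 1 : ℕ) * (π / 12)) := by
    unfold Lam
    congr 1; ext k; congr 1; push_cast; ring
  rw [e]
  simp only [Finset.sum_range_succ, Finset.sum_range_zero]
  norm_num
  have h3 : √3 ^ 2 = 3 := by norm_num
  have h3' : √3 ≤ 1.7321 := by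
    rw [sqrt_le_left (by norm_num)]; norm_num
  have h3p : 0 < √3 := by positivity
  have p1 : phi (π / 12) = π / 12 * (2 + √3) := by
    rw [phi_half (t := π/12) (by linarith) (by linarith) (S := 1/2) (C := √3/2)
      (by rw [← sin_pi_div_six]; congr 1; ring) (by rw [← cos_pi_div_six]; congr 1; ring)
      (by norm_num)]
    ring
  have p2 : phi (2 * (π / 12)) = π / 12 * (2 * √3) := by
    rw [phi_half (t := 2 * (π / 12)) (by linarith) (by linarith) (S := √3/2) (C := 1/2)
      (by rw [← sin_pi_div_three]; congr 1; ring) (by rw [← cos_pi_div_three]; congr 1; ring)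
      (by positivity)]
    field_simp; rw [h3]; norm_num
  have p3 : phi (3 * (π / 12)) = π / 12 * 3 := by
    rw [phi_half (t := 3 * (π / 12)) (by linarith) (by linarith) (S := 1) (C := 0)
      (by rw [← sin_pi_div_two]; congr 1; ring) (by rw [← cos_pi_div_two]; congr 1; ring)
      (by positivity)]
    ring
  have p4 : phi (4 * (π / 12)) = π / 12 * (4 * √3 / 3) := by
    rw [phi_half (t := 4 * (π / 12)) (by linarith) (by linarith) (S := √3/2) (C := -(1/2))
      (by rw [← sin_pi_div_three, ← sin_pi_sub]; congr 1; ring)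
      (by rw [← cos_pi_div_three, ← cos_pi_sub]; congr 1; ring)
      (by positivity)]
    field_simp; rw [h3]; norm_num
  have p5 : phi (5 * (π / 12)) = π / 12 * (5 * (2 - √3)) := by
    rw [phi_half (t := 5 * (π / 12)) (by linarith) (by linarith) (S := 1/2) (C := -(√3/2))
      (by rw [← sin_pi_div_six, ← sin_pi_sub]; congr 1; ring)
      (by rw [← cos_pi_div_six, ← cos_pi_sub]; congr 1; ring)
      (by positivity)]
    ring
  have p6 : phi (6 * (π / 12)) = 0 := by
    have : 6 * (π / 12) = π / 2 := by ring
    rw [this]; unfold phi; simp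
  have p7 : phi (7 * (π / 12)) = π / 12 * (-7 * (2 - √3)) := by
    rw [phi_half (t := 7 * (π / 12)) (by linarith) (by linarith) (S := -(1/2)) (C := -(√3/2))
      (by rw [← sin_pi_div_six, ← sin_add_pi]; congr 1; ring)
      (by rw [← cos_pi_div_six, ← cos_add_pi]; congr 1; ring)
      (by norm_num)]
    ring
  have p8 : phi (8 * (π / 12)) = π / 12 * (-8 * √3 / 3) := by
    rw [phi_half (t := 8 * (π / 12)) (by linarith) (by linarith) (S := -(√3/2)) (C := -(1/2))
      (by rw [← sin_pi_div_three, ← sin_add_pi]; congr 1; ring)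
      (by rw [← cos_pi_div_three, ← cos_add_pi]; congr 1; ring)
      (by simp)]
    field_simp; rw [h3]; norm_num
  have p9 : phi (9 * (π / 12)) = π / 12 * (-9) := by
    rw [phi_half (t := 9 * (π / 12)) (by linarith) (by linarith) (S := -1) (C := 0)
      (by rw [← sin_pi_div_two, ← sin_add_pi]; congr 1; ring)
      (by rw [← neg_zero, ← cos_pi_div_two, ← cos_add_pi]; congr 1; ring)
      (by norm_num)]
    ring
  rw [p1, p2, p3, p4, p5, p6, p7, p8, p9]
  have : 3.14 < π := pi_gt_d2
  nlinarith

theorem Rs_six : 1 / 20 ≤ Rs 6 (3 * π / 4) := by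
  have hpi := pi_pos
  have e : Rs 6 (3 * π / 4) = ∑ k ∈ Finset.range 7, phi ((k : ℕ) * (π / 8)) := by
    unfold Rs
    congr 1; ext k; congr 1; push_cast; ring
  rw [e]
  simp only [Finset.sum_range_succ, Finset.sum_range_zero]
  norm_num
  rw [phi_zero]
  have h3 : √2 ^ 2 = 2 := by norm_num
  have h3' : √2 ≤ 1.4143 := by
    rw [sqrt_le_left (by norm_num)]; norm_num
  have h3p : 0 < √2 := by positivity
  have p1 : phi (π / 8) = π / 8 * (1 + √2) := by
    rw [phi_half (t := π/8) (by linarith) (by linarith) (S := √2/2) (C := √2/2)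
      (by rw [← sin_pi_div_four]; congr 1; ring) (by rw [← cos_pi_div_four]; congr 1; ring)
      (by positivity)]
    field_simp; linear_combination (-1 : ℝ) * h3
  have p2 : phi (2 * (π / 8)) = π / 8 * 2 := by
    rw [phi_half (t := 2 * (π / 8)) (by linarith) (by linarith) (S := 1) (C := 0)
      (by rw [← sin_pi_div_two]; congr 1; ring) (by rw [← cos_pi_div_two]; congr 1; ring)
      (by positivity)]
    ring
  have p3 : phi (3 * (π / 8)) = π / 8 * (3 * (√2 - 1)) := by
    rw [phi_half (t := 3 * (π / 8)) (by linarith) (by linarith) (S := √2/2) (C := -(√2/2))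
      (by rw [← sin_pi_div_four, ← sin_pi_sub]; congr 1; ring)
      (by rw [← cos_pi_div_four, ← cos_pi_sub]; congr 1; ring)
      (by positivity)]
    field_simp; linear_combination (-1 : ℝ) * h3
  have p4 : phi (4 * (π / 8)) = 0 := by
    have : 4 * (π / 8) = π / 2 := by ring
    rw [this]; unfold phi; simp
  have p5 : phi (5 * (π / 8)) = π / 8 * (-5 * (√2 - 1)) := by
    rw [phi_half (t := 5 * (π / 8)) (by linarith) (by linarith) (S := -(√2/2)) (C := -(√2/2))
      (by rw [← sin_pi_div_four, ← sin_add_pi]; congr 1; ring)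
      (by rw [← cos_pi_div_four, ← cos_add_pi]; congr 1; ring)
      (by simp)]
    field_simp; linear_combination (1 : ℝ) * h3
  have p6 : phi (6 * (π / 8)) = π / 8 * (-6) := by
    rw [phi_half (t := 6 * (π / 8)) (by linarith) (by linarith) (S := -1) (C := 0)
      (by rw [← sin_pi_div_two, ← sin_add_pi]; congr 1; ring)
      (by rw [← neg_zero, ← cos_pi_div_two, ← cos_add_pi]; congr 1; ring)
      (by norm_num)]
    ring
  rw [p1, p2, p3, p4, p5, p6]
  have : π < 3.1416 := pi_lt_d4
  nlinarith

/-! the weight -/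

/-- the major arc weight -/
noncomputable def vv (n j : ℕ) (X : ℝ) : ℝ :=
  sin (X / 2 / n) ^ j * ∏ k ∈ Finset.range n, (2 * sin ((k + 1 : ℕ) * (X / 2 / n)))

noncomputable def ss (n j : ℕ) (X : ℝ) : ℝ :=
  ∑ k ∈ Finset.range n, ((k + 1 : ℕ) / (2 * n) : ℝ) *
      (cos ((k + 1 : ℕ) * (X / 2 / n)) / sin ((k + 1 : ℕ) * (X / 2 / n))) +
    j / (2 * n) * (cos (X / 2 / n) / sin (X / 2 / n))

theorem ang_bd {n k : ℕ} (hk : k < n) {X : ℝ} (h0 : 0 < X) (h1 : X < 2 * π) :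
    0 < (k + 1 : ℕ) * (X / 2 / n) ∧ (k + 1 : ℕ) * (X / 2 / n) ≤ X / 2 ∧
    (k + 1 : ℕ) * (X / 2 / n) < π := by
  have hn : (0:ℝ) < n := by exact_mod_cast (by omega : 0 < n)
  have hk' : ((k + 1 : ℕ) : ℝ) ≤ n := by exact_mod_cast hk
  have h2 : (k + 1 : ℕ) * (X / 2 / n) ≤ X / 2 := by
    calc _ ≤ (n : ℝ) * (X / 2 / n) := mul_le_mul_of_nonneg_right hk' (by positivity)
      _ = _ := by field_simp
  refine ⟨by positivity, h2, by linarith⟩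

theorem ang_bd1 {n : ℕ} (hn : 1 ≤ n) {X : ℝ} (h0 : 0 < X) (h1 : X < 2 * π) :
    0 < X / 2 / n ∧ X / 2 / n ≤ X / 2 ∧ X / 2 / n < π := by
  have := ang_bd (n := n) (k := 0) (by omega) h0 h1
  simpa using this

theorem vv_pos {n : ℕ} (j : ℕ) (hn : 1 ≤ n) {X : ℝ} (h0 : 0 < X) (h1 : X < 2 * π) :
    0 < vv n j X := by
  unfold vv
  apply mul_pos
  · apply pow_pos
    have := ang_bd1 hn h0 h1
    exact sin_pos_of_pos_of_lt_pi this.1 this.2.2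
  · apply Finset.prod_pos
    intro k hk
    have := ang_bd (Finset.mem_range.1 hk) h0 h1
    have := sin_pos_of_pos_of_lt_pi this.1 this.2.2
    linarith

theorem ss_mul {n : ℕ} (j : ℕ) (hn : 1 ≤ n) {X : ℝ} (h0 : 0 < X) :
    X * ss n j X = Gs n (X / 2) + j * phi (X / 2 / n) := by
  have hn' : (0:ℝ) < n := by exact_mod_cast hn
  unfold ss Gs
  rw [mul_add, Finset.mul_sum]
  congr 1
  · apply Finset.sum_congr rfl
    intro k _
    rw [phi_eq (by positivity)]
    field_simp
  · rw [phi_eq (by positivity)]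
    field_simp

theorem vv_smooth (n j : ℕ) : ContDiff ℝ 1 (vv n j) := by
  unfold vv
  fun_prop

theorem vv_deriv {n : ℕ} (j : ℕ) (hn : 1 ≤ n) {X : ℝ} (h0 : 0 < X) (h1 : X < 2 * π) :
    deriv (vv n j) X = ss n j X * vv n j X := by
  have hv := vv_pos j hn h0 h1
  have hn' : (0:ℝ) < n := by exact_mod_cast hn
  have key : logDeriv (vv n j) X = ss n j X := by
    unfold vv
    have a1 := ang_bd1 hn h0 h1
    have s1 := sin_pos_of_pos_of_lt_pi a1.1 a1.2.2
    have s2 : ∀ k ∈ Finset.range n, 2 * sin ((k + 1 : ℕ) * (X / 2 / n)) ≠ 0 := by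
      intro k hk
      have := ang_bd (Finset.mem_range.1 hk) h0 h1
      have := sin_pos_of_pos_of_lt_pi this.1 this.2.2
      linarith
    rw [logDeriv_mul X (by positivity) (Finset.prod_ne_zero_iff.2 s2) (by fun_prop) (by fun_prop),
      logDeriv_prod s2 (by intro i _; fun_prop), add_comm]
    unfold ss
    congr 1
    · apply Finset.sum_congr rfl
      intro k hk
      have hd : HasDerivAt (fun X : ℝ => 2 * sin ((k + 1 : ℕ) * (X / 2 / n)))
          (2 * (cos ((k + 1 : ℕ) * (X / 2 / n)) * ((k + 1 : ℕ) * (1 / 2 / n)))) X :=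
        (((((hasDerivAt_id' X).div_const 2).div_const (n:ℝ)).const_mul _).sin).const_mul 2
      rw [logDeriv_apply, hd.deriv]
      have := s2 k hk
      have : sin ((k + 1 : ℕ) * (X / 2 / n)) ≠ 0 := by
        intro h; rw [h] at this; simp at this
      generalize sin (((k + 1 : ℕ) : ℝ) * (X / 2 / n)) = S at *
      generalize cos (((k + 1 : ℕ) : ℝ) * (X / 2 / n)) = C at *
      field_simp
    · have hd : HasDerivAt (fun X : ℝ => sin (X / 2 / n)) (cos (X / 2 / n) * (1 / 2 / n)) X :=
        ((((hasDerivAt_id' X).div_const 2).div_const (n:ℝ)).sin)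
      rw [logDeriv_fun_pow (by fun_prop), logDeriv_apply, hd.deriv]
      generalize sin (X / 2 / n) = S at *
      generalize cos (X / 2 / n) = C at *
      field_simp
  rw [logDeriv_apply] at key
  rw [← key, div_mul_cancel₀ _ hv.ne']

theorem cot_mono {x y : ℝ} (h0 : 0 < x) (hxy : x ≤ y) (h1 : y < π) :
    cos y / sin y - cos x / sin x ≤ -(y - x) := by
  have hd : ∀ t ∈ Icc x y, HasDerivAt (fun t => cos t / sin t + t) (-1 / sin t ^ 2 + 1) t := by
    intro t ht
    have hs := sin_pos_of_pos_of_lt_pi (h0.trans_le ht.1) (ht.2.trans_lt h1)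
    have := ((hasDerivAt_cos t).fun_div (hasDerivAt_sin t) hs.ne').fun_add (hasDerivAt_id' t)
    refine this.congr_deriv ?_
    have := sin_sq_add_cos_sq t
    congr 2; linarith
  have := antitoneOn_of_deriv_nonpos (convex_Icc x y)
    (fun t ht => (hd t ht).continuousAt.continuousWithinAt)
    (fun t ht => (hd t (interior_subset ht)).differentiableAt.differentiableWithinAt)
    (fun t ht => by
      have ht := interior_subset ht
      rw [(hd t ht).deriv]
      have hs := sin_pos_of_pos_of_lt_pi (h0.trans_le ht.1) (ht.2.trans_lt h1)
      have : 1 ≤ 1 / sin t ^ 2 := by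
        rw [le_div_iff₀ (by positivity)]
        have := sin_le_one t
        nlinarith
      have e : -1 / sin t ^ 2 = - (1 / sin t ^ 2) := by ring
      rw [e]; linarith)
  have := this ⟨le_refl x, hxy⟩ ⟨hxy, le_refl y⟩ hxy
  simp only at this
  linarith

theorem sum_sq_lower (n : ℕ) : (n:ℝ) ^ 3 / 3 ≤ ∑ k ∈ Finset.range n, ((k + 1 : ℕ) : ℝ) ^ 2 := by
  induction n with
  | zero => simp
  | succ n ih =>
    rw [Finset.sum_range_succ]
    push_cast at *
    have : (0:ℝ) ≤ n := Nat.cast_nonneg n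
    nlinarith

theorem ss_mono {n : ℕ} (j : ℕ) (hn : 1 ≤ n) {x y : ℝ} (h0 : 0 < x) (hxy : x < y) (h1 : y < 2 * π) :
    ss n j y - ss n j x ≤ -(n / 12 : ℝ) * (y - x) := by
  have hn' : (0:ℝ) < n := by exact_mod_cast hn
  have t1 : ∀ k ∈ Finset.range n, ((k + 1 : ℕ) / (2 * n) : ℝ) *
      (cos ((k + 1 : ℕ) * (y / 2 / n)) / sin ((k + 1 : ℕ) * (y / 2 / n))) -
      ((k + 1 : ℕ) / (2 * n) : ℝ) *
      (cos ((k + 1 : ℕ) * (x / 2 / n)) / sin ((k + 1 : ℕ) * (x / 2 / n))) ≤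
      (-(y - x) / (4 * n ^ 2)) * ((k + 1 : ℕ) : ℝ) ^ 2 := by
    intro k hk
    have a1 := ang_bd (Finset.mem_range.1 hk) h0 (hxy.trans h1)
    have a2 := ang_bd (Finset.mem_range.1 hk) (h0.trans hxy) h1
    have h := cot_mono a1.1 (by gcongr) a2.2.2
    rw [← mul_sub]
    calc _ ≤ ((k + 1 : ℕ) / (2 * n) : ℝ) * -((k + 1 : ℕ) * (y / 2 / n) - (k + 1 : ℕ) * (x / 2 / n)) :=
          mul_le_mul_of_nonneg_left h (by positivity)
      _ = _ := by field_simp; ring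
  have hs := Finset.sum_le_sum t1
  rw [Finset.sum_sub_distrib, ← Finset.mul_sum] at hs
  have a1 := ang_bd1 hn h0 (hxy.trans h1)
  have a2 := ang_bd1 hn (h0.trans hxy) h1
  have h := cot_mono a1.1 (show x / 2 / n ≤ y / 2 / n by gcongr) a2.2.2
  have hle : x / 2 / n ≤ y / 2 / n := by gcongr
  have h3 : (j : ℝ) / (2 * n) * (cos (y / 2 / n) / sin (y / 2 / n)) -
      j / (2 * n) * (cos (x / 2 / n) / sin (x / 2 / n)) ≤ 0 := by
    rw [← mul_sub]
    apply mul_nonpos_of_nonneg_of_nonpos (by positivity)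
    linarith
  have h4 : (-(y - x) / (4 * n ^ 2)) * ∑ k ∈ Finset.range n, ((k + 1 : ℕ) : ℝ) ^ 2 ≤
      -(n / 12 : ℝ) * (y - x) := by
    have h5 := sum_sq_lower n
    have h6 : -(y - x) / (4 * n ^ 2) ≤ 0 :=
      div_nonpos_of_nonpos_of_nonneg (by linarith) (by positivity)
    calc _ ≤ (-(y - x) / (4 * n ^ 2)) * ((n:ℝ) ^ 3 / 3) := mul_le_mul_of_nonpos_left h5 h6
      _ = _ := by field_simp; ring
  unfold ss
  linarith

theorem vv_zero {n : ℕ} (j : ℕ) (hn : 1 ≤ n) : vv n j 0 = 0 := by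
  unfold vv
  apply mul_eq_zero_of_right
  apply Finset.prod_eq_zero (i := 0) (by simp; omega)
  simp

theorem vv_two_pi {n : ℕ} (j : ℕ) (hn : 1 ≤ n) : vv n j (2 * π) = 0 := by
  have hn' : (n:ℝ) ≠ 0 := by positivity
  unfold vv
  apply mul_eq_zero_of_right
  apply Finset.prod_eq_zero (i := n - 1) (by simp; omega)
  have e : ((n - 1 + 1 : ℕ) : ℝ) = n := by
    congr 1; omega
  rw [e]
  have : (n:ℝ) * (2 * π / 2 / n) = π := by field_simp
  rw [this]; simp

theorem vv_slc {n : ℕ} (j : ℕ) (hn : 1 ≤ n) : ∃ c, SLC (vv n j) (ss n j) (2 * π) (n / 12) c := by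
  have hpi := pi_pos
  have hc := (vv_smooth n j).continuous
  obtain ⟨c, hc1, hc2⟩ := isCompact_Icc.exists_isMaxOn (s := Icc 0 (2 * π))
    ⟨0, by simp; positivity⟩ hc.continuousOn
  have hp := vv_pos j hn (X := π) hpi (by linarith)
  have hpc : vv n j π ≤ vv n j c := hc2 (show π ∈ Icc 0 (2 * π) from ⟨hpi.le, by linarith⟩)
  have c0 : 0 < c := by
    rcases hc1.1.eq_or_lt with h | h
    · rw [← h, vv_zero j hn] at hpc; linarith
    · exact h
  have cb : c < 2 * π := by
    rcases hc1.2.eq_or_lt with h | h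
    · rw [h, vv_two_pi j hn] at hpc; linarith
    · exact h
  have hloc : IsLocalMax (vv n j) c := hc2.isLocalMax (Icc_mem_nhds c0 cb)
  have hd := hloc.deriv_eq_zero
  rw [vv_deriv j hn c0 cb] at hd
  have hvc := vv_pos j hn c0 cb
  refine ⟨c, ⟨by positivity, ?_, c0, cb, vv_smooth n j, vv_zero j hn, vv_two_pi j hn,
    fun x h0 h1 => vv_pos j hn h0 h1, fun x h0 h1 => vv_deriv j hn h0 h1,
    fun x y h0 hxy h1 => ss_mono j hn h0 hxy h1, ?_⟩⟩
  · have : (0:ℝ) < n := by exact_mod_cast hn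
    positivity
  · rcases mul_eq_zero.1 hd with h | h
    · exact h
    · exact absurd h hvc.ne'

end QP

namespace QP

open Set Real

theorem pi_lo : 3.14159 < π := by have := pi_gt_d6; linarith
theorem pi_hi : π < 3.1416 := pi_lt_d4

/-- derivative of `X * ss` -/
noncomputable def gp (n j : ℕ) (X : ℝ) : ℝ :=
  ∑ k ∈ Finset.range n, ((k + 1 : ℕ) / (2 * n) : ℝ) * phid ((k + 1 : ℕ) * (X / 2 / n)) +
    j / (2 * n) * phid (X / 2 / n)

theorem G_tangent {n : ℕ} (j : ℕ) (hn : 1 ≤ n) {t x : ℝ} (ht0 : 0 < t) (ht1 : t < 2 * π)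
    (hx0 : 0 < x) (hx1 : x < 2 * π) :
    x * ss n j x ≤ t * ss n j t + gp n j t * (x - t) := by
  have hn' : (0:ℝ) < n := by exact_mod_cast hn
  rw [ss_mul j hn hx0, ss_mul j hn ht0]
  unfold gp Gs
  have h1 : ∀ k ∈ Finset.range n, phi ((k + 1 : ℕ) * (x / 2 / n)) ≤
      phi ((k + 1 : ℕ) * (t / 2 / n)) +
      ((k + 1 : ℕ) / (2 * n) : ℝ) * phid ((k + 1 : ℕ) * (t / 2 / n)) * (x - t) := by
    intro k hk
    have a1 := ang_bd (Finset.mem_range.1 hk) hx0 hx1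
    have a2 := ang_bd (Finset.mem_range.1 hk) ht0 ht1
    have := phi_tangent a2.1 a2.2.2 a1.1.le a1.2.2
    refine this.trans (le_of_eq ?_)
    field_simp
  have h2 := Finset.sum_le_sum h1
  rw [Finset.sum_add_distrib, ← Finset.sum_mul] at h2
  have a1 := ang_bd1 hn hx0 hx1
  have a2 := ang_bd1 hn ht0 ht1
  have h3 := phi_tangent a2.1 a2.2.2 a1.1.le a1.2.2
  have h4 := mul_le_mul_of_nonneg_left h3 (Nat.cast_nonneg (α := ℝ) j)
  have e : (j : ℝ) * (phi (t / 2 / n) + phid (t / 2 / n) * (x / 2 / n - t / 2 / n)) =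
     j * phi (t / 2 / n) + j / (2 * n) * phid (t / 2 / n) * (x - t) := by
    field_simp
  rw [e] at h4
  rw [add_mul]
  linarith

theorem gp_bound {n j : ℕ} (hn : 800 ≤ n) (hj : j ≤ 1) {X : ℝ} (h0 : 0 < X)
    (hU : (n + 1 : ℝ) * (X / 2 / n) < π) :
    -(X * gp n j X) ≤ Gs n (X / 2) - n * phi ((n + 1 : ℝ) * (X / 2 / n)) + 1 / 1000 := by
  have hn1 : 1 ≤ n := by omega
  have hn' : (0:ℝ) < n := by exact_mod_cast hn1
  have hn8 : (800:ℝ) ≤ n := by exact_mod_cast hn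
  set h := X / 2 / n with hh
  have hh0 : 0 < h := by positivity
  have eX : X = 2 * n * h := by rw [hh]; field_simp
  have key : ∀ k : ℕ, k < n → -((k + 1 : ℕ) * h * phid ((k + 1 : ℕ) * h)) ≤
      (k + 1 : ℕ) * (phi ((k + 1 : ℕ) * h) - phi ((k + 2 : ℕ) * h)) := by
    intro k hk
    have b2 : ((k + 2 : ℕ) : ℝ) * h < π := by
      have : ((k + 2 : ℕ) : ℝ) ≤ n + 1 := by exact_mod_cast (by omega : k + 2 ≤ n + 1)
      nlinarith
    have b1 : ((k + 1 : ℕ) : ℝ) * h < π := by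
      push_cast at *; nlinarith
    have := phi_tangent (t := (k + 1 : ℕ) * h) (x := (k + 2 : ℕ) * h) (by positivity) b1
      (by positivity) b2
    have e : ((k + 2 : ℕ) : ℝ) * h - (k + 1 : ℕ) * h = h := by push_cast; ring
    rw [e] at this
    have h3 : (0:ℝ) ≤ (k + 1 : ℕ) := by positivity
    nlinarith
  have tel : ∀ q : ℕ, ∑ k ∈ Finset.range q, ((k + 1 : ℕ) : ℝ) * (phi ((k + 1 : ℕ) * h) - phi ((k + 2 : ℕ) * h))
      = ∑ k ∈ Finset.range q, phi ((k + 1 : ℕ) * h) - q * phi ((q + 1 : ℕ) * h) := by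
    intro q
    induction q with
    | zero => simp
    | succ q ih =>
      rw [Finset.sum_range_succ, Finset.sum_range_succ, ih]; push_cast
      have : ((q:ℝ) + 1 + 1) = q + 2 := by ring
      rw [this]; ring
  have hs := Finset.sum_le_sum (fun k hk => key k (Finset.mem_range.1 hk))
  rw [tel] at hs
  have hG : Gs n (X / 2) = ∑ k ∈ Finset.range n, phi ((k + 1 : ℕ) * h) := rfl
  have e1 : X * gp n j X = ∑ k ∈ Finset.range n, (k + 1 : ℕ) * h * phid ((k + 1 : ℕ) * h) +
      j * (h * phid h) := by
    unfold gp
    rw [← hh, mul_add, Finset.mul_sum]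
    congr 1
    · apply Finset.sum_congr rfl
      intro k _
      rw [eX]; field_simp
    · rw [eX]; field_simp
  rw [Finset.sum_neg_distrib] at hs
  have hj' : (j:ℝ) ≤ 1 := by exact_mod_cast hj
  have hj0 : (0:ℝ) ≤ j := Nat.cast_nonneg j
  have h5 : -(j * (h * phid h)) ≤ 1 / 1000 := by
    have hk := key 0 (by omega)
    norm_num at hk
    have b : h ≤ 1 / 100 := by
      have : (801:ℝ) * h ≤ (n + 1) * h := mul_le_mul_of_nonneg_right (by linarith) hh0.le
      have := pi_hi
      linarith
    have l1 := phi_le_one hh0.le (by linarith [pi_lo])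
    have l2 := phi_lower_small (x := 2 * h) (by positivity) (by linarith)
    have l3 : -(h * phid h) ≤ 1 / 1000 := by nlinarith
    nlinarith
  have e2 : ((n + 1 : ℕ) : ℝ) = n + 1 := by push_cast; ring
  rw [e2] at hs
  rw [e1, hG]
  linarith

theorem cot_anti {x y : ℝ} (h0 : 0 < x) (hxy : x ≤ y) (h1 : y < π) :
    cos y / sin y ≤ cos x / sin x := by
  have := cot_mono h0 hxy h1
  linarith

theorem negcot_le {U d : ℝ} (h0 : 0 < U) (hU : U ≤ 5 * π / 6 + d) (hd0 : 0 ≤ d) (hd : d ≤ 1 / 10) :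
    -(cos U / sin U) ≤ (0.86603 + d / 2) / (0.5 - d ^ 2 / 4 - 0.86603 * d) := by
  have p1 := pi_lo
  have p2 := pi_hi
  have h1 := cot_anti h0 hU (by linarith)
  have s1 : sin (5 * π / 6 + d) = sin (π / 6 - d) := by
    rw [← sin_pi_sub]; congr 1; ring
  have c1 : cos (5 * π / 6 + d) = - cos (π / 6 - d) := by
    rw [← cos_pi_sub]; congr 1; ring
  rw [s1, c1, sin_sub, cos_sub, sin_pi_div_six, cos_pi_div_six] at h1
  have h3' : √3 ≤ 1.73206 := by
    rw [sqrt_le_left (by norm_num)]; norm_num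
  have h3p : 0 < √3 := by positivity
  have q1 := one_sub_sq_div_two_le_cos (x := d)
  have q2 := cos_le_one d
  have q3 := sin_le hd0
  have q4 := sin_nonneg_of_nonneg_of_le_pi hd0 (by linarith)
  have N : √3 / 2 * cos d + 1 / 2 * sin d ≤ 0.86603 + d / 2 := by nlinarith
  have D : 0.5 - d ^ 2 / 4 - 0.86603 * d ≤ 1 / 2 * cos d - √3 / 2 * sin d := by nlinarith
  have D0 : 0 < 0.5 - d ^ 2 / 4 - 0.86603 * d := by nlinarith
  have : (√3 / 2 * cos d + 1 / 2 * sin d) / (1 / 2 * cos d - √3 / 2 * sin d) ≤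
      (0.86603 + d / 2) / (0.5 - d ^ 2 / 4 - 0.86603 * d) :=
    div_le_div₀ (by linarith) N D0 D
  rw [neg_div] at h1
  linarith

section mode
variable {n j : ℕ} {c : ℝ}

theorem mode_hi (hn : 800 ≤ n) (hj : j ≤ 1) (H : SLC (vv n j) (ss n j) (2 * π) (n / 12) c) :
    c < 5 * π / 3 := by
  by_contra hc
  push Not at hc
  have p1 := pi_lo
  have p2 := pi_hi
  have hn1 : 1 ≤ n := by omega
  have hn8 : (800:ℝ) ≤ n := by exact_mod_cast hn
  have hj' : (j:ℝ) ≤ 1 := by exact_mod_cast hj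
  have hs : 0 ≤ ss n j (5 * π / 3) := by
    rcases hc.eq_or_lt with h | h
    · rw [h, H.sc]
    · have := ss_mono j hn1 (x := 5 * π / 3) (y := c) (by positivity) h H.hcb
      rw [H.sc] at this
      nlinarith
  have h1 := ss_mul j hn1 (X := 5 * π / 3) (by positivity)
  have e : 5 * π / 3 / 2 = 5 * π / 6 := by ring
  rw [e, Gs_eq_Lam hn1] at h1
  have h2 := Lam_mono (y := 5 * π / 6) (by positivity) (by linarith) (q := 10) (n := n)
    (by norm_num) (by omega)
  have h3 := Lam_ten
  have h4 : phi (5 * π / 6) ≤ -1 := by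
    rw [phi_eq (by positivity)]
    have s1 : sin (5 * π / 6) = 1 / 2 := by
      rw [← sin_pi_div_six, ← sin_pi_sub]; congr 1; ring
    have c1 : cos (5 * π / 6) = - (√3 / 2) := by
      rw [← cos_pi_div_six, ← cos_pi_sub]; congr 1; ring
    rw [s1, c1]
    have : 1 ≤ √3 := by rw [one_le_sqrt]; norm_num
    nlinarith
  have h5 : (j:ℝ) * phi (5 * π / 6 / n) ≤ 1 := by
    have a := phi_le_one (x := 5 * π / 6 / n) (by positivity) (by
      rw [div_lt_iff₀ (by linarith)]; nlinarith)
    nlinarith [Nat.cast_nonneg (α := ℝ) j]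
  have h6 : 0 ≤ 5 * π / 3 * ss n j (5 * π / 3) := by positivity
  have h7 : (n - 1 : ℝ) * Lam 10 (5 * π / 6) ≤ (n - 1) * (-(2/5)) :=
    mul_le_mul_of_nonneg_left h3 (by linarith)
  push_cast at h2
  nlinarith

theorem mode_lo (hn : 800 ≤ n) (H : SLC (vv n j) (ss n j) (2 * π) (n / 12) c) :
    3 * π / 2 < c := by
  by_contra hc
  push Not at hc
  have p1 := pi_lo
  have p2 := pi_hi
  have hn1 : 1 ≤ n := by omega
  have hn8 : (800:ℝ) ≤ n := by exact_mod_cast hn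
  have hs : ss n j (3 * π / 2) ≤ 0 := by
    rcases hc.eq_or_lt with h | h
    · rw [← h, H.sc]
    · have := ss_mono j hn1 (x := c) (y := 3 * π / 2) H.hc0 h (by linarith)
      rw [H.sc] at this
      nlinarith
  have h1 := ss_mul j hn1 (X := 3 * π / 2) (by positivity)
  have e : 3 * π / 2 / 2 = 3 * π / 4 := by ring
  rw [e] at h1
  have h2 := Rs_mono (y := 3 * π / 4) (by positivity) (by linarith) (q := 6) (n := n)
    (by norm_num) (by omega)
  have h3 := Rs_six
  have h5 : 0 ≤ (j:ℝ) * phi (3 * π / 4 / n) := by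
    apply mul_nonneg (Nat.cast_nonneg _)
    have b : 3 * π / 4 / n ≤ 1 / 10 := by
      rw [div_le_iff₀ (by linarith)]; nlinarith
    have b0 : 0 ≤ 3 * π / 4 / n := by positivity
    have a := phi_lower_small (x := 3 * π / 4 / n) b0 (by linarith)
    nlinarith
  have h6 : 3 * π / 2 * ss n j (3 * π / 2) ≤ 0 := mul_nonpos_of_nonneg_of_nonpos (by positivity) hs
  rw [Rs_eq_Gs n] at h2
  have h7 : (n + 1 : ℝ) * (1 / 20) ≤ (n + 1) * (Rs 6 (3 * π / 4)) :=
    mul_le_mul_of_nonneg_left h3 (by linarith)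
  push_cast at h2
  nlinarith

theorem G_c (hn : 800 ≤ n) (H : SLC (vv n j) (ss n j) (2 * π) (n / 12) c) {X : ℝ} (hX : c ≤ X)
    (hX1 : X < 2 * π) : Gs n (X / 2) ≤ 0 := by
  have p1 := pi_lo
  have p2 := pi_hi
  have hn1 : 1 ≤ n := by omega
  have hn8 : (800:ℝ) ≤ n := by exact_mod_cast hn
  have hX0 : 0 < X := H.hc0.trans_le hX
  have h1 := ss_mul j hn1 hX0
  have hs : ss n j X ≤ 0 := by
    rcases hX.eq_or_lt with h | h
    · rw [← h, H.sc]
    · have := ss_mono j hn1 H.hc0 h hX1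
      rw [H.sc] at this
      nlinarith
  have h5 : 0 ≤ (j:ℝ) * phi (X / 2 / n) := by
    apply mul_nonneg (Nat.cast_nonneg _)
    have b : X / 2 / n ≤ 1 / 10 := by
      rw [div_le_iff₀ (by linarith)]; linarith
    have b0 : 0 ≤ X / 2 / n := by positivity
    have a := phi_lower_small b0 (by linarith)
    nlinarith
  have h6 : X * ss n j X ≤ 0 := mul_nonpos_of_nonneg_of_nonpos hX0.le hs
  linarith

/-- slope bound right of the mode -/
theorem gp_le (hn : 800 ≤ n) (hj : j ≤ 1) (H : SLC (vv n j) (ss n j) (2 * π) (n / 12) c) {X d : ℝ}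
    (hX : c ≤ X) (hd0 : 0 ≤ d) (hd : d ≤ 1 / 10) (hXd : (n + 1 : ℝ) * (X / 2 / n) ≤ 5 * π / 6 + d) :
    -gp n j X ≤ n * (0.500625 * ((0.86603 + d / 2) / (0.5 - d ^ 2 / 4 - 0.86603 * d)) + 0.0000005) := by
  have p1 := pi_lo
  have p2 := pi_hi
  have hn1 : 1 ≤ n := by omega
  have hn8 : (800:ℝ) ≤ n := by exact_mod_cast hn
  have hn0 : (0:ℝ) < n := by linarith
  have hX0 : 0 < X := H.hc0.trans_le hX
  have hXb : X < 2 * π := by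
    have : X / 2 ≤ (n + 1 : ℝ) * (X / 2 / n) := by
      have e : (n + 1 : ℝ) * (X / 2 / n) = X / 2 + X / 2 / n := by field_simp
      rw [e]
      have : 0 ≤ X / 2 / n := by positivity
      linarith
    linarith
  have h1 := gp_bound hn hj hX0 (by linarith)
  have h2 := G_c hn H hX hXb
  set U := (n + 1 : ℝ) * (X / 2 / n) with hU
  have hU0 : 0 < U := by positivity
  have h3 := negcot_le hU0 hXd hd0 hd
  set q := (0.86603 + d / 2) / (0.5 - d ^ 2 / 4 - 0.86603 * d) with hq
  have hq0 : 0 ≤ q := by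
    apply div_nonneg <;> nlinarith
  rw [phi_eq hU0.ne'] at h1
  have h4 : -(n * (U * (cos U / sin U))) ≤ n * (U * q) := by
    have := mul_le_mul_of_nonneg_left h3 (mul_nonneg hn0.le hU0.le)
    linarith
  have h5 : X * -gp n j X ≤ X * (n * (0.500625 * q + 0.0000005)) := by
    have e : n * (U * q) = X * ((n + 1) / 2 * q) := by rw [hU]; field_simp
    have h6 : (n + 1 : ℝ) / 2 * q ≤ n * 0.500625 * q :=
      mul_le_mul_of_nonneg_right (by linarith) hq0
    have h7 := mul_le_mul_of_nonneg_left h6 hX0.le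
    have h8 : (4:ℝ) ≤ X := by
      have := mode_lo hn H
      linarith
    have h9 : (1:ℝ)/1000 ≤ X * n * 0.0000005 := by nlinarith
    nlinarith
  exact le_of_mul_le_mul_left h5 hX0

theorem gp_c (hn : 800 ≤ n) (hj : j ≤ 1) (H : SLC (vv n j) (ss n j) (2 * π) (n / 12) c) :
    -gp n j c ≤ n * 0.88 := by
  have p1 := pi_lo
  have p2 := pi_hi
  have hn8 : (800:ℝ) ≤ n := by exact_mod_cast hn
  have hc := mode_hi hn hj H
  have h := gp_le hn hj H (X := c) (d := 0.0033) (le_refl _) (by norm_num) (by norm_num) (by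
    have e : (n + 1 : ℝ) * (c / 2 / n) = c / 2 + c / 2 / n := by field_simp
    have : c / 2 / n ≤ c / 2 / 800 := by
      apply div_le_div_of_nonneg_left (by linarith [H.hc0]) (by norm_num) hn8
    rw [e]; linarith)
  refine h.trans ?_
  apply mul_le_mul_of_nonneg_left _ (by linarith)
  norm_num

theorem G_left (hn : 800 ≤ n) (hj : j ≤ 1) (H : SLC (vv n j) (ss n j) (2 * π) (n / 12) c) {t : ℝ}
    (h0 : 0 < t) (h1 : t ≤ c) : t * ss n j t ≤ n * 0.88 * (c - t) := by
  have h := G_tangent j (by omega : 1 ≤ n) H.hc0 H.hcb h0 (h1.trans_lt H.hcb)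
  rw [H.sc] at h
  have := gp_c hn hj H
  nlinarith

theorem win (hn : 800 ≤ n) (hj : j ≤ 1) (H : SLC (vv n j) (ss n j) (2 * π) (n / 12) c) {a : ℝ}
    (ha : 0 < a) (ha2 : a ^ 2 ≤ 12 / n) : Win (ss n j) c a (n / 4) := by
  have p1 := pi_lo
  have p2 := pi_hi
  have hn8 : (800:ℝ) ≤ n := by exact_mod_cast hn
  have hn0 : (0:ℝ) < n := by linarith
  have hlo := mode_lo hn H
  have hhi := mode_hi hn hj H
  have ha1 : a ≤ 0.1225 := by
    have : (12:ℝ) / n ≤ 12 / 800 := div_le_div_of_nonneg_left (by norm_num) (by norm_num) hn8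
    nlinarith
  constructor
  · intro t h1 h2
    have ht0 : 0 < t := by linarith
    have h := G_left hn hj H ht0 h2.le
    have : t * ss n j t ≤ t * (n / 4 * (c - t)) := by
      have : 0 ≤ n * (c - t) := mul_nonneg hn0.le (by linarith)
      nlinarith
    exact le_of_mul_le_mul_left this ht0
  · intro t h1 h2
    have ht0 : 0 < t := by linarith
    have htb : t < 2 * π := by linarith
    have h := G_tangent j (by omega : 1 ≤ n) ht0 htb H.hc0 H.hcb
    rw [H.sc] at h
    have hg := gp_le hn hj H (X := t) (d := 0.0649) h1.le (by norm_num) (by norm_num) (by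
      have e : (n + 1 : ℝ) * (t / 2 / n) = t / 2 + t / 2 / n := by field_simp
      have : t / 2 / n ≤ t / 2 / 800 := by
        apply div_le_div_of_nonneg_left (by linarith) (by norm_num) hn8
      rw [e]; linarith)
    have hg2 : -gp n j t ≤ n * 1.1 := by
      refine hg.trans ?_
      apply mul_le_mul_of_nonneg_left _ (by linarith)
      norm_num
    have : t * -(n / 4 * (t - c)) ≤ t * ss n j t := by
      have : 0 ≤ n * (t - c) := mul_nonneg hn0.le (by linarith)
      nlinarith
    exact le_of_mul_le_mul_left this ht0

theorem mean_bounds (hn : 800 ≤ n) (hj : j ≤ 1) (H : SLC (vv n j) (ss n j) (2 * π) (n / 12) c) :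
    4.589 ≤ mean (vv n j) (2 * π) ∧ mean (vv n j) (2 * π) ≤ 5.2395 := by
  have p1 := pi_lo
  have p2 := pi_hi
  have hn8 : (800:ℝ) ≤ n := by exact_mod_cast hn
  have hn0 : (0:ℝ) < n := by linarith
  have hlo := mode_lo hn H
  have hhi := mode_hi hn hj H
  have hsq := H.mean_sq
  have hv := H.cont
  set e := mean (vv n j) (2 * π) with he
  have h12 : (1:ℝ) / (n / 12) ≤ 0.015 := by
    rw [div_le_iff₀ (by positivity)]; linarith
  have b1 : (e - c) ^ 2 ≤ 0.015 := hsq.trans h12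
  have b2 : -0.1225 ≤ e - c := by nlinarith
  have b3 : e - c ≤ 0.1225 := by nlinarith
  refine ⟨by linarith, ?_⟩
  have he0 : 0 < e := by linarith
  have heb : e < 2 * π := by linarith
  have hI := H.ibp (h := fun x => x) (h' := fun _ => 1) (fun x => hasDerivAt_id' x) continuous_const
  have hle : ∫ x in (0:ℝ)..(2 * π), x * deriv (vv n j) x ≤
      ∫ x in (0:ℝ)..(2 * π), (e * ss n j e * vv n j x + gp n j e * ((x - e) * vv n j x)) := by
    have := H.dcont
    apply H.int_mono (by fun_prop) (by fun_prop)
    intro x h0 h1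
    rw [H.der x h0 h1]
    have h := G_tangent j (by omega : 1 ≤ n) he0 heb h0 h1
    have := mul_le_mul_of_nonneg_right h (H.pos x h0 h1).le
    linarith
  rw [intervalIntegral.integral_add (Continuous.intervalIntegrable (by fun_prop) _ _)
    (Continuous.intervalIntegrable (by fun_prop) _ _), intervalIntegral.integral_const_mul,
    intervalIntegral.integral_const_mul, stein_int H, ← he, hI] at hle
  have hZ := H.Zpos
  simp only [one_mul, sub_self, zero_mul, mul_zero, add_zero] at hle
  have hG : -1 ≤ e * ss n j e := by
    by_contra h
    push Not at h
    nlinarith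
  by_contra hcon
  push Not at hcon
  have hec : c < e := by linarith
  have := H.mono c e H.hc0 hec heb
  rw [H.sc] at this
  have h7 : e * ss n j e ≤ e * (-(n / 12) * (e - c)) :=
    mul_le_mul_of_nonneg_left (by linarith) he0.le
  have h8 : e - c ≥ 0.0034 := by linarith
  have h9 : 66 * 0.0034 ≤ (n / 12) * (e - c) := by nlinarith
  nlinarith

/-- positive part mass of the derivative -/
noncomputable def Pp (n j : ℕ) : ℝ := ∫ x in (0:ℝ)..(2 * π), max (deriv (vv n j) x) 0

theorem Pp_bound (hn : 800 ≤ n) (hj : j ≤ 1) (H : SLC (vv n j) (ss n j) (2 * π) (n / 12) c) {a : ℝ}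
    (ha : 0 < a) (ha2 : a ^ 2 = 12 / n) :
    Pp n j = ∫ x in (0:ℝ)..(2 * π), max (-deriv (vv n j) x) 0 ∧
    4.712 * Pp n j ≤ (0.88 * (n * a) + 1) * ∫ x in (0:ℝ)..(2 * π), vv n j x := by
  have p1 := pi_lo
  have p2 := pi_hi
  have hn8 : (800:ℝ) ≤ n := by exact_mod_cast hn
  have hn0 : (0:ℝ) < n := by linarith
  have hlo := mode_lo hn H
  have hhi := mode_hi hn hj H
  have hv := H.cont
  have hd := H.dcont
  have hI0 := H.ibp (h := fun _ => 1) (h' := fun _ => 0) (fun x => hasDerivAt_const x 1) continuous_const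
  have hI := H.ibp (h := fun x => x) (h' := fun _ => 1) (fun x => hasDerivAt_id' x) continuous_const
  simp only [one_mul, zero_mul, intervalIntegral.integral_zero, neg_zero] at hI0 hI
  have e1 : Pp n j = ∫ x in (0:ℝ)..(2 * π), max (-deriv (vv n j) x) 0 := by
    have : Pp n j - ∫ x in (0:ℝ)..(2 * π), max (-deriv (vv n j) x) 0 =
        ∫ x in (0:ℝ)..(2 * π), deriv (vv n j) x := by
      unfold Pp
      rw [← intervalIntegral.integral_sub (Continuous.intervalIntegrable (by fun_prop) _ _)
        (Continuous.intervalIntegrable (by fun_prop) _ _)]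
      congr 1; ext x
      rcases le_total 0 (deriv (vv n j) x) with h | h
      · rw [max_eq_left h, max_eq_right (by linarith)]; ring
      · rw [max_eq_right h, max_eq_left (by linarith)]; ring
    rw [hI0] at this; linarith
  refine ⟨e1, ?_⟩
  rw [e1]
  have hle : ∫ x in (0:ℝ)..(2 * π), 4.712 * max (-deriv (vv n j) x) 0 ≤
      ∫ x in (0:ℝ)..(2 * π), (-(x * deriv (vv n j) x) +
        (n * 0.88) * ((1 / (2 * a)) * ((x - c) ^ 2 * vv n j x) + (a / 2) * vv n j x)) := by
    apply H.int_mono (by fun_prop) (by fun_prop)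
    intro x h0 h1
    have hpos := H.pos x h0 h1
    have hder := H.der x h0 h1
    have amgm : |x - c| ≤ 1 / (2 * a) * (x - c) ^ 2 + a / 2 := by
      have : 0 ≤ (|x - c| - a) ^ 2 := sq_nonneg _
      rw [← sq_abs]
      have e : 1 / (2 * a) * |x - c| ^ 2 + a / 2 = (|x - c| ^ 2 + a ^ 2) / (2 * a) := by field_simp
      rw [e, le_div_iff₀ (by positivity)]
      nlinarith
    have hbig : 0 ≤ n * 0.88 * (1 / (2 * a) * ((x - c) ^ 2 * vv n j x) + a / 2 * vv n j x) := by
      positivity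
    rcases le_total x c with h | h
    · have hs : 0 ≤ ss n j x := by
        rcases h.eq_or_lt with h' | h'
        · rw [h', H.sc]
        · have := H.mono x c h0 h' H.hcb
          rw [H.sc] at this
          nlinarith
      have hdn : 0 ≤ deriv (vv n j) x := by rw [hder]; positivity
      rw [max_eq_right (by linarith)]
      have hG := G_left hn hj H h0 h
      have : x * deriv (vv n j) x ≤ n * 0.88 * ((1 / (2 * a) * (x - c) ^ 2 + a / 2) * vv n j x) := by
        rw [hder]
        have e3 : |x - c| = c - x := by rw [abs_of_nonpos (by linarith)]; ring
        rw [e3] at amgm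
        calc x * (ss n j x * vv n j x) = (x * ss n j x) * vv n j x := by ring
          _ ≤ (n * 0.88 * (c - x)) * vv n j x := mul_le_mul_of_nonneg_right hG hpos.le
          _ = n * 0.88 * ((c - x) * vv n j x) := by ring
          _ ≤ _ := by
            apply mul_le_mul_of_nonneg_left _ (by positivity)
            exact mul_le_mul_of_nonneg_right amgm hpos.le
      linarith
    · have hs : ss n j x ≤ 0 := by
        rcases h.eq_or_lt with h' | h'
        · rw [← h', H.sc]
        · have := H.mono c x H.hc0 h' h1
          rw [H.sc] at this
          nlinarith
      have hdn : deriv (vv n j) x ≤ 0 := by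
        rw [hder]; exact mul_nonpos_of_nonpos_of_nonneg hs hpos.le
      rw [max_eq_left (by linarith)]
      nlinarith
  rw [intervalIntegral.integral_const_mul, intervalIntegral.integral_add
    (Continuous.intervalIntegrable (by fun_prop) _ _)
    (Continuous.intervalIntegrable (by fun_prop) _ _), intervalIntegral.integral_neg, hI,
    intervalIntegral.integral_const_mul, intervalIntegral.integral_add
    (Continuous.intervalIntegrable (by fun_prop) _ _)
    (Continuous.intervalIntegrable (by fun_prop) _ _), intervalIntegral.integral_const_mul,
    intervalIntegral.integral_const_mul] at hle
  have hm2 := H.m2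
  unfold Ex at hm2
  rw [div_le_iff₀ H.Zpos] at hm2
  have e5 : (1:ℝ) / (n / 12) = a ^ 2 := by rw [ha2]; field_simp
  rw [e5] at hm2
  set Z := ∫ x in (0:ℝ)..(2 * π), vv n j x
  set Q := ∫ x in (0:ℝ)..(2 * π), (x - c) ^ 2 * vv n j x
  have : 1 / (2 * a) * Q ≤ a / 2 * Z := by
    calc _ ≤ 1 / (2 * a) * (a ^ 2 * Z) := mul_le_mul_of_nonneg_left hm2 (by positivity)
      _ = _ := by field_simp
  have : n * 0.88 * (1 / (2 * a) * Q + a / 2 * Z) ≤ n * 0.88 * (a * Z) :=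
    mul_le_mul_of_nonneg_left (by linarith) (by positivity)
  linarith

end mode

end QP

namespace QP

open Set Real

variable {p : ℕ} {c c' : ℝ}

theorem sqrt3_bds : 1.732 < √3 ∧ √3 < 1.7321 := by
  constructor
  · apply lt_sqrt_of_sq_lt; norm_num
  · rw [sqrt_lt' (by norm_num)]; norm_num

theorem phi_56 : -4.54 ≤ phi (5 * π / 6) := by
  have p1 := pi_lo
  have p2 := pi_hi
  rw [phi_eq (by positivity)]
  have e : 5 * π / 6 = π - π / 6 := by ring
  rw [e, cos_pi_sub, sin_pi_sub, cos_pi_div_six, sin_pi_div_six]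
  have := sqrt3_bds
  have e2 : (π - π / 6) * (-(√3 / 2) / (1 / 2)) = -(5 * π / 6 * √3) := by ring
  rw [e2]
  nlinarith

theorem Lam_anti {n : ℕ} {y z : ℝ} (h0 : 0 < y) (hyz : y ≤ z) (hz : z < π) :
    Lam n z ≤ Lam n y := by
  unfold Lam
  apply Finset.sum_le_sum
  intro k hk
  have hk' : k + 1 ≤ n := by have := Finset.mem_range.1 hk; omega
  have hn : (0:ℝ) < n := by exact_mod_cast (by omega : 0 < n)
  have hk2 : ((k + 1 : ℕ) : ℝ) ≤ n := by exact_mod_cast hk'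
  apply phi_anti (by positivity) (by gcongr)
  have : ((k + 1 : ℕ) : ℝ) * (z / n) ≤ n * (z / n) := by
    have : 0 < z := by linarith
    gcongr
  have e : (n:ℝ) * (z / n) = z := by field_simp
  linarith

theorem Lam_le (hp : 800 ≤ p) (H : SLC (vv p 1) (ss p 1) (2 * π) (p / 12) c) {X : ℝ} (h0 : 0 < X)
    (h1 : X < 2 * π) : Lam p (X / 2) ≤ max (Gs p (X / 2)) 0 + 4.54 := by
  have hhi := mode_hi hp le_rfl H
  have p0 := pi_pos
  have hp1 : 1 ≤ p := by omega
  have h56 := phi_56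
  rcases le_total X c with h | h
  · have := Gs_eq_Lam hp1 (X / 2)
    have h2 := phi_anti (x := X / 2) (y := 5 * π / 6) (by linarith) (by linarith) (by linarith)
    have := le_max_left (Gs p (X / 2)) 0
    linarith
  · have h2 := Lam_anti (n := p) (y := c / 2) (z := X / 2) (by linarith [H.hc0]) (by linarith) (by linarith)
    have h3 := Gs_eq_Lam hp1 (c / 2)
    have h4 := phi_anti (x := c / 2) (y := 5 * π / 6) (by linarith [H.hc0]) (by linarith) (by linarith)
    have h5 := G_c hp H le_rfl H.hcb
    have := le_max_right (Gs p (X / 2)) 0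
    linarith

theorem v_div_le (hp : 800 ≤ p) {X : ℝ} (h0 : 0 < X) (h1 : X < 2 * π) :
    vv p 1 X / X ≤ vv p 1 X / 2 + 2 * max (deriv (vv p 1) X) 0 / p := by
  have hp1 : 1 ≤ p := by omega
  have hp8 : (800:ℝ) ≤ p := by exact_mod_cast hp
  have hv := vv_pos 1 hp1 h0 h1
  rcases le_total 2 X with h | h
  · have : 0 ≤ max (deriv (vv p 1) X) 0 := le_max_right _ _
    have : 0 ≤ 2 * max (deriv (vv p 1) X) 0 / p := by positivity
    have : vv p 1 X / X ≤ vv p 1 X / 2 := by gcongr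
    linarith
  · have hs := ss_mul 1 hp1 h0
    have hG : (p:ℝ) / 2 ≤ Gs p (X / 2) := by
      unfold Gs
      have : ∑ k ∈ Finset.range p, (1/2 : ℝ) ≤ ∑ k ∈ Finset.range p, phi ((k + 1 : ℕ) * (X / 2 / p)) := by
        apply Finset.sum_le_sum
        intro k hk
        have hk2 : ((k + 1 : ℕ) : ℝ) ≤ p := by exact_mod_cast (by have := Finset.mem_range.1 hk; omega)
        have b : ((k + 1 : ℕ) : ℝ) * (X / 2 / p) ≤ 1 := by
          have : ((k + 1 : ℕ) : ℝ) * (X / 2 / p) ≤ p * (X / 2 / p) := by gcongr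
          have e : (p:ℝ) * (X / 2 / p) = X / 2 := by field_simp
          linarith
        have b0 : 0 ≤ ((k + 1 : ℕ) : ℝ) * (X / 2 / p) := by positivity
        have := phi_lower_small b0 b
        nlinarith
      simp at this
      push_cast
      push_cast at this
      linarith
    have hq : 0 ≤ phi (X / 2 / p) := by
      have b : X / 2 / p ≤ 1 := by rw [div_le_iff₀ (by linarith)]; linarith
      have b0 : 0 ≤ X / 2 / p := by positivity
      have := phi_lower_small b0 b
      nlinarith
    have hd := vv_deriv 1 hp1 h0 h1
    have h3 := le_max_left (deriv (vv p 1) X) 0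
    have h4 : vv p 1 X / X ≤ 2 * max (deriv (vv p 1) X) 0 / p := by
      rw [div_le_div_iff₀ h0 (by linarith)]
      have h5 : (p:ℝ) / 2 ≤ X * ss p 1 X := by
        rw [hs]; push_cast; linarith
      have h6 : (p:ℝ) / 2 * vv p 1 X ≤ X * ss p 1 X * vv p 1 X :=
        mul_le_mul_of_nonneg_right h5 hv.le
      rw [hd] at h3 ⊢
      nlinarith
    linarith

theorem score_up (hp : 800 ≤ p) (H : SLC (vv p 1) (ss p 1) (2 * π) (p / 12) c) {X : ℝ} (h0 : 0 < X)
    (h1 : X < 2 * π) :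
    (ss (p + 2) 1 X - ss p 1 X) * vv p 1 X ≤
      2 / (p - 1) * (max (deriv (vv p 1) X) 0 +
        4.54 * (vv p 1 X / 2 + 2 * max (deriv (vv p 1) X) 0 / p)) + vv p 1 X / p ^ 2 := by
  have p2 := pi_hi
  have hp1 : 1 ≤ p := by omega
  have hp8 : (800:ℝ) ≤ p := by exact_mod_cast hp
  have hv := vv_pos 1 hp1 h0 h1
  have s1 := ss_mul 1 hp1 h0
  have s2 := ss_mul (n := p + 2) 1 (by omega) h0
  have L1 := Lam_mono (y := X / 2) (by linarith) (by linarith) (q := p) (n := p + 2) (by omega) (by omega)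
  have e1 := Gs_eq_Lam hp1 (X / 2)
  have e2 := Gs_eq_Lam (n := p + 2) (by omega) (X / 2)
  have hL := Lam_le hp H h0 h1
  have q1 : phi (X / 2 / (p + 2 : ℕ)) ≤ 1 := by
    apply phi_le_one (by positivity)
    rw [div_lt_iff₀ (by positivity)]
    push_cast
    nlinarith [pi_pos]
  have b1 : X / 2 / p ≤ 1 := by rw [div_le_iff₀ (by linarith)]; linarith
  have b0 : 0 ≤ X / 2 / p := by positivity
  have q2 := phi_lower_small b0 b1
  have hvd := v_div_le hp h0 h1
  have hd := vv_deriv 1 hp1 h0 h1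
  set G := Gs p (X / 2)
  set v := vv p 1 X
  -- G part
  have hG : max G 0 * (v / X) ≤ max (deriv (vv p 1) X) 0 := by
    rcases le_total G 0 with h | h
    · rw [max_eq_right h]; simp
    · rw [max_eq_left h]
      refine le_trans ?_ (le_max_left _ _)
      rw [hd, ← mul_div_assoc, div_le_iff₀ h0]
      have : G ≤ X * ss p 1 X := by rw [s1]; push_cast; nlinarith
      nlinarith
  have key : X * (ss (p + 2) 1 X - ss p 1 X) ≤ 2 / (p - 1) * (max G 0 + 4.54) + (X / 2 / p) ^ 2 / 2 := by
    have : Lam (p + 2) (X / 2) - Lam p (X / 2) ≤ 2 / (p - 1) * Lam p (X / 2) := by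
      rw [div_mul_eq_mul_div, le_div_iff₀ (by linarith)]
      push_cast at L1
      linarith
    have h3 : 2 / ((p:ℝ) - 1) * Lam p (X / 2) ≤ 2 / (p - 1) * (max G 0 + 4.54) :=
      mul_le_mul_of_nonneg_left hL (div_nonneg (by norm_num) (by linarith))
    push_cast at *
    rw [mul_sub, s1, s2]
    linarith
  have e3 : (ss (p + 2) 1 X - ss p 1 X) * v = X * (ss (p + 2) 1 X - ss p 1 X) * (v / X) := by
    field_simp
  rw [e3]
  have hvX : 0 ≤ v / X := by positivity
  have h4 := mul_le_mul_of_nonneg_right key hvX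
  refine h4.trans ?_
  have e4 : (X / 2 / p) ^ 2 / 2 * (v / X) = X / 8 * (v / p ^ 2) := by field_simp; ring
  rw [add_mul, e4]
  have h5 : X / 8 * (v / p ^ 2) ≤ v / p ^ 2 := by
    have : 0 ≤ v / (p:ℝ) ^ 2 := by positivity
    nlinarith
  have h6 : 2 / ((p:ℝ) - 1) * (max G 0 + 4.54) * (v / X) ≤ 2 / (p - 1) * (max (deriv (vv p 1) X) 0 +
        4.54 * (v / 2 + 2 * max (deriv (vv p 1) X) 0 / p)) := by
    rw [mul_assoc]
    apply mul_le_mul_of_nonneg_left _ (div_nonneg (by norm_num) (by linarith))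
    rw [add_mul]
    linarith
  linarith

theorem score_down {X : ℝ} (hp : 1 ≤ p) (h0 : 0 < X) (h1 : X < 2 * π) :
    (ss p 1 X - ss (p + 2) 1 X) * vv (p + 2) 1 X ≤
      2 / (p + 3) * max (-deriv (vv (p + 2) 1) X) 0 := by
  have hv := vv_pos (n := p + 2) 1 (by omega) h0 h1
  have s1 := ss_mul 1 hp h0
  have s2 := ss_mul (n := p + 2) 1 (by omega) h0
  have L1 := Rs_mono (y := X / 2) (by linarith) (by linarith) (q := p) (n := p + 2) (by omega) (by omega)
  have e1 := Rs_eq_Gs p (X / 2)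
  have e2 := Rs_eq_Gs (p + 2) (X / 2)
  have hd := vv_deriv (n := p + 2) 1 (by omega) h0 h1
  have p1 : (1:ℝ) ≤ p := by exact_mod_cast hp
  have a1 : X / 2 / p < π := by rw [div_lt_iff₀ (by linarith)]; nlinarith [pi_pos]
  have q1 : phi (X / 2 / p) ≤ phi (X / 2 / (p + 2 : ℕ)) := by
    apply phi_anti (by positivity) _ a1
    push_cast
    gcongr; linarith
  have q2 : phi (X / 2 / (p + 2 : ℕ)) ≤ 1 := by
    apply phi_le_one (by positivity)
    rw [div_lt_iff₀ (by positivity)]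
    push_cast
    nlinarith [pi_pos]
  have key : X * (ss p 1 X - ss (p + 2) 1 X) ≤ X * (-(2 / (p + 3) * ss (p + 2) 1 X)) := by
    have h2 : Rs p (X / 2) - Rs (p + 2) (X / 2) ≤ -(2 / (p + 3) * Rs (p + 2) (X / 2)) := by
      have : Rs p (X / 2) ≤ (p + 1) / (p + 3) * Rs (p + 2) (X / 2) := by
        rw [div_mul_eq_mul_div, le_div_iff₀ (by linarith)]
        push_cast at L1
        linarith
      have e : ((p:ℝ) + 1) / (p + 3) = 1 - 2 / (p + 3) := by field_simp; ring
      rw [e] at this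
      linarith
    have h3 : X * (-(2 / (p + 3) * ss (p + 2) 1 X)) = -(2 / (p + 3) * (X * ss (p + 2) 1 X)) := by ring
    have h4 : 2 / ((p:ℝ) + 3) * (X * ss (p + 2) 1 X) ≤ 2 / (p + 3) * Rs (p + 2) (X / 2) := by
      apply mul_le_mul_of_nonneg_left _ (by positivity)
      rw [s2, e2]; push_cast at *; linarith
    rw [h3, mul_sub, s1]
    rw [s2] at h4 ⊢
    push_cast at *
    linarith
  have k2 := le_of_mul_le_mul_left key h0
  have k3 := mul_le_mul_of_nonneg_right k2 hv.le
  refine k3.trans ?_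
  have : -(2 / ((p:ℝ) + 3) * ss (p + 2) 1 X) * vv (p + 2) 1 X =
    2 / (p + 3) * (-deriv (vv (p + 2) 1) X) := by rw [hd]; ring
  rw [this]
  exact mul_le_mul_of_nonneg_left (le_max_left _ _) (by positivity)

theorem mean_step_up (hp : 900 ≤ p) (H : SLC (vv p 1) (ss p 1) (2 * π) (p / 12) c)
    (H' : SLC (vv (p + 2) 1) (ss (p + 2) 1) (2 * π) ((p + 2 : ℕ) / 12) c') :
    (p + 2) * (mean (vv (p + 2) 1) (2 * π) - mean (vv p 1) (2 * π)) ≤ 0.6 := by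
  have hp8 : (900:ℝ) ≤ p := by exact_mod_cast hp
  have hv := H.cont
  have hd := H.dcont
  have hZ := H.Zpos
  have st := stein_upper H' H (w := fun X => 2 / (p - 1) * (max (deriv (vv p 1) X) 0 +
        4.54 * (vv p 1 X / 2 + 2 * max (deriv (vv p 1) X) 0 / p)) + vv p 1 X / p ^ 2)
      (by fun_prop)
      (by
        intro X h0 h1
        have := vv_pos (n := p) 1 (by omega) h0 h1
        have : 0 ≤ max (deriv (vv p 1) X) 0 := le_max_right _ _
        have : 0 ≤ (p:ℝ) - 1 := by linarith
        positivity)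
      (fun X h0 h1 => score_up (by omega) H h0 h1)
  set a := √(12 / p) with ha
  have ha2 : a ^ 2 = 12 / p := sq_sqrt (by positivity)
  have ha0 : 0 < a := sqrt_pos.2 (by positivity)
  have hP := (Pp_bound (by omega : 800 ≤ p) le_rfl H ha0 ha2).2
  have e : (∫ X in (0:ℝ)..(2 * π), (2 / ((p:ℝ) - 1) * (max (deriv (vv p 1) X) 0 +
        4.54 * (vv p 1 X / 2 + 2 * max (deriv (vv p 1) X) 0 / p)) + vv p 1 X / p ^ 2)) =
      2 / (p - 1) * (1 + 9.08 / p) * Pp p 1 +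
        (2 / (p - 1) * 2.27 + 1 / p ^ 2) * ∫ X in (0:ℝ)..(2 * π), vv p 1 X := by
    unfold Pp
    rw [← intervalIntegral.integral_const_mul, ← intervalIntegral.integral_const_mul,
      ← intervalIntegral.integral_add (Continuous.intervalIntegrable (by fun_prop) _ _)
        (Continuous.intervalIntegrable (by fun_prop) _ _)]
    congr 1; ext X; ring
  rw [e] at st
  set Z := ∫ X in (0:ℝ)..(2 * π), vv p 1 X
  set P := Pp p 1
  set d := mean (vv (p + 2) 1) (2 * π) - mean (vv p 1) (2 * π)
  have e1 : 1 / (((p + 2 : ℕ) : ℝ) / 12) = 12 / (p + 2) := by push_cast; field_simp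
  rw [e1] at st
  -- a * p ≤ (p/900)*104
  have hap : p * a ≤ 3.4642 * √p := by
    have : p * a = √12 * √p := by
      rw [ha, sqrt_div (by norm_num)]
      have h3 : √(p:ℝ) * √p = p := mul_self_sqrt (by linarith)
      have : 0 < √(p:ℝ) := sqrt_pos.2 (by linarith)
      field_simp
      linarith
    rw [this]
    apply mul_le_mul_of_nonneg_right _ (sqrt_nonneg _)
    rw [sqrt_le_left (by norm_num)]; norm_num
  set r := √(p:ℝ) with hr
  have hr2 : r ^ 2 = p := sq_sqrt (by linarith)
  have hr0 : 30 ≤ r := by apply le_sqrt_of_sq_le; linarith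
  have hPr : P ≤ (0.64697 * r + 0.21223) * Z := by nlinarith
  have f1 : 1 + 9.08 / (p:ℝ) ≤ 1.01009 := by
    have : 9.08 / (p:ℝ) ≤ 9.08 / 900 := by gcongr
    linarith
  have f2 : 2 / ((p:ℝ) - 1) * (1 + 9.08 / p) * P ≤ 2 / (p - 1) * (1.01009 * ((0.64697 * r + 0.21223) * Z)) := by
    rw [mul_assoc]
    apply mul_le_mul_of_nonneg_left _ (div_nonneg (by norm_num) (by linarith))
    have hP0 : 0 ≤ P := intervalIntegral.integral_nonneg H.hb.le fun x _ => le_max_right _ _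
    exact mul_le_mul f1 hPr hP0 (by norm_num)
  have f3 : 1 / (p:ℝ) ^ 2 ≤ 2 / (p - 1) * 0.001 := by
    rw [div_mul_eq_mul_div, div_le_div_iff₀ (by positivity) (by linarith)]
    nlinarith
  have f4 : 12 * (2 / ((p:ℝ) - 1) * (1.01009 * (0.64697 * r + 0.21223) + 2.271)) ≤ 0.6 := by
    rw [div_mul_eq_mul_div, ← mul_div_assoc, div_le_iff₀ (by linarith)]
    nlinarith
  have f5 : ((p:ℝ) + 2) * d * Z ≤ 0.6 * Z := by
    have g1 : ((p:ℝ) + 2) * (12 / (p + 2) * (2 / (p - 1) * (1 + 9.08 / p) * P + (2 / (p - 1) * 2.27 + 1 / p ^ 2) * Z)) =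
       12 * (2 / (p - 1) * (1 + 9.08 / p) * P + (2 / (p - 1) * 2.27 + 1 / p ^ 2) * Z) := by
      field_simp
    have g2 := mul_le_mul_of_nonneg_left st (by linarith : (0:ℝ) ≤ p + 2)
    rw [g1] at g2
    have g3 := mul_le_mul_of_nonneg_right f3 hZ.le
    have g4 := mul_le_mul_of_nonneg_right f4 hZ.le
    nlinarith
  exact le_of_mul_le_mul_right f5 hZ

theorem mean_step_down (hp : 900 ≤ p) (H : SLC (vv p 1) (ss p 1) (2 * π) (p / 12) c)
    (H' : SLC (vv (p + 2) 1) (ss (p + 2) 1) (2 * π) ((p + 2 : ℕ) / 12) c') :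
    (p + 2) * (mean (vv p 1) (2 * π) - mean (vv (p + 2) 1) (2 * π)) ≤ 1 := by
  have hp8 : (900:ℝ) ≤ p := by exact_mod_cast hp
  have hv := H'.cont
  have hd := H'.dcont
  have hZ := H'.Zpos
  have st := stein_upper H H' (w := fun X => 2 / (p + 3) * max (-deriv (vv (p + 2) 1) X) 0)
      (by fun_prop)
      (by
        intro X h0 h1
        have : 0 ≤ max (-deriv (vv (p + 2) 1) X) 0 := le_max_right _ _
        positivity)
      (fun X h0 h1 => score_down (by omega) h0 h1)
  set q : ℝ := ((p + 2 : ℕ) : ℝ) with hq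
  have hqp : q = p + 2 := by rw [hq]; push_cast; ring
  set a := √(12 / q) with ha
  have hq0 : 0 < q := by linarith
  have ha2 : a ^ 2 = 12 / q := sq_sqrt (by positivity)
  have ha0 : 0 < a := sqrt_pos.2 (by positivity)
  obtain ⟨hP1, hP⟩ := (Pp_bound (by omega : 800 ≤ p + 2) le_rfl H' ha0 ha2)
  rw [intervalIntegral.integral_const_mul, ← hP1] at st
  set Z := ∫ X in (0:ℝ)..(2 * π), vv (p + 2) 1 X
  set P := Pp (p + 2) 1
  set d := mean (vv p 1) (2 * π) - mean (vv (p + 2) 1) (2 * π)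
  have hqa : q * a ≤ q * 0.1155 := by
    apply mul_le_mul_of_nonneg_left _ hq0.le
    rw [ha, sqrt_le_left (by norm_num), div_le_iff₀ hq0]
    linarith
  have hPr : P ≤ 0.03 * q * Z := by nlinarith
  have e1 : 1 / ((p:ℝ) / 12) = 12 / p := by field_simp
  rw [e1] at st
  have f5 : ((p:ℝ) + 2) * d * Z ≤ 1 * Z := by
    have g2 := mul_le_mul_of_nonneg_left st (by linarith : (0:ℝ) ≤ p + 2)
    have g3 : ((p:ℝ) + 2) * (12 / p * (2 / (p + 3) * P)) ≤ 24.5 / p * P := by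
      have hP0 : 0 ≤ P := intervalIntegral.integral_nonneg H.hb.le fun x _ => le_max_right _ _
      have : ((p:ℝ) + 2) * (12 / p * (2 / (p + 3) * P)) = 24 / p * ((p + 2) / (p + 3)) * P := by
        field_simp; ring
      rw [this]
      apply mul_le_mul_of_nonneg_right _ hP0
      have : ((p:ℝ) + 2) / (p + 3) ≤ 1 := by rw [div_le_one (by linarith)]; linarith
      have h1 : 24 / (p:ℝ) * ((p + 2) / (p + 3)) ≤ 24 / p * 1 := by gcongr
      have : 24 / (p:ℝ) * 1 ≤ 24.5 / p := by rw [mul_one]; gcongr; norm_num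
      linarith
    have g4 : 24.5 / (p:ℝ) * P ≤ 24.5 / p * (0.03 * q * Z) := by gcongr
    have g5 : 24.5 / (p:ℝ) * (0.03 * q * Z) = 0.735 * (q / p) * Z := by ring
    have g6 : q / p ≤ 1.01 := by rw [hqp, div_le_iff₀ (by linarith)]; linarith
    have g7 : 0.735 * (q / p) * Z ≤ 1 * Z := mul_le_mul_of_nonneg_right (by linarith) hZ.le
    linarith
  exact le_of_mul_le_mul_right f5 hZ

/-- the critical location -/
noncomputable def xx (n : ℕ) : ℝ := π * n / (2 * mean (vv n 1) (2 * π))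

theorem xx_step (hp : 900 ≤ p) : 0.56 ≤ xx (p + 2) - xx p ∧ xx (p + 2) - xx p ≤ 1.4 := by
  have p1 := pi_lo
  have p2 := pi_hi
  have hp8 : (900:ℝ) ≤ p := by exact_mod_cast hp
  obtain ⟨c, H⟩ := vv_slc (n := p) 1 (by omega)
  obtain ⟨c', H'⟩ := vv_slc (n := p + 2) 1 (by omega)
  obtain ⟨b1, b2⟩ := mean_bounds (by omega) le_rfl H
  obtain ⟨b3, b4⟩ := mean_bounds (by omega) le_rfl H'
  have u := mean_step_up hp H H'
  have d := mean_step_down hp H H'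
  unfold xx
  set e := mean (vv p 1) (2 * π)
  set f := mean (vv (p + 2) 1) (2 * π)
  have key : π * (p + 2 : ℕ) / (2 * f) - π * p / (2 * e) = π / e * (1 - (p + 2) * (f - e) / (2 * f)) := by
    have : e ≠ 0 := by linarith
    have : f ≠ 0 := by linarith
    push_cast
    field_simp
    ring
  rw [key]
  have l1 : 0.5995 ≤ π / e := by rw [le_div_iff₀ (by linarith)]; linarith
  have l2 : π / e ≤ 0.7 := by rw [div_le_iff₀ (by linarith)]; linarith
  have m1 : (p + 2) * (f - e) / (2 * f) ≤ 0.0654 := by rw [div_le_iff₀ (by linarith)]; linarith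
  have m2 : -0.2 ≤ (p + 2) * (f - e) / (2 * f) := by rw [le_div_iff₀ (by linarith)]; linarith
  set A := π / e
  set B := (p + 2) * (f - e) / (2 * f)
  constructor <;> nlinarith

end QP

namespace QP

open Set Real

theorem one_sub_norm_sq (r x : ℝ) : ‖(1:ℂ) - r * Complex.exp (x * Complex.I)‖ ^ 2 = 1 - 2 * r * cos x + r ^ 2 := by
  rw [← Complex.normSq_eq_norm_sq, Complex.normSq_apply, Complex.exp_mul_I]
  simp [Complex.cos_ofReal_re, Complex.sin_ofReal_re, Complex.cos_ofReal_im, Complex.sin_ofReal_im]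
  nlinarith [sin_sq_add_cos_sq x]

theorem maj {r : ℝ} (h0 : 0 < r) (h1 : r < 1) (K : ℕ) (x : ℝ) :
    |2 * sin (x / 2)| ≤ exp (log (2 / (1 + r)) + r ^ (K + 1) * (1 - r)⁻¹ / (K + 1)
      - ∑ m ∈ Finset.range K, r ^ (m + 1) / (m + 1 : ℕ) * cos ((m + 1 : ℕ) * x)) := by
  set z : ℂ := -(r * Complex.exp (x * Complex.I)) with hz
  have hzn : ‖z‖ = r := by
    rw [hz, norm_neg, norm_mul, Complex.norm_exp_ofReal_mul_I, mul_one]; simp [abs_of_pos h0]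
  have h := Complex.norm_log_sub_logTaylor_le K (z := z) (by rw [hzn]; exact h1)
  rw [hzn] at h
  have hre := (le_abs_self _).trans ((Complex.abs_re_le_norm _).trans h)
  rw [Complex.sub_re, Complex.log_re] at hre
  have e : (Complex.logTaylor (K + 1) z).re = - ∑ m ∈ Finset.range K, r ^ (m + 1) / (m + 1 : ℕ) * cos ((m + 1 : ℕ) * x) := by
    unfold Complex.logTaylor
    rw [Finset.sum_range_succ', Complex.add_re, Complex.re_sum, ← Finset.sum_neg_distrib]
    simp only [Nat.cast_zero, div_zero, Complex.zero_re, add_zero]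
    refine Finset.sum_congr rfl fun m _ => ?_
    have : (-1 : ℂ) ^ (m + 1 + 1) * z ^ (m + 1) / ((m + 1 : ℕ) : ℂ) =
       ((-(r ^ (m + 1) / (m + 1 : ℕ)) : ℝ) : ℂ) * Complex.exp (((((m + 1 : ℕ) : ℝ) * x : ℝ) : ℂ) * Complex.I) := by
      have e2 : Complex.exp (((((m + 1 : ℕ) : ℝ) * x : ℝ) : ℂ) * Complex.I) = Complex.exp (x * Complex.I) ^ (m + 1) := by
        rw [← Complex.exp_nat_mul]; congr 1; push_cast; ring
      rw [e2, hz, neg_pow ((r:ℂ) * _), mul_pow (r:ℂ)]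
      have e3 : ((-1:ℂ)) ^ (m + 1 + 1) * (-1) ^ (m + 1) = -1 := by
        rw [← pow_add]; exact Odd.neg_one_pow ⟨m + 1, by ring⟩
      rw [← mul_assoc, e3]; push_cast; ring
    rw [this, Complex.re_ofReal_mul, Complex.exp_ofReal_mul_I_re]; ring
  rw [e] at hre
  have hpos : 0 < ‖1 + z‖ := by
    rw [norm_pos_iff]; intro h'
    have : z = -1 := by linear_combination h'
    rw [this] at hzn; simp at hzn; linarith
  have hn2 : ‖1 + z‖ ^ 2 = 1 - 2 * r * cos x + r ^ 2 := by
    rw [← one_sub_norm_sq, hz, ← sub_eq_add_neg]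
  have key : |2 * sin (x / 2)| ≤ 2 / (1 + r) * ‖1 + z‖ := by
    apply abs_le_of_sq_le_sq _ (by positivity)
    rw [mul_pow, mul_pow, hn2, sin_sq_eq_half_sub, div_pow, div_mul_eq_mul_div, le_div_iff₀ (by positivity),
      show 2 * (x / 2) = x by ring]
    nlinarith [neg_one_le_cos x, mul_nonneg (mul_self_nonneg (1 - r)) (by linarith [neg_one_le_cos x] : 0 ≤ 1 + cos x)]
  refine key.trans ?_
  rw [add_sub_assoc, exp_add, exp_log (by positivity)]
  refine mul_le_mul_of_nonneg_left ?_ (by positivity)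
  rw [← log_le_iff_le_exp hpos]
  linarith

noncomputable def EE (n : ℕ) (φ : ℝ) : ℝ := -∑ k ∈ Finset.range n, cos ((k + 1 : ℕ) * φ)

theorem prod_le {r : ℝ} (h0 : 0 < r) (h1 : r < 1) (K n : ℕ) (θ : ℝ) :
    |∏ k ∈ Finset.range n, (2 * sin ((k + 1 : ℕ) * (θ / 2)))| ≤
      exp (n * (log (2 / (1 + r)) + r ^ (K + 1) * (1 - r)⁻¹ / (K + 1))
      + ∑ m ∈ Finset.range K, r ^ (m + 1) / (m + 1 : ℕ) * EE n ((m + 1 : ℕ) * θ)) := by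
  rw [Finset.abs_prod]
  have : ∀ k ∈ Finset.range n, |2 * sin ((k + 1 : ℕ) * (θ / 2))| ≤
      exp (log (2 / (1 + r)) + r ^ (K + 1) * (1 - r)⁻¹ / (K + 1)
      - ∑ m ∈ Finset.range K, r ^ (m + 1) / (m + 1 : ℕ) * cos ((m + 1 : ℕ) * ((k + 1 : ℕ) * θ))) := fun k _ => by
    have := maj h0 h1 K ((k + 1 : ℕ) * θ)
    rwa [mul_div_assoc] at this
  refine (Finset.prod_le_prod (fun _ _ => abs_nonneg _) this).trans ?_
  rw [← exp_sum]
  refine (congrArg exp ?_).le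
  rw [Finset.sum_sub_distrib, Finset.sum_const, Finset.card_range, nsmul_eq_mul, sub_eq_add_neg]
  congr 1
  rw [Finset.sum_comm, ← Finset.sum_neg_distrib]
  refine Finset.sum_congr rfl fun m _ => ?_
  rw [EE, mul_neg, Finset.mul_sum]
  congr 1
  refine Finset.sum_congr rfl fun k _ => ?_
  congr 2; ring

theorem EE_formula (n : ℕ) (φ : ℝ) : 2 * sin (φ / 2) * EE n φ = sin (φ / 2) - sin ((n + 1 / 2) * φ) := by
  induction n with
  | zero => simp [EE]; ring_nf
  | succ n ih =>
    have : EE (n + 1) φ = EE n φ - cos ((n + 1 : ℕ) * φ) := by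
      unfold EE; rw [Finset.sum_range_succ]; ring
    rw [this, mul_sub, ih]
    have h1 : (n + 1 / 2) * φ = (n + 1 : ℕ) * φ - φ / 2 := by push_cast; ring
    have h2 : ((n + 1 : ℕ) + 1 / 2) * φ = (n + 1 : ℕ) * φ + φ / 2 := by push_cast; ring
    rw [h1, h2, sin_sub, sin_add]; ring

theorem EE_abs (n : ℕ) (φ : ℝ) : EE n |φ| = EE n φ := by
  unfold EE
  rcases abs_choice φ with h | h <;> rw [h]
  simp

theorem EE_per (n : ℕ) (φ : ℝ) (k : ℤ) : EE n (φ + k * (2 * π)) = EE n φ := by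
  unfold EE
  congr 1
  refine Finset.sum_congr rfl fun i _ => ?_
  have : ((i + 1 : ℕ):ℝ) * (φ + k * (2 * π)) = (i + 1 : ℕ) * φ + (((i + 1 : ℕ) * k : ℤ) : ℝ) * (2 * π) := by push_cast; ring
  rw [this, cos_add_int_mul_two_pi]

theorem EE_le1 (n : ℕ) {φ σ : ℝ} (h0 : 0 < σ) (h : σ ≤ |sin (φ / 2)|) : EE n φ ≤ 1 / 2 + 1 / (2 * σ) := by
  have hf := EE_formula n φ
  have hs : sin (φ / 2) ≠ 0 := by intro h'; rw [h'] at h; simp at h; linarith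
  have e : EE n φ = 1 / 2 - sin ((n + 1 / 2) * φ) / (2 * sin (φ / 2)) := by
    rw [eq_sub_iff_add_eq, ← mul_right_inj' (mul_ne_zero two_ne_zero hs), mul_add, hf]
    field_simp; ring
  have : |sin ((n + 1 / 2) * φ) / (2 * sin (φ / 2))| ≤ 1 / (2 * σ) := by
    rw [abs_div, abs_mul, abs_two]
    exact div_le_div₀ zero_le_one (abs_sin_le_one _) (by positivity) (by linarith)
  rw [e]; linarith [neg_abs_le (sin ((n + 1 / 2) * φ) / (2 * sin (φ / 2)))]

theorem EE_nonpos (n : ℕ) {φ : ℝ} (h0 : 0 < sin (φ / 2)) (h : 0 ≤ sin ((n + 1 / 2) * φ)) : EE n φ ≤ 1 / 2 := by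
  have hf := EE_formula n φ
  nlinarith

theorem EE_le22 (n : ℕ) (hn : 400 ≤ n) (φ : ℝ) : EE n φ ≤ 0.22 * n + 0.6 := by
  have hn' : (400:ℝ) ≤ n := by exact_mod_cast hn
  obtain ⟨ψ, hψ, he⟩ : ∃ ψ, (0 ≤ ψ ∧ ψ ≤ π) ∧ EE n φ = EE n ψ := by
    refine ⟨|φ + (-round (φ / (2 * π)) : ℤ) * (2 * π)|, ⟨abs_nonneg _, ?_⟩, by rw [EE_abs, EE_per]⟩
    have h1 := abs_sub_round (φ / (2 * π))
    have e : φ + (-round (φ / (2 * π)) : ℤ) * (2 * π) = (φ / (2 * π) - round (φ / (2 * π))) * (2 * π) := by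
      have := pi_pos.ne'
      push_cast; field_simp; ring
    rw [e, abs_mul, abs_of_pos two_pi_pos]
    nlinarith [pi_pos]
  rw [he]
  rcases hψ.1.eq_or_lt with h0 | h0
  · rw [← h0]; unfold EE; simp; linarith
  have hpi := pi_pos
  have hs0 : 0 < sin (ψ / 2) := sin_pos_of_pos_of_lt_pi (by linarith) (by linarith)
  by_cases hs : 0 ≤ sin ((n + 1 / 2) * ψ)
  · linarith [EE_nonpos n hs0 hs]
  push Not at hs
  by_cases h2 : 0.2 ≤ ψ
  · have : (0.06:ℝ) ≤ |sin (ψ / 2)| := by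
      rw [abs_of_pos hs0]
      have := mul_le_sin (x := ψ / 2) (by linarith) (by linarith)
      have h3 : 2 / π * (ψ / 2) = ψ / π := by ring
      rw [h3] at this
      refine le_trans ?_ this
      rw [le_div_iff₀ hpi]; linarith [pi_hi]
    have := EE_le1 n (by norm_num) this
    norm_num at this; linarith
  push Not at h2
  have hy : π < (n + 1 / 2) * ψ := by
    by_contra hc
    push Not at hc
    exact absurd (sin_nonneg_of_nonneg_of_le_pi (by positivity) hc) (by linarith)
  set y := (n + 1 / 2) * ψ with hyd
  have hsy : - sin y ≤ 0.219 * y := by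
    by_cases hy2 : 2 * π ≤ y
    · have := neg_one_le_sin y
      nlinarith [pi_lo]
    · push Not at hy2
      have e1 : - sin y = cos (y - π - π / 2) := by rw [cos_sub_pi_div_two, sin_sub_pi]
      rw [e1]
      have hu : -1.58 ≤ y - π - π / 2 := by linarith [pi_hi]
      set u := y - π - π / 2
      have : y = u + 3 * π / 2 := by simp only [u]; ring
      by_cases hu2 : 0 ≤ u
      · rw [this]; nlinarith [cos_le_one u, pi_lo]
      · push Not at hu2
        have hb : cos u ≤ 1 - u ^ 2 / 2 + u ^ 4 / 24 := cos_le_quartic u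
        rw [this]
        nlinarith [pi_lo, sq_nonneg (u + 0.22), mul_nonneg (sq_nonneg u) (by nlinarith : 0 ≤ 2.5 - u ^ 2)]
  have hf := EE_formula n ψ
  rw [← hyd] at hf
  have hsin : ψ / 2 * 0.998 ≤ sin (ψ / 2) := by
    have := sin_gt_sub_cube (x := ψ / 2) (by linarith)
    nlinarith [mul_pos h0 h0]
  have h3 : 2 * sin (ψ / 2) * (EE n ψ - 1 / 2) ≤ 2 * sin (ψ / 2) * (0.219 * (n + 1 / 2) / 0.998) := by
    have : 0.219 * y = 2 * (ψ / 2 * 0.998) * (0.219 * (n + 1 / 2) / 0.998) := by rw [hyd]; ring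
    have h4 : 2 * (ψ / 2 * 0.998) * (0.219 * (n + 1 / 2) / 0.998) ≤ 2 * sin (ψ / 2) * (0.219 * (n + 1 / 2) / 0.998) := by gcongr
    nlinarith
  have := le_of_mul_le_mul_left h3 (by positivity)
  norm_num at this ⊢
  linarith

end QP

namespace QP

open Set Real

theorem sum95a : ∑ m ∈ Finset.range 100, ((0.95:ℝ)) ^ (m + 1) / (m + 1 : ℕ) ≤ 3 := by
  norm_num [Finset.sum_range_succ]

theorem sum95b : ∑ m ∈ Finset.Ico 4 30, ((0.95:ℝ)) ^ (m + 1) / (m + 1 : ℕ) / (m + 1 : ℕ)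
   + 1.6 * ∑ m ∈ Finset.Ico 30 100, ((0.95:ℝ)) ^ (m + 1) / (m + 1 : ℕ) / (m + 1 : ℕ) ≤ 0.1222 := by
  norm_num [Finset.sum_Ico_eq_sum_range, Finset.sum_range_succ]

theorem num95 {E : ℕ → ℝ} {A a1 a2 a3 a4 : ℝ} (hA : 0 ≤ A) (h1 : E 1 ≤ 1 / 2 + a1) (h2 : E 2 ≤ 1 / 2 + a2)
    (h3 : E 3 ≤ 1 / 2 + a3) (h4 : E 4 ≤ 1 / 2 + a4) (h5 : ∀ m : ℕ, 1 ≤ m → m ≤ 30 → E m ≤ 1 / 2 + A / m)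
    (h6 : ∀ m : ℕ, 1 ≤ m → m ≤ 100 → E m ≤ 1 / 2 + 1.6 * (A / m)) :
    ∑ m ∈ Finset.range 100, (0.95:ℝ) ^ (m + 1) / (m + 1 : ℕ) * E (m + 1) ≤
      1.5 + 0.95 * a1 + 0.45125 * a2 + 0.857375 / 3 * a3 + 0.81450625 / 4 * a4 + 0.1222 * A := by
  have e : ∑ m ∈ Finset.range 100, (0.95:ℝ) ^ (m + 1) / (m + 1 : ℕ) * E (m + 1) =
     1 / 2 * ∑ m ∈ Finset.range 100, ((0.95:ℝ)) ^ (m + 1) / (m + 1 : ℕ) +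
     ∑ m ∈ Finset.range 100, (0.95:ℝ) ^ (m + 1) / (m + 1 : ℕ) * (E (m + 1) - 1 / 2) := by
    rw [Finset.mul_sum, ← Finset.sum_add_distrib]
    exact Finset.sum_congr rfl fun _ _ => by ring
  have e' : ∀ f : ℕ → ℝ, ∑ m ∈ Finset.range 100, f m = ∑ m ∈ Finset.range 4, f m + ∑ m ∈ Finset.Ico 4 30, f m
      + ∑ m ∈ Finset.Ico 30 100, f m := by
    intro f
    rw [Finset.range_eq_Ico, Finset.range_eq_Ico, Finset.sum_Ico_consecutive f (by norm_num) (by norm_num),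
      Finset.sum_Ico_consecutive f (by norm_num) (by norm_num)]
  rw [e, e' (fun m => (0.95:ℝ) ^ (m + 1) / (m + 1 : ℕ) * (E (m + 1) - 1 / 2))]
  have b1 : ∑ m ∈ Finset.Ico 4 30, (0.95:ℝ) ^ (m + 1) / (m + 1 : ℕ) * (E (m + 1) - 1 / 2) ≤
    A * ∑ m ∈ Finset.Ico 4 30, ((0.95:ℝ)) ^ (m + 1) / (m + 1 : ℕ) / (m + 1 : ℕ) := by
    rw [Finset.mul_sum]
    refine Finset.sum_le_sum fun m hm => ?_
    have := Finset.mem_Ico.1 hm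
    have h := h5 (m + 1) (by omega) (by omega)
    calc _ ≤ (0.95:ℝ) ^ (m + 1) / (m + 1 : ℕ) * (A / (m + 1 : ℕ)) := by gcongr; linarith
      _ = _ := by ring
  have b2 : ∑ m ∈ Finset.Ico 30 100, (0.95:ℝ) ^ (m + 1) / (m + 1 : ℕ) * (E (m + 1) - 1 / 2) ≤
    A * (1.6 * ∑ m ∈ Finset.Ico 30 100, ((0.95:ℝ)) ^ (m + 1) / (m + 1 : ℕ) / (m + 1 : ℕ)) := by
    rw [Finset.mul_sum, Finset.mul_sum]
    refine Finset.sum_le_sum fun m hm => ?_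
    have := Finset.mem_Ico.1 hm
    have h := h6 (m + 1) (by omega) (by omega)
    calc _ ≤ (0.95:ℝ) ^ (m + 1) / (m + 1 : ℕ) * (1.6 * (A / (m + 1 : ℕ))) := by gcongr; linarith
      _ = _ := by ring
  have b3 : ∑ m ∈ Finset.range 4, (0.95:ℝ) ^ (m + 1) / (m + 1 : ℕ) * (E (m + 1) - 1 / 2) =
     0.95 * (E 1 - 1 / 2) + 0.45125 * (E 2 - 1 / 2) + 0.857375 / 3 * (E 3 - 1 / 2) + 0.81450625 / 4 * (E 4 - 1 / 2) := by
    simp only [Finset.sum_range_succ, Finset.sum_range_zero]; norm_num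
  have := mul_le_mul_of_nonneg_left sum95b hA
  have := sum95a
  linarith

theorem sin_nn {x : ℝ} (k : ℕ) (h1 : 2 * π * k ≤ x) (h2 : x ≤ 2 * π * k + π) : 0 ≤ sin x := by
  rw [← sin_sub_nat_mul_two_pi x k]
  exact sin_nonneg_of_nonneg_of_le_pi (by linarith) (by linarith)

theorem regE {N : ℕ} {φ ρ : ℝ} (h0 : 0 < φ) (h100 : 100 * φ ≤ π) (hρ0 : 0 < ρ) (hρ : 1 ≤ ρ * (1 - (15 * φ) ^ 2 / 6)) :
    (∀ m : ℕ, 1 ≤ m → m ≤ 30 → EE N (m * φ) ≤ 1 / 2 + (ρ / φ) / m) ∧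
    (1 ≤ ρ → ∀ m : ℕ, 1 ≤ m → m ≤ 100 → EE N (m * φ) ≤ 1 / 2 + 1.6 * ((ρ / φ) / m)) := by
  constructor
  · intro m hm1 hm2
    have hm1' : (1:ℝ) ≤ m := by exact_mod_cast hm1
    have hm2' : (m:ℝ) ≤ 30 := by exact_mod_cast hm2
    have hx : 0 < m * φ / 2 := by positivity
    have hx2 : m * φ / 2 ≤ 15 * φ := by nlinarith
    have hs : m * φ / (2 * ρ) ≤ |sin (m * φ / 2)| := by
      refine le_trans ?_ (le_abs_self _)
      have h := sin_gt_sub_cube hx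
      refine le_trans ?_ h.le
      rw [div_le_iff₀ (by positivity)]
      have h3 : (m * φ / 2) ^ 2 ≤ (15 * φ) ^ 2 := by gcongr
      have h4 : 1 ≤ ρ * (1 - (m * φ / 2) ^ 2 / 6) := by
        refine hρ.trans (mul_le_mul_of_nonneg_left (by linarith) hρ0.le)
      nlinarith [mul_le_mul_of_nonneg_left h4 (show 0 ≤ m * φ by positivity)]
    refine (EE_le1 N (by positivity) hs).trans (le_of_eq ?_)
    field_simp
  · intro h1ρ m hm1 hm2
    have hm1' : (1:ℝ) ≤ m := by exact_mod_cast hm1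
    have hm2' : (m:ℝ) ≤ 100 := by exact_mod_cast hm2
    have hx : 0 < m * φ / 2 := by positivity
    have hs : m * φ / 3.2 ≤ |sin (m * φ / 2)| := by
      refine le_trans ?_ (le_abs_self _)
      have := mul_le_sin hx.le (by nlinarith)
      refine le_trans ?_ this
      rw [show 2 / π * (m * φ / 2) = m * φ / π by ring]
      gcongr; linarith [pi_hi]
    refine (EE_le1 N (by positivity) hs).trans ?_
    have : 1 / (2 * (m * φ / 3.2)) = 1.6 * (1 / φ / m) := by field_simp; norm_num
    rw [this]; gcongr

theorem prod95 {N : ℕ} {θ S : ℝ} (h : ∑ m ∈ Finset.range 100, (0.95:ℝ) ^ (m + 1) / (m + 1 : ℕ) * EE N ((m + 1 : ℕ) * θ) ≤ S) :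
    |∏ k ∈ Finset.range N, (2 * sin ((k + 1 : ℕ) * (θ / 2)))| ≤ exp (N * 0.02681 + S) := by
  refine (prod_le (r := 0.95) (by norm_num) (by norm_num) 100 N θ).trans (exp_le_exp.2 ?_)
  have h1 : log (2 / (1 + 0.95)) ≤ 0.02565 := by
    refine (log_le_sub_one_of_pos (by norm_num)).trans (by norm_num)
  have h2 : (0.95:ℝ) ^ (100 + 1) * (1 - 0.95)⁻¹ / ((100 : ℕ) + 1) ≤ 0.00116 := by norm_num
  gcongr
  linarith

/-- near 0, first range -/
theorem minor_b1 {n : ℕ} (hn : 900 ≤ n) {θ : ℝ} (h1 : 2 * π ≤ n * θ) (h2 : n * θ ≤ 8 * π) :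
    |∏ k ∈ Finset.range n, (2 * sin ((k + 1 : ℕ) * (θ / 2)))| ≤ exp (0.159 * n) := by
  have hn' : (900:ℝ) ≤ n := by exact_mod_cast hn
  have hpi := pi_pos
  have hθ : 0 < θ := by by_contra h; push Not at h; nlinarith
  have hθ2 : θ ≤ 8 * π / 900 := by rw [le_div_iff₀ (by norm_num)]; nlinarith
  have hpl := pi_lo
  have hph := pi_hi
  have hθ3 : θ ≤ 0.02793 := by linarith
  obtain ⟨r1, r2⟩ := regE (N := n) (ρ := 1.031) hθ (by linarith) (by norm_num) (by nlinarith)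
  replace r2 := r2 (by norm_num)
  set T := (n + 1 / 2) * θ with hT
  set A := 1.031 / θ with hA
  have hA0 : 0 ≤ A := by positivity
  have hAT : A * T = 1.031 * (n + 1 / 2) := by rw [hA, hT]; field_simp
  have hT1 : 2 * π ≤ T := by rw [hT]; linarith
  have z : ∀ m k : ℕ, 1 ≤ m → m ≤ 4 → 2 * π * k ≤ m * T → m * T ≤ 2 * π * k + π → EE n (m * θ) ≤ 1 / 2 + 0 := by
    intro m k hm hm4 ha hb
    have hm' : (1:ℝ) ≤ m := by exact_mod_cast hm
    have hm4' : (m:ℝ) ≤ 4 := by exact_mod_cast hm4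
    rw [add_zero]
    apply EE_nonpos
    · apply sin_pos_of_pos_of_lt_pi (by positivity)
      nlinarith
    · apply sin_nn k
      · rw [show (n + 1 / 2 : ℝ) * (m * θ) = m * T by rw [hT]; ring]; exact ha
      · rw [show (n + 1 / 2 : ℝ) * (m * θ) = m * T by rw [hT]; ring]; exact hb
  have q := fun m h h' => r1 m h h'
  have fin : ∀ S : ℝ, ∑ m ∈ Finset.range 100, (0.95:ℝ) ^ (m + 1) / (m + 1 : ℕ) * EE n ((m + 1 : ℕ) * θ) ≤ S →
      n * 0.02681 + S ≤ 0.159 * n → |∏ k ∈ Finset.range n, (2 * sin ((k + 1 : ℕ) * (θ / 2)))| ≤ exp (0.159 * n) := by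
    intro S hS h
    exact (prod95 hS).trans (exp_le_exp.2 h)
  have q1 := q 1 (by norm_num) (by norm_num)
  have q2 := q 2 (by norm_num) (by norm_num)
  have q3 := q 3 (by norm_num) (by norm_num)
  have q4 := q 4 (by norm_num) (by norm_num)
  have up : ∀ c : ℝ, 0 < c → c ≤ T → A ≤ 1.031 * (n + 1 / 2) / c := by
    intro c hc h
    rw [le_div_iff₀ hc, ← hAT]; gcongr
  by_cases c1 : T ≤ 3 * π
  · have z1 := z 1 1 (by norm_num) (by norm_num) (by push_cast; linarith) (by push_cast; linarith)
    refine fin _ (num95 (E := fun m => EE n (m * θ)) hA0 z1 q2 q3 q4 r1 r2) ?_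
    have := up 6.283 (by norm_num) (by linarith)
    norm_num at this ⊢; linarith
  push Not at c1
  by_cases c2 : T ≤ 3.25 * π
  · have z2 := z 2 3 (by norm_num) (by norm_num) (by push_cast; linarith) (by push_cast; linarith)
    have z4 := z 4 6 (by norm_num) (by norm_num) (by push_cast; linarith) (by push_cast; linarith)
    refine fin _ (num95 (E := fun m => EE n (m * θ)) hA0 q1 z2 q3 z4 r1 r2) ?_
    have := up 9.4247 (by norm_num) (by linarith)
    norm_num at this ⊢; linarith
  push Not at c2
  by_cases c3 : T ≤ 3.5 * π
  · have z2 := z 2 3 (by norm_num) (by norm_num) (by push_cast; linarith) (by push_cast; linarith)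
    refine fin _ (num95 (E := fun m => EE n (m * θ)) hA0 q1 z2 q3 q4 r1 r2) ?_
    have := up 10.21 (by norm_num) (by linarith)
    norm_num at this ⊢; linarith
  push Not at c3
  by_cases c4 : T ≤ 11 / 3 * π
  · have z3 := z 3 5 (by norm_num) (by norm_num) (by push_cast; linarith) (by push_cast; linarith)
    refine fin _ (num95 (E := fun m => EE n (m * θ)) hA0 q1 q2 z3 q4 r1 r2) ?_
    have := up 10.995 (by norm_num) (by linarith)
    norm_num at this ⊢; linarith
  push Not at c4
  · refine fin _ (num95 (E := fun m => EE n (m * θ)) hA0 q1 q2 q3 q4 r1 r2) ?_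
    have := up 11.519 (by norm_num) (by linarith)
    norm_num at this ⊢; linarith

/-- the half-length product near π -/
theorem minor_J {J : ℕ} (hn : 449 ≤ J) {θ : ℝ} (h1 : π / 2 ≤ (J + 1 / 2) * θ) (h2 : (J + 1 / 2) * θ ≤ 2 * π) :
    |∏ k ∈ Finset.range J, (2 * sin ((k + 1 : ℕ) * (θ / 2)))| ≤ exp (0.318 * J - 0.55) := by
  have hn' : (449:ℝ) ≤ J := by exact_mod_cast hn
  have hpi := pi_pos
  have hθ : 0 < θ := by by_contra h; push Not at h; nlinarith
  have hθ2 : θ ≤ 2 * π / 449 := by rw [le_div_iff₀ (by norm_num)]; nlinarith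
  have hpl := pi_lo
  have hph := pi_hi
  have hθ3 : θ ≤ 0.014 := by linarith
  obtain ⟨r1, r2⟩ := regE (N := J) (ρ := 1.0075) hθ (by linarith) (by norm_num) (by nlinarith)
  replace r2 := r2 (by norm_num)
  set T := (J + 1 / 2) * θ with hT
  set A := 1.0075 / θ with hA
  have hA0 : 0 ≤ A := by positivity
  have hAT : A * T = 1.0075 * (J + 1 / 2) := by rw [hA, hT]; field_simp
  have z : ∀ m k : ℕ, 1 ≤ m → m ≤ 4 → 2 * π * k ≤ m * T → m * T ≤ 2 * π * k + π → EE J (m * θ) ≤ 1 / 2 + 0 := by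
    intro m k hm hm4 ha hb
    have hm' : (1:ℝ) ≤ m := by exact_mod_cast hm
    have hm4' : (m:ℝ) ≤ 4 := by exact_mod_cast hm4
    rw [add_zero]
    apply EE_nonpos
    · apply sin_pos_of_pos_of_lt_pi (by positivity)
      nlinarith
    · apply sin_nn k
      · rw [show (J + 1 / 2 : ℝ) * (m * θ) = m * T by rw [hT]; ring]; exact ha
      · rw [show (J + 1 / 2 : ℝ) * (m * θ) = m * T by rw [hT]; ring]; exact hb
  have q := fun m h h' => r1 m h h'
  have fin : ∀ S : ℝ, ∑ m ∈ Finset.range 100, (0.95:ℝ) ^ (m + 1) / (m + 1 : ℕ) * EE J ((m + 1 : ℕ) * θ) ≤ S →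
      J * 0.02681 + S ≤ 0.318 * J - 0.55 → |∏ k ∈ Finset.range J, (2 * sin ((k + 1 : ℕ) * (θ / 2)))| ≤ exp (0.318 * J - 0.55) := by
    intro S hS h
    exact (prod95 hS).trans (exp_le_exp.2 h)
  have q1 := q 1 (by norm_num) (by norm_num)
  have q2 := q 2 (by norm_num) (by norm_num)
  have q3 := q 3 (by norm_num) (by norm_num)
  have q4 := q 4 (by norm_num) (by norm_num)
  have k1 : EE J ((1 : ℕ) * θ) ≤ 1 / 2 + (0.22 * J + 0.1) := (EE_le22 J (by omega) _).trans (by linarith)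
  have up : ∀ c : ℝ, 0 < c → c ≤ T → A ≤ 1.0075 * (J + 1 / 2) / c := by
    intro c hc h
    rw [le_div_iff₀ hc, ← hAT]; gcongr
  by_cases c0 : T ≤ 2 / 3 * π
  · have z1 := z 1 0 (by norm_num) (by norm_num) (by push_cast; linarith) (by push_cast; linarith)
    have z4 := z 4 1 (by norm_num) (by norm_num) (by push_cast; linarith) (by push_cast; linarith)
    refine fin _ (num95 (E := fun m => EE J (m * θ)) hA0 z1 q2 q3 z4 r1 r2) ?_
    have := up 1.57079 (by norm_num) (by linarith)
    norm_num at this ⊢; linarith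
  push Not at c0
  by_cases c1 : T ≤ π
  · have z1 := z 1 0 (by norm_num) (by norm_num) (by push_cast; linarith) (by push_cast; linarith)
    have z3 := z 3 1 (by norm_num) (by norm_num) (by push_cast; linarith) (by push_cast; linarith)
    refine fin _ (num95 (E := fun m => EE J (m * θ)) hA0 z1 q2 z3 q4 r1 r2) ?_
    have := up 2.094 (by norm_num) (by linarith)
    norm_num at this ⊢; linarith
  push Not at c1
  by_cases c2 : T ≤ 1.25 * π
  · have z2 := z 2 1 (by norm_num) (by norm_num) (by push_cast; linarith) (by push_cast; linarith)
    have z4 := z 4 2 (by norm_num) (by norm_num) (by push_cast; linarith) (by push_cast; linarith)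
    refine fin _ (num95 (E := fun m => EE J (m * θ)) hA0 k1 z2 q3 z4 r1 r2) ?_
    have := up 3.1415 (by norm_num) (by linarith)
    norm_num at this ⊢; linarith
  push Not at c2
  by_cases c3 : T ≤ 1.5 * π
  · have z2 := z 2 1 (by norm_num) (by norm_num) (by push_cast; linarith) (by push_cast; linarith)
    refine fin _ (num95 (E := fun m => EE J (m * θ)) hA0 k1 z2 q3 q4 r1 r2) ?_
    have := up 3.9269 (by norm_num) (by linarith)
    norm_num at this ⊢; linarith
  push Not at c3
  by_cases c4 : T ≤ 5 / 3 * π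
  · have z3 := z 3 2 (by norm_num) (by norm_num) (by push_cast; linarith) (by push_cast; linarith)
    have z4 := z 4 3 (by norm_num) (by norm_num) (by push_cast; linarith) (by push_cast; linarith)
    refine fin _ (num95 (E := fun m => EE J (m * θ)) hA0 q1 q2 z3 z4 r1 r2) ?_
    have := up 4.712 (by norm_num) (by linarith)
    norm_num at this ⊢; linarith
  push Not at c4
  · refine fin _ (num95 (E := fun m => EE J (m * θ)) hA0 q1 q2 q3 q4 r1 r2) ?_
    have := up 5.2359 (by norm_num) (by linarith)
    norm_num at this ⊢; linarith

end QP

namespace QP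

open Set Real

theorem pair_le {δ : ℝ} (h0 : 0 ≤ δ) (J : ℕ) (hJ : (J + 1 / 2) * δ ≤ π / 2) :
    |∏ k ∈ Finset.range (2 * J + 1), (2 * sin ((k + 1 : ℕ) * ((π - δ) / 2)))| ≤
      2 * |∏ k ∈ Finset.range J, (2 * sin ((k + 1 : ℕ) * (4 * δ / 2)))| := by
  induction J with
  | zero =>
    simp only [Nat.mul_zero, Finset.prod_range_succ, Finset.prod_range_zero, one_mul, abs_one, mul_one, zero_add]
    rw [abs_mul, abs_two]
    linarith [abs_sin_le_one (((1 : ℕ):ℝ) * ((π - δ) / 2))]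
  | succ J ih =>
    have hJ' : (J + 1 / 2) * δ ≤ π / 2 := by
      refine le_trans ?_ hJ
      push_cast; nlinarith
    rw [show 2 * (J + 1) + 1 = (2 * J + 1) + 1 + 1 by ring, Finset.prod_range_succ, Finset.prod_range_succ,
      Finset.prod_range_succ (n := J), mul_assoc, abs_mul, abs_mul _ (2 * sin ((J + 1 : ℕ) * (4 * δ / 2))), ← mul_assoc (2:ℝ) |_|]
    refine mul_le_mul (ih hJ') ?_ (abs_nonneg _) (by positivity)
    set x := ((J:ℝ) + 1) * δ with hx
    have e1 : |sin ((2 * J + 1 + 1 : ℕ) * ((π - δ) / 2))| = |sin x| := by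
      rw [show ((2 * J + 1 + 1 : ℕ):ℝ) * ((π - δ) / 2) = ((J + 1 : ℕ) : ℝ) * π - x by rw [hx]; push_cast; ring,
        sin_nat_mul_pi_sub, abs_neg, abs_mul, abs_pow, abs_neg, abs_one, one_pow, one_mul]
    have e2 : |sin ((2 * J + 2 + 1 : ℕ) * ((π - δ) / 2))| = |cos (x + δ / 2)| := by
      rw [show ((2 * J + 2 + 1 : ℕ):ℝ) * ((π - δ) / 2) = ((J + 1 : ℕ) : ℝ) * π - (x + δ / 2 - π / 2) by rw [hx]; push_cast; ring,
        sin_nat_mul_pi_sub, abs_neg, abs_mul, abs_pow, abs_neg, abs_one, one_pow, one_mul, sin_sub_pi_div_two, abs_neg]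
    have hx2 : x + δ / 2 ≤ π / 2 := by rw [hx]; push_cast at hJ; linarith
    have hx0 : 0 ≤ x := by positivity
    have hpi := pi_pos
    have c1 : 0 ≤ cos (x + δ / 2) := cos_nonneg_of_neg_pi_div_two_le_of_le (by linarith) hx2
    have c2 : cos (x + δ / 2) ≤ cos x := cos_le_cos_of_nonneg_of_le_pi hx0 (by linarith) (by linarith)
    have s1 : 0 ≤ sin x := sin_nonneg_of_nonneg_of_le_pi hx0 (by linarith)
    rw [abs_mul, abs_mul 2, abs_mul 2, e1, e2, abs_two, abs_of_nonneg s1, abs_of_nonneg c1,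
      show (((J + 1 : ℕ)):ℝ) * (4 * δ / 2) = 2 * x by rw [hx]; push_cast; ring, sin_two_mul]
    refine le_trans ?_ (le_abs_self _)
    nlinarith [mul_le_mul_of_nonneg_left c2 s1]

theorem minor_pi0 {n : ℕ} (hn : 900 ≤ n) (ho : Odd n) {θ : ℝ} (h1 : θ ≤ π) (h2 : n * (π - θ) ≤ π) :
    |∏ k ∈ Finset.range n, (2 * sin ((k + 1 : ℕ) * (θ / 2)))| ≤ exp (0.159 * n) := by
  obtain ⟨J, rfl⟩ := ho
  have hJ : 450 ≤ J := by omega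
  have hpi := pi_pos
  set δ := π - θ with hδ
  have hJδ : (J + 1 / 2) * δ ≤ π / 2 := by push_cast at h2; linarith
  have h := pair_le (by linarith : 0 ≤ δ) J hJδ
  rw [show π - δ = θ by rw [hδ]; ring] at h
  have hb : |∏ k ∈ Finset.range J, (2 * sin ((k + 1 : ℕ) * (4 * δ / 2)))| ≤ exp (0.318 * J - 0.55) := by
    by_cases hc : π / 2 ≤ (J + 1 / 2) * (4 * δ)
    · exact minor_J (by omega) hc (by linarith)
    push Not at hc
    set φ := (π / 2) / (J + 1 / 2 : ℝ) with hφ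
    have hφ' : (J + 1 / 2 : ℝ) * φ = π / 2 := by rw [hφ]; field_simp
    refine le_trans ?_ (minor_J (J := J) (θ := φ) (by omega) hφ'.ge (by linarith))
    rw [Finset.abs_prod, Finset.abs_prod]
    refine Finset.prod_le_prod (fun _ _ => abs_nonneg _) fun k hk => ?_
    have hk' : ((k + 1 : ℕ) : ℝ) ≤ J := by exact_mod_cast Finset.mem_range.1 hk
    have hφ0 : 0 < φ := by positivity
    have hle : 4 * δ ≤ φ := by
      rw [hφ, le_div_iff₀ (by positivity)]; linarith
    have hδ0 : 0 ≤ δ := by linarith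
    have a1 : ((k + 1 : ℕ):ℝ) * (φ / 2) ≤ π / 2 := by
      have : ((k + 1 : ℕ):ℝ) * φ ≤ (J + 1 / 2) * φ := by gcongr; linarith
      linarith
    have a2 : ((k + 1 : ℕ):ℝ) * (4 * δ / 2) ≤ (k + 1 : ℕ) * (φ / 2) := by gcongr
    have a0 : 0 ≤ ((k + 1 : ℕ):ℝ) * (4 * δ / 2) := by positivity
    have s0 := sin_nonneg_of_nonneg_of_le_pi a0 (by linarith)
    have s1 := sin_le_sin_of_le_of_le_pi_div_two (by linarith) a1 a2
    rw [abs_of_nonneg (by linarith), abs_of_nonneg (by linarith)]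
    linarith
  have h2e : (2:ℝ) ≤ exp 0.7 := by
    rw [← Real.log_le_iff_le_exp (by norm_num)]
    have := Real.log_two_lt_d9
    linarith
  calc _ ≤ 2 * |∏ k ∈ Finset.range J, (2 * sin ((k + 1 : ℕ) * (4 * δ / 2)))| := h
    _ ≤ exp 0.7 * exp (0.318 * J - 0.55) := mul_le_mul h2e hb (abs_nonneg _) (exp_pos _).le
    _ = exp (0.7 + (0.318 * J - 0.55)) := by rw [exp_add]
    _ ≤ _ := by
      apply exp_le_exp.2; push_cast; linarith

theorem EE_near_pi (n m : ℕ) (θ : ℝ) (h : 2 ∣ m) : EE n (m * θ) = EE n (m * (π - θ)) := by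
  obtain ⟨j, rfl⟩ := h
  rw [← EE_abs n (((2 * j : ℕ):ℝ) * θ), ← abs_neg, EE_abs, ← EE_per n _ j]
  congr 1; push_cast; ring

theorem EE_odd (n m : ℕ) (θ : ℝ) (h : ¬ 2 ∣ m) (hθ : θ ≤ π) (hm : m * (π - θ) / 2 ≤ π / 4) : EE n (m * θ) ≤ 1 / 2 + 0.72 := by
  obtain ⟨j, rfl⟩ : ∃ j, m = 2 * j + 1 := ⟨m / 2, by omega⟩
  have hpi := pi_pos
  have : (0.7:ℝ) ≤ |sin ((2 * j + 1 : ℕ) * θ / 2)| := by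
    set y := (2 * j + 1 : ℕ) * (π - θ) / 2 with hy
    rw [show ((2 * j + 1 : ℕ):ℝ) * θ / 2 = (j : ℝ) * π - (y - π / 2) by rw [hy]; push_cast; ring,
        sin_nat_mul_pi_sub, abs_neg, abs_mul, abs_pow, abs_neg, abs_one, one_pow, one_mul, sin_sub_pi_div_two, abs_neg]
    have hy0 : 0 ≤ y := by
      rw [hy]; have : 0 ≤ π - θ := by linarith
      positivity
    have := cos_le_cos_of_nonneg_of_le_pi hy0 (by linarith) hm
    rw [cos_pi_div_four] at this
    have h2 : (1.4:ℝ) ≤ √2 := by apply le_sqrt_of_sq_le; norm_num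
    exact le_trans (by linarith) (le_abs_self _)
  refine (EE_le1 n (by norm_num) this).trans (by norm_num)

theorem sum95c : ∑ m ∈ Finset.range 100, (if 2 ∣ m + 1 then ((0.95:ℝ)) ^ (m + 1) / (m + 1 : ℕ) / (m + 1 : ℕ) else 0) ≤ 0.33 := by
  norm_num [Finset.sum_range_succ]

theorem minor_pi1 {n : ℕ} (hn : 900 ≤ n) {θ : ℝ} (h1 : π ≤ n * (π - θ)) (h2 : n * (π - θ) ≤ 4 * π) :
    |∏ k ∈ Finset.range n, (2 * sin ((k + 1 : ℕ) * (θ / 2)))| ≤ exp (0.159 * n) := by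
  have hn' : (900:ℝ) ≤ n := by exact_mod_cast hn
  have hpi := pi_pos
  have hpl := pi_lo
  have hph := pi_hi
  set δ := π - θ with hδ
  have hδ0 : 0 < δ := by by_contra h; push Not at h; nlinarith
  have hδ1 : δ ≤ 4 * π / 900 := by rw [le_div_iff₀ (by norm_num)]; nlinarith
  have hS : ∑ m ∈ Finset.range 100, (0.95:ℝ) ^ (m + 1) / (m + 1 : ℕ) * EE n ((m + 1 : ℕ) * θ) ≤ 1.22 * 3 + 0.36 * n * 0.33 := by
    refine le_trans (Finset.sum_le_sum (g := fun m => 1.22 * ((0.95:ℝ) ^ (m + 1) / (m + 1 : ℕ)) +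
      0.36 * n * (if 2 ∣ m + 1 then ((0.95:ℝ)) ^ (m + 1) / (m + 1 : ℕ) / (m + 1 : ℕ) else 0)) fun m hm => ?_) ?_
    · have hm' : ((m + 1 : ℕ):ℝ) ≤ 100 := by exact_mod_cast Finset.mem_range.1 hm
      have hm0 : (0:ℝ) < ((m + 1 : ℕ):ℝ) := by positivity
      split_ifs with hd
      · have : EE n ((m + 1 : ℕ) * θ) ≤ 1.22 + 0.36 * n / (m + 1 : ℕ) := by
          rw [EE_near_pi n _ _ hd, ← hδ]
          have hx : 0 < (m + 1 : ℕ) * δ / 2 := by positivity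
          have hx1 : (m + 1 : ℕ) * δ / 2 ≤ 0.7 := by nlinarith
          have hs : (m + 1 : ℕ) * δ / 2 * 0.9 ≤ |sin ((m + 1 : ℕ) * δ / 2)| := by
            refine le_trans ?_ (le_abs_self _)
            have := sin_gt_sub_cube hx
            nlinarith [mul_nonneg hx.le (show 0 ≤ 0.49 - ((m + 1 : ℕ) * δ / 2) ^ 2 by nlinarith)]
          refine (EE_le1 n (by positivity) hs).trans ?_
          have : 1 / (2 * ((m + 1 : ℕ) * δ / 2 * 0.9)) ≤ 0.36 * n / (m + 1 : ℕ) := by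
            rw [div_le_div_iff₀ (by positivity) hm0]
            nlinarith [mul_le_mul_of_nonneg_left h1 hm0.le]
          linarith
        calc _ ≤ (0.95:ℝ) ^ (m + 1) / (m + 1 : ℕ) * (1.22 + 0.36 * n / (m + 1 : ℕ)) := by gcongr
          _ = _ := by ring
      · have := EE_odd n (m + 1) θ hd (by linarith) (by rw [← hδ]; nlinarith)
        calc _ ≤ (0.95:ℝ) ^ (m + 1) / (m + 1 : ℕ) * 1.22 := by gcongr; linarith
          _ = _ := by ring
    · rw [Finset.sum_add_distrib, ← Finset.mul_sum, ← Finset.mul_sum]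
      have := sum95a
      have := sum95c
      gcongr
  exact (prod95 hS).trans (exp_le_exp.2 (by linarith))

theorem sum85a : ∑ m ∈ Finset.range 18, ((0.85:ℝ)) ^ (m + 1) / (m + 1 : ℕ) ≤ 1.9 := by
  norm_num [Finset.sum_range_succ]
theorem sum85b : ∑ m ∈ Finset.Ico 18 40, ((0.85:ℝ)) ^ (m + 1) / (m + 1 : ℕ) ≤ 0.0162 := by
  norm_num [Finset.sum_Ico_eq_sum_range, Finset.sum_range_succ]
theorem sum85c : ∑ m ∈ Finset.range 18, ((0.85:ℝ)) ^ (m + 1) / (m + 1 : ℕ) / (m + 1 : ℕ) ≤ 1.19 := by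
  norm_num [Finset.sum_range_succ]
theorem sum85q : ∀ b ∈ Finset.Icc 3 36, ∑ m ∈ Finset.range 18, (if b ∣ m + 1 then ((17/20:ℚ)) ^ (m + 1) / (m + 1 : ℕ) else 0)
    ≤ if b = 3 then 314 / 1000 else 182 / 1000 := by
  decide +kernel
theorem sum85q2 : ∑ m ∈ Finset.range 18, (if 2 ∣ m + 1 then ((17/20:ℚ)) ^ (m + 1) / (m + 1 : ℕ) / (m + 1 : ℕ) else 0) ≤ 0.24 := by
  decide +kernel

theorem sum85d {b : ℕ} (h1 : 3 ≤ b) (h2 : b ≤ 36) :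
    ∑ m ∈ Finset.range 18, (if b ∣ m + 1 then ((0.85:ℝ)) ^ (m + 1) / (m + 1 : ℕ) else 0) ≤ if b = 3 then 0.314 else 0.182 := by
  have := sum85q b (Finset.mem_Icc.2 ⟨h1, h2⟩)
  rw [← Rat.cast_le (K := ℝ)] at this
  push_cast [apply_ite ((↑) : ℚ → ℝ)] at this
  norm_num at this ⊢
  exact this

theorem prod85 {n : ℕ} (hn : 900 ≤ n) {θ S : ℝ} (h : ∑ m ∈ Finset.range 18, (0.85:ℝ) ^ (m + 1) / (m + 1 : ℕ) * EE n ((m + 1 : ℕ) * θ) ≤ S)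
    (hS : S ≤ 0.077 * n) :
    |∏ k ∈ Finset.range n, (2 * sin ((k + 1 : ℕ) * (θ / 2)))| ≤ exp (0.159 * n) := by
  have hn' : (900:ℝ) ≤ n := by exact_mod_cast hn
  refine (prod_le (r := 0.85) (by norm_num) (by norm_num) 40 n θ).trans (exp_le_exp.2 ?_)
  have h1 : log (2 / (1 + 0.85)) ≤ 0.0781 := by
    rw [log_le_iff_le_exp (by norm_num)]
    refine le_trans ?_ (quadratic_le_exp_of_nonneg (by norm_num)); norm_num
  have h2 : (0.85:ℝ) ^ (40 + 1) * (1 - 0.85)⁻¹ / ((40 : ℕ) + 1) ≤ 0.00022 := by norm_num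
  have h3 : ∑ m ∈ Finset.Ico 18 40, (0.85:ℝ) ^ (m + 1) / (m + 1 : ℕ) * EE n ((m + 1 : ℕ) * θ) ≤ (0.22 * n + 0.6) * 0.0162 := by
    calc _ ≤ ∑ m ∈ Finset.Ico 18 40, (0.85:ℝ) ^ (m + 1) / (m + 1 : ℕ) * (0.22 * n + 0.6) := by
          refine Finset.sum_le_sum fun m _ => ?_
          gcongr; exact EE_le22 n (by omega) _
      _ = (0.22 * n + 0.6) * ∑ m ∈ Finset.Ico 18 40, (0.85:ℝ) ^ (m + 1) / (m + 1 : ℕ) := by rw [← Finset.sum_mul, mul_comm]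
      _ ≤ _ := by gcongr; exact sum85b
  rw [← Finset.sum_range_add_sum_Ico _ (show 18 ≤ 40 by norm_num)]
  have h4 : (n:ℝ) * (log (2 / (1 + 0.85)) + 0.85 ^ (40 + 1) * (1 - 0.85)⁻¹ / ((40 : ℕ) + 1)) ≤ n * (0.0781 + 0.00022) := by gcongr
  linarith

theorem nonmult {ν : ℝ} {q : ℚ} (h : |ν - q| ≤ 1 / ((36 + 1) * q.den)) (hb : 3 ≤ q.den) {m : ℕ} (hm : m ≤ 18)
    (hd : ¬ q.den ∣ m) : 1.49 / q.den ≤ |sin (π * (m * ν))| := by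
  set b := q.den with hbd
  have hb' : (3:ℝ) ≤ b := by exact_mod_cast hb
  have hm' : (m:ℝ) ≤ 18 := by exact_mod_cast hm
  have hpi := pi_pos
  set k := round (m * ν) with hk
  set u := m * ν - k with hu
  have hu1 : |u| ≤ 1 / 2 := abs_sub_round _
  have hq : (q:ℝ) * b = q.num := by exact_mod_cast Rat.mul_den_eq_num q
  have hintg : (1:ℝ) ≤ |((m * q.num - k * b : ℤ) : ℝ)| := by
    have : m * q.num - k * b ≠ 0 := by
      intro h0
      apply hd
      have h1 : (b:ℤ) ∣ m * q.num := ⟨k, by linarith⟩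
      have h2 : IsCoprime (b:ℤ) q.num := by
        have := q.reduced
        rw [← hbd] at this
        exact (Int.isCoprime_iff_gcd_eq_one.2 (by rw [Int.gcd_comm]; exact this))
      exact_mod_cast h2.dvd_of_dvd_mul_right h1
    exact_mod_cast Int.one_le_abs this
  have hu2 : 1 / (2 * b) ≤ |u| := by
    have e : ((m * q.num - k * b : ℤ):ℝ) = b * u - m * b * (ν - q) := by
      push_cast; rw [hu, ← hq]; ring
    rw [e] at hintg
    have h3 := abs_sub (b * u) (m * b * (ν - q))
    rw [abs_mul, abs_mul, abs_of_pos (by positivity : (0:ℝ) < b), abs_of_nonneg (by positivity : (0:ℝ) ≤ m * b)] at h3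
    have h4 : m * b * |ν - q| ≤ 18 / 37 := by
      calc m * b * |ν - q| ≤ 18 * b * (1 / ((36 + 1) * b)) := by gcongr
        _ = 18 / 37 := by field_simp; norm_num
    rw [div_le_iff₀ (by positivity)]
    linarith
  have e : |sin (π * (m * ν))| = sin (π * |u|) := by
    rw [show π * (m * ν) = π * u + k * π by rw [hu]; ring, sin_add_int_mul_pi]
    have : |((-1:ℝ) ^ k)| = 1 := by rw [abs_zpow]; simp
    rw [abs_mul, this, one_mul]
    have h5 : 0 ≤ sin (π * |u|) := sin_nonneg_of_nonneg_of_le_pi (by positivity) (by nlinarith)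
    rcases abs_choice u with h | h
    · rw [h] at h5 ⊢; exact abs_of_nonneg h5
    · rw [h] at h5 ⊢; rw [mul_neg, sin_neg] at h5 ⊢; rw [abs_of_nonpos (by linarith)]
  rw [e]
  have h6 : sin (π / (2 * b)) ≤ sin (π * |u|) := by
    apply sin_le_sin_of_le_of_le_pi_div_two
    · have : 0 < π / (2 * b) := by positivity
      linarith
    · nlinarith
    · calc π / (2 * b) = π * (1 / (2 * b)) := by ring
        _ ≤ _ := by gcongr
  refine le_trans ?_ h6
  have h7 := sin_gt_sub_cube (x := π / (2 * b)) (by positivity)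
  refine le_trans ?_ h7.le
  have h8 : π / (2 * b) ≤ 0.5237 := by
    rw [div_le_iff₀ (by positivity)]; linarith [pi_hi]
  have h9 : 1.49 / b ≤ π / (2 * b) * 0.954 := by
    rw [div_mul_eq_mul_div, div_le_div_iff₀ (by positivity) (by positivity)]
    nlinarith [pi_lo]
  have h10 : 0 < π / (2 * b) := by positivity
  nlinarith [mul_nonneg h10.le (show 0 ≤ 0.5237 ^ 2 - (π / (2 * b)) ^ 2 by nlinarith)]

theorem minor {n : ℕ} (hn : 900 ≤ n) (ho : Odd n) {θ : ℝ} (h1 : 2 * π ≤ n * θ) (h2 : θ ≤ π) :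
    |∏ k ∈ Finset.range n, (2 * sin ((k + 1 : ℕ) * (θ / 2)))| ≤ exp (0.159 * n) := by
  have hn' : (900:ℝ) ≤ n := by exact_mod_cast hn
  have hpi := pi_pos
  have hpl := pi_lo
  have hph := pi_hi
  by_cases hA : n * θ ≤ 8 * π
  · exact minor_b1 hn h1 hA
  push Not at hA
  by_cases hB : n * (π - θ) ≤ π
  · exact minor_pi0 hn ho h2 hB
  push Not at hB
  by_cases hC : n * (π - θ) ≤ 4 * π
  · exact minor_pi1 hn hB.le hC
  push Not at hC
  set ν := θ / (2 * π) with hν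
  have hθν : θ = 2 * π * ν := by rw [hν]; field_simp
  have hν0 : 0 < ν := by
    rw [hν]; apply div_pos _ two_pi_pos
    by_contra h; push Not at h; nlinarith
  have hν1 : ν ≤ 1 / 2 := by rw [hν, div_le_iff₀ two_pi_pos]; linarith
  obtain ⟨q, hq, hqd⟩ := Real.exists_rat_abs_sub_le_and_den_le ν (n := 36) (by norm_num)
  push_cast at hq
  by_cases hb3 : 3 ≤ q.den
  · have hb' : (3:ℝ) ≤ q.den := by exact_mod_cast hb3
    set b := q.den with hbd
    refine prod85 hn (S := (1 / 2 + 0.336 * b) * 1.9 + (0.22 * n + 0.6) * (if b = 3 then 0.314 else 0.182)) ?_ ?_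
    · refine le_trans (Finset.sum_le_sum (g := fun m => (1 / 2 + 0.336 * b) * ((0.85:ℝ) ^ (m + 1) / (m + 1 : ℕ)) +
        (0.22 * n + 0.6) * (if b ∣ m + 1 then ((0.85:ℝ)) ^ (m + 1) / (m + 1 : ℕ) else 0)) fun m hm => ?_) ?_
      · have hm' := Finset.mem_range.1 hm
        split_ifs with hd
        · calc _ ≤ (0.85:ℝ) ^ (m + 1) / (m + 1 : ℕ) * (0.22 * n + 0.6) := by gcongr; exact EE_le22 n (by omega) _
            _ ≤ _ := by
              have : 0 ≤ (1 / 2 + 0.336 * b) * ((0.85:ℝ) ^ (m + 1) / (m + 1 : ℕ)) := by positivity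
              linarith
        · have h := nonmult hq hb3 (m := m + 1) (by omega) hd
          rw [show π * ((m + 1 : ℕ) * ν) = (m + 1 : ℕ) * θ / 2 by rw [hθν]; ring] at h
          have h' := EE_le1 n (by positivity) h
          have h3 : 1 / (2 * (1.49 / (b:ℝ))) ≤ 0.336 * b := by
            rw [div_le_iff₀ (by positivity)]
            field_simp; norm_num
          calc _ ≤ (0.85:ℝ) ^ (m + 1) / (m + 1 : ℕ) * (1 / 2 + 0.336 * b) := by gcongr; linarith
            _ = _ := by ring
      · rw [Finset.sum_add_distrib, ← Finset.mul_sum, ← Finset.mul_sum]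
        have := sum85a
        have := sum85d hb3 hqd
        gcongr
    · have hb36 : (b:ℝ) ≤ 36 := by exact_mod_cast hqd
      split_ifs with h3
      · rw [h3]; push_cast; linarith
      · linarith
  · have hden : q.den = 1 ∨ q.den = 2 := by have := q.den_pos; omega
    have hqn : (q:ℝ) * q.den = q.num := by exact_mod_cast Rat.mul_den_eq_num q
    rcases hden with hd | hd
    · rw [hd] at hq hqn
      push_cast at hq hqn
      rw [abs_le] at hq
      have hz : q.num = 0 := by
        have a1 : (q.num:ℝ) < 1 := by linarith
        have a2 : (-1:ℝ) < q.num := by linarith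
        have : q.num < 1 := by exact_mod_cast a1
        have : -1 < q.num := by exact_mod_cast a2
        omega
      rw [hz] at hqn; push_cast at hqn
      have hνs : ν ≤ 1 / 37 := by linarith
      have hnν : 4 ≤ n * ν := by
        rw [hθν] at hA
        by_contra hc; push Not at hc
        nlinarith
      refine prod85 hn (S := 1 / 2 * 1.9 + n / 16 * 1.19) ?_ (by linarith)
      refine le_trans (Finset.sum_le_sum (g := fun m => 1 / 2 * ((0.85:ℝ) ^ (m + 1) / (m + 1 : ℕ)) +
        n / 16 * (((0.85:ℝ)) ^ (m + 1) / (m + 1 : ℕ) / (m + 1 : ℕ))) fun m hm => ?_) ?_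
      · have hm' : ((m + 1 : ℕ):ℝ) ≤ 18 := by exact_mod_cast Finset.mem_range.1 hm
        have hm0 : (0:ℝ) < ((m + 1 : ℕ):ℝ) := by positivity
        have hs : 2 * ((m + 1 : ℕ) * ν) ≤ |sin ((m + 1 : ℕ) * θ / 2)| := by
          refine le_trans ?_ (le_abs_self _)
          rw [hθν, show ((m + 1 : ℕ):ℝ) * (2 * π * ν) / 2 = π * ((m + 1 : ℕ) * ν) by ring]
          have hh : (m + 1 : ℕ) * ν ≤ 18 * (1 / 37) := by gcongr
          have := mul_le_sin (x := π * ((m + 1 : ℕ) * ν)) (by positivity) (by nlinarith)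
          rwa [show 2 / π * (π * ((m + 1 : ℕ) * ν)) = 2 * ((m + 1 : ℕ) * ν) by field_simp] at this
        have h' := EE_le1 n (by positivity) hs
        have h3 : 1 / (2 * (2 * ((m + 1 : ℕ) * ν))) ≤ n / 16 / (m + 1 : ℕ) := by
          rw [div_div, div_le_div_iff₀ (by positivity) (by positivity)]
          nlinarith
        calc _ ≤ (0.85:ℝ) ^ (m + 1) / (m + 1 : ℕ) * (1 / 2 + n / 16 / (m + 1 : ℕ)) := by gcongr; linarith
          _ = _ := by ring
      · rw [Finset.sum_add_distrib, ← Finset.mul_sum, ← Finset.mul_sum]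
        have := sum85a
        have := sum85c
        gcongr
    · rw [hd] at hq hqn
      push_cast at hq hqn
      rw [abs_le] at hq
      have hz : q.num = 1 := by
        have a1 : (q.num:ℝ) < 2 := by linarith
        have a2 : (-1:ℝ) < q.num := by linarith
        have b1 : q.num < 2 := by exact_mod_cast a1
        have b2 : -1 < q.num := by exact_mod_cast a2
        have : q.num ≠ 0 := by
          intro h0
          have hr := q.reduced
          rw [h0, hd] at hr
          norm_num at hr
        omega
      rw [hz] at hqn; push_cast at hqn
      set δ := π - θ with hδ
      have hδν : δ = 2 * π * (1 / 2 - ν) := by rw [hδ, hθν]; ring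
      have hδs : δ ≤ π / 37 := by rw [hδν]; nlinarith
      have hδ0 : 0 < δ := by by_contra h; push Not at h; nlinarith
      have hs2 : ∑ m ∈ Finset.range 18, (if 2 ∣ m + 1 then ((0.85:ℝ)) ^ (m + 1) / (m + 1 : ℕ) / (m + 1 : ℕ) else 0) ≤ 0.24 := by
        have : ((∑ m ∈ Finset.range 18, (if 2 ∣ m + 1 then ((17/20:ℚ)) ^ (m + 1) / (m + 1 : ℕ) / (m + 1 : ℕ) else 0) : ℚ) : ℝ) ≤ ((0.24 : ℚ) : ℝ) := by
          exact_mod_cast sum85q2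
        push_cast [apply_ite ((↑) : ℚ → ℝ)] at this
        norm_num at this ⊢
        exact this
      refine prod85 hn (S := 1.22 * 1.9 + n / 8 * 0.24) ?_ (by linarith)
      refine le_trans (Finset.sum_le_sum (g := fun m => 1.22 * ((0.85:ℝ) ^ (m + 1) / (m + 1 : ℕ)) +
        n / 8 * (if 2 ∣ m + 1 then ((0.85:ℝ)) ^ (m + 1) / (m + 1 : ℕ) / (m + 1 : ℕ) else 0)) fun m hm => ?_) ?_
      · have hm' : ((m + 1 : ℕ):ℝ) ≤ 18 := by exact_mod_cast Finset.mem_range.1 hm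
        have hm0 : (0:ℝ) < ((m + 1 : ℕ):ℝ) := by positivity
        have hmδ : (m + 1 : ℕ) * δ / 2 ≤ π / 4 := by nlinarith
        split_ifs with hd2
        · rw [EE_near_pi n _ _ hd2, ← hδ]
          have hs : (m + 1 : ℕ) * δ / π ≤ |sin ((m + 1 : ℕ) * δ / 2)| := by
            refine le_trans ?_ (le_abs_self _)
            have := mul_le_sin (x := (m + 1 : ℕ) * δ / 2) (by positivity) (by linarith)
            rwa [show 2 / π * ((m + 1 : ℕ) * δ / 2) = (m + 1 : ℕ) * δ / π by field_simp] at this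
          have h' := EE_le1 n (by positivity) hs
          have h3 : 1 / (2 * ((m + 1 : ℕ) * δ / π)) ≤ n / 8 / (m + 1 : ℕ) := by
            rw [div_div, show 1 / (2 * (((m + 1 : ℕ):ℝ) * δ / π)) = π / (2 * ((m + 1 : ℕ) * δ)) by field_simp,
              div_le_div_iff₀ (by positivity) (by positivity)]
            nlinarith
          calc _ ≤ (0.85:ℝ) ^ (m + 1) / (m + 1 : ℕ) * (1.22 + n / 8 / (m + 1 : ℕ)) := by gcongr; linarith
            _ = _ := by ring
        · have := EE_odd n (m + 1) θ hd2 h2 hmδ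
          calc _ ≤ (0.85:ℝ) ^ (m + 1) / (m + 1 : ℕ) * 1.22 := by gcongr; linarith
            _ = _ := by ring
      · rw [Finset.sum_add_distrib, ← Finset.mul_sum, ← Finset.mul_sum]
        have := sum85a
        gcongr

end QP

namespace QP

open Set Real

variable {n j : ℕ} {c : ℝ}

theorem sin_tau_abs (hn : 900 ≤ n) (H : SLC (vv n j) (ss n j) (2 * π) (n / 12) c) {w : ℝ} (hw : 0 ≤ w) :
    |Ex (vv n j) (2 * π) (fun x => sin (w * (x - mean (vv n j) (2 * π))))| ≤ 0.924 * w ^ 3 / n := by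
  have h := H.sin_tau hw
  have hn9 : (900:ℝ) ≤ n := by exact_mod_cast hn
  apply abs_le_of_sq_le_sq _ (by positivity)
  refine h.trans ?_
  have e : w ^ 6 / 36 * (16 / ((n:ℝ) / 12) ^ 3) = 768 / n * (w ^ 6 / n ^ 2) := by field_simp; ring
  have e2 : (0.924 * w ^ 3 / n) ^ 2 = 0.853776 * (w ^ 6 / n ^ 2) := by field_simp; ring
  rw [e, e2]
  apply mul_le_mul_of_nonneg_right _ (by positivity)
  rw [div_le_iff₀ (by linarith)]
  linarith

theorem cos_tau_lo (hn : 900 ≤ n) (H : SLC (vv n j) (ss n j) (2 * π) (n / 12) c) (w : ℝ) :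
    1 - 6 * w ^ 2 / n ≤ Ex (vv n j) (2 * π) (fun x => cos (w * (x - mean (vv n j) (2 * π)))) := by
  refine le_trans ?_ (H.cos_tau_lower w)
  have h := H.var_le
  have hn9 : (900:ℝ) ≤ n := by exact_mod_cast hn
  have := mul_le_mul_of_nonneg_left h (by positivity : 0 ≤ w ^ 2 / 2)
  have e : w ^ 2 / 2 * (1 / ((n:ℝ) / 12)) = 6 * w ^ 2 / n := by field_simp; ring
  linarith

theorem signA_lo (hn : 900 ≤ n) (H : SLC (vv n 1) (ss n 1) (2 * π) (n / 12) c) {w : ℝ} (hw : 0 ≤ w)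
    (h : w * n ≤ xx n - 0.028) : 0.02 / n ≤ Ex (vv n 1) (2 * π) (fun x => cos (w * x)) := by
  have p1 := pi_lo
  have p2 := pi_hi
  have hn9 : (900:ℝ) ≤ n := by exact_mod_cast hn
  obtain ⟨b1, b2⟩ := mean_bounds (by omega) le_rfl H
  have hS := sin_tau_abs hn H hw
  have hC := cos_tau_lo hn H w
  have hC1 := H.cos_tau_le_one w
  rw [H.Ex_cos]
  unfold xx at h
  set e := mean (vv n 1) (2 * π)
  set C := Ex (vv n 1) (2 * π) (fun x => cos (w * (x - e)))
  set S := Ex (vv n 1) (2 * π) (fun x => sin (w * (x - e)))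
  have he : 0 < e := by linarith
  have h2 : w * n * e ≤ π / 2 * n - 0.028 * e := by
    have := mul_le_mul_of_nonneg_right h he.le
    have e1 : (π * n / (2 * e) - 0.028) * e = π / 2 * n - 0.028 * e := by field_simp
    linarith
  set η := π / 2 - w * e with hη
  have hη1 : 0.128 / n ≤ η := by
    rw [div_le_iff₀ (by linarith)]; nlinarith
  have hη0 : 0 < η := lt_of_lt_of_le (by positivity) hη1
  have hw1 : w ≤ 0.343 := by nlinarith
  have hcos : cos (w * e) = sin η := by rw [hη, sin_pi_div_two_sub]
  have hj := mul_le_sin hη0.le (by rw [hη]; nlinarith)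
  have hr : 0.6366 ≤ 2 / π := by rw [le_div_iff₀ pi_pos]; linarith
  have hsin : 0.0814 / n ≤ sin η := by
    have h3 : 0.6366 * (0.128 / n) ≤ 2 / π * η := by
      apply mul_le_mul hr hη1 (by positivity) (by positivity)
    have h4 : 0.0814 / (n:ℝ) ≤ 0.6366 * (0.128 / n) := by
      rw [← mul_div_assoc]; gcongr; norm_num
    linarith
  have hCl : 0.99 ≤ C := by
    have : 6 * w ^ 2 / n ≤ 0.01 := by rw [div_le_iff₀ (by linarith)]; nlinarith
    linarith
  have hSl : |S| ≤ 0.038 / n := by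
    refine hS.trans ?_
    gcongr
    have : w ^ 3 ≤ 0.343 ^ 3 := by gcongr
    linarith
  have hs1 : sin (w * e) * S ≤ |S| := by
    refine (le_abs_self _).trans ?_
    rw [abs_mul]
    have := abs_sin_le_one (w * e)
    nlinarith [abs_nonneg S]
  rw [hcos]
  have h5 : 0.99 * (0.0814 / n) ≤ sin η * C := by
    rw [mul_comm (sin η)]
    apply mul_le_mul hCl hsin (by positivity) (by linarith)
  have h6 : 0.02 / (n:ℝ) + 0.038 / n ≤ 0.99 * (0.0814 / n) := by
    rw [← add_div, ← mul_div_assoc]; gcongr; norm_num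
  linarith

theorem signA_hi (hn : 900 ≤ n) (H : SLC (vv n 1) (ss n 1) (2 * π) (n / 12) c) {w : ℝ}
    (h : xx n + 0.028 ≤ w * n) (hw : w ≤ 0.56) :
    Ex (vv n 1) (2 * π) (fun x => cos (w * x)) ≤ -(0.02 / n) := by
  have p1 := pi_lo
  have p2 := pi_hi
  have hn9 : (900:ℝ) ≤ n := by exact_mod_cast hn
  obtain ⟨b1, b2⟩ := mean_bounds (by omega) le_rfl H
  have hxx : 0 ≤ xx n := by unfold xx; positivity
  have hw0 : 0 ≤ w := by
    by_contra hc
    push Not at hc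
    nlinarith
  have hS := sin_tau_abs hn H hw0
  have hC := cos_tau_lo hn H w
  have hC1 := H.cos_tau_le_one w
  rw [H.Ex_cos]
  unfold xx at h
  set e := mean (vv n 1) (2 * π)
  set C := Ex (vv n 1) (2 * π) (fun x => cos (w * (x - e)))
  set S := Ex (vv n 1) (2 * π) (fun x => sin (w * (x - e)))
  have he : 0 < e := by linarith
  have h2 : π / 2 * n + 0.028 * e ≤ w * n * e := by
    have := mul_le_mul_of_nonneg_right h he.le
    have e1 : (π * n / (2 * e) + 0.028) * e = π / 2 * n + 0.028 * e := by field_simp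
    linarith
  set η := w * e - π / 2 with hη
  have hη1 : 0.128 / n ≤ η := by
    rw [div_le_iff₀ (by linarith)]; nlinarith
  have hη0 : 0 < η := lt_of_lt_of_le (by positivity) hη1
  have hη2 : η ≤ π / 2 := by rw [hη]; nlinarith
  have hcos : cos (w * e) = -sin η := by
    rw [hη, ← cos_add_pi_div_two]; congr 1; ring
  have hj := mul_le_sin hη0.le hη2
  have hr : 0.6366 ≤ 2 / π := by rw [le_div_iff₀ pi_pos]; linarith
  have hCl : 0.99 ≤ C := by
    have : 6 * w ^ 2 / n ≤ 0.01 := by rw [div_le_iff₀ (by linarith)]; nlinarith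
    linarith
  have hs1 : -(sin (w * e) * S) ≤ |S| := by
    refine (neg_le_abs _).trans ?_
    rw [abs_mul]
    have := abs_sin_le_one (w * e)
    nlinarith [abs_nonneg S]
  rw [hcos]
  rcases le_total w 0.38 with hw1 | hw1
  · have hsin : 0.0814 / n ≤ sin η := by
      have h3 : 0.6366 * (0.128 / n) ≤ 2 / π * η := by
        apply mul_le_mul hr hη1 (by positivity) (by positivity)
      have h4 : 0.0814 / (n:ℝ) ≤ 0.6366 * (0.128 / n) := by
        rw [← mul_div_assoc]; gcongr; norm_num
      linarith
    have hSl : |S| ≤ 0.051 / n := by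
      refine hS.trans ?_
      gcongr
      have : w ^ 3 ≤ 0.38 ^ 3 := by gcongr
      linarith
    have h5 : 0.99 * (0.0814 / n) ≤ sin η * C := by
      rw [mul_comm (sin η)]
      apply mul_le_mul hCl hsin (by positivity) (by linarith)
    have h6 : 0.02 / (n:ℝ) + 0.051 / n ≤ 0.99 * (0.0814 / n) := by
      rw [← add_div, ← mul_div_assoc]; gcongr; norm_num
    linarith
  · have hη3 : 0.17 ≤ η := by rw [hη]; nlinarith
    have hsin : 0.1 ≤ sin η := by
      have : 0.6366 * 0.17 ≤ 2 / π * η := by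
        apply mul_le_mul hr hη3 (by norm_num) (by positivity)
      linarith
    have hSl : |S| ≤ 0.2 / n := by
      refine hS.trans ?_
      gcongr
      have : w ^ 3 ≤ 0.56 ^ 3 := by gcongr
      linarith
    have h5 : 0.99 * 0.1 ≤ sin η * C := by
      rw [mul_comm (sin η)]
      apply mul_le_mul hCl hsin (by positivity) (by linarith)
    have h6 : 0.02 / (n:ℝ) + 0.2 / n ≤ 0.001 := by
      rw [← add_div, div_le_iff₀ (by linarith)]; linarith
    linarith

/-- window constants -/
theorem kappa_lo (hn : 900 ≤ n) {a : ℝ} (ha : 0 < a) (ha2 : a ^ 2 = 12 / n) :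
    0.177 ≤ exp (-((n / 4 : ℝ) * a ^ 2 / 2)) / √(π / ((n / 12 : ℝ) / 2)) * (2 * a) := by
  have p1 := pi_lo
  have p2 := pi_hi
  have hn9 : (900:ℝ) ≤ n := by exact_mod_cast hn
  have e1 : (n / 4 : ℝ) * a ^ 2 / 2 = 3 / 2 := by rw [ha2]; field_simp; try norm_num
  rw [e1]
  have e2 : π / ((n / 12 : ℝ) / 2) = 2 * π * a ^ 2 := by rw [ha2]; field_simp; try norm_num
  rw [e2, sqrt_mul (by positivity), sqrt_sq ha.le]
  have hs : √(2 * π) ≤ 2.5067 := by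
    rw [sqrt_le_left (by norm_num)]; nlinarith
  have hs0 : 0 < √(2 * π) := sqrt_pos.2 (by positivity)
  have e3 : exp (-(3 / 2)) / (√(2 * π) * a) * (2 * a) = 2 * exp (-(3 / 2)) / √(2 * π) := by field_simp
  rw [e3, le_div_iff₀ hs0]
  have hE : 0.2231 ≤ exp (-(3 / 2)) := by
    rw [exp_neg, le_inv_comm₀ (by norm_num) (exp_pos _)]
    have h1 := exp_one_lt_d9
    have h2 : exp (3 / 2) ^ 2 = exp 1 ^ 3 := by
      rw [← exp_nat_mul, ← exp_nat_mul]; norm_num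
    have h3 : exp 1 ^ 3 ≤ 2.7182818286 ^ 3 := by gcongr
    have h4 : (0.2231⁻¹ : ℝ) ^ 2 ≥ 2.7182818286 ^ 3 := by norm_num
    exact (abs_le.1 <| abs_le_of_sq_le_sq (by rw [h2]; linarith) (by norm_num)).2
  nlinarith

end QP

namespace QP

open Set Real

variable {n j : ℕ} {c : ℝ}

/-- amplitude near the first peak -/
theorem ampB_peak (hn : 900 ≤ n) (H : SLC (vv n 0) (ss n 0) (2 * π) (n / 12) c) {w : ℝ}
    (h : |w * n - π * n / (2 * mean (vv n 0) (2 * π))| ≤ 1 / 2) :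
    1 - 0.0589 * var (vv n 0) (2 * π) - 3.6 / n ^ 2 ≤ Ex (vv n 0) (2 * π) (fun x => sin (w * x)) := by
  have p1 := pi_lo
  have p2 := pi_hi
  have hn9 : (900:ℝ) ≤ n := by exact_mod_cast hn
  have hn0 : (0:ℝ) < n := by linarith
  obtain ⟨b1, b2⟩ := mean_bounds (by omega) (by norm_num) H
  have hv0 := H.var_nonneg
  have hv1 := H.var_le
  set e := mean (vv n 0) (2 * π) with hee
  have he : 0 < e := by linarith
  obtain ⟨g1, g2⟩ := abs_le.1 h
  set t := π * n / (2 * e) with ht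
  have hte : t * e = π / 2 * n := by rw [ht]; field_simp
  have hw0 : 0 ≤ w := by
    by_contra hc
    push Not at hc
    have h1 : w * n < 0 := mul_neg_of_neg_of_pos hc hn0
    have h2 : t ≤ 1 / 2 := by linarith
    have h3 : t * e ≤ 1 / 2 * e := mul_le_mul_of_nonneg_right h2 he.le
    nlinarith
  have hw1 : w ≤ 0.343 := by
    by_contra hc
    push Not at hc
    have h1 : 0.343 * (n:ℝ) < w * n := mul_lt_mul_of_pos_right hc hn0
    have h2 : (0.343 * n - 1 / 2) * e ≤ t * e := mul_le_mul_of_nonneg_right (by linarith) he.le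
    nlinarith
  have hS := sin_tau_abs (by omega) H hw0
  have hC := H.cos_tau_lower w
  have hC1 := H.cos_tau_le_one w
  rw [H.Ex_sin]
  rw [← hee] at hS hC hC1 ⊢
  set C := Ex (vv n 0) (2 * π) (fun x => cos (w * (x - e)))
  set S := Ex (vv n 0) (2 * π) (fun x => sin (w * (x - e)))
  set V := var (vv n 0) (2 * π)
  have hSl : |S| ≤ 0.038 / n := by
    refine hS.trans ?_
    gcongr
    have : w ^ 3 ≤ 0.343 ^ 3 := by gcongr
    linarith
  set η := w * e - π / 2 with hη
  have hηn : |η| ≤ 2.62 / n := by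
    have e0 : |η| * n = |η * n| := by rw [abs_mul, abs_of_pos hn0]
    rw [le_div_iff₀ hn0, e0]
    have e1 : η * n = (w * n - t) * e := by rw [hη, sub_mul, sub_mul, hte]; ring
    rw [e1, abs_mul, abs_of_pos he]
    nlinarith
  have hsin : sin (w * e) = cos η := by rw [hη, cos_sub_pi_div_two]
  have hcos : cos (w * e) = -sin η := by
    rw [hη, ← cos_add_pi_div_two]; congr 1; ring
  have hc1 := one_sub_sq_div_two_le_cos (x := η)
  have hη2 : η ^ 2 ≤ 6.8644 / n ^ 2 := by
    rw [← sq_abs]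
    have : |η| ^ 2 ≤ (2.62 / n) ^ 2 := by gcongr
    refine this.trans (le_of_eq ?_)
    rw [div_pow]; norm_num
  have hSS : sin η * S ≤ 0.1 / n ^ 2 := by
    refine (le_abs_self _).trans ?_
    rw [abs_mul]
    have h1 : |sin η| ≤ 2.62 / n := (abs_sin_le_abs).trans hηn
    have h2 : |sin η| * |S| ≤ 2.62 / n * (0.038 / n) := by gcongr
    refine h2.trans ?_
    rw [div_mul_div_comm, ← sq]
    gcongr; norm_num
  rw [hsin, hcos]
  have hVn : V ≤ 12 / n := by
    refine hv1.trans (le_of_eq ?_); field_simp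
  have hw2 : w ^ 2 / 2 * V ≤ 0.0589 * V := by
    apply mul_le_mul_of_nonneg_right _ hv0; nlinarith
  have hCl : 1 - 0.0589 * V ≤ C := by linarith
  have hV1 : V ≤ 1 := hVn.trans (by rw [div_le_one hn0]; linarith)
  have h7 : (1 - 6.8644 / n ^ 2 / 2) * (1 - 0.0589 * V) ≤ cos η * C := by
    have q : 6.8644 / (n:ℝ) ^ 2 ≤ 1 := by
      rw [div_le_one (by positivity)]; nlinarith
    apply mul_le_mul (by linarith) hCl (by linarith) (by linarith)
  have q0 : 0 ≤ 6.8644 / (n:ℝ) ^ 2 := by positivity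
  have h8 : 1 - 0.0589 * V - 6.8644 / n ^ 2 / 2 ≤ (1 - 6.8644 / n ^ 2 / 2) * (1 - 0.0589 * V) := by
    have e : (1 - 6.8644 / (n:ℝ) ^ 2 / 2) * (1 - 0.0589 * V) =
      1 - 0.0589 * V - 6.8644 / n ^ 2 / 2 + 6.8644 / n ^ 2 / 2 * (0.0589 * V) := by ring
    rw [e]
    have : 0 ≤ 6.8644 / (n:ℝ) ^ 2 / 2 * (0.0589 * V) := by positivity
    linarith
  have h9 : 6.8644 / (n:ℝ) ^ 2 / 2 + 0.1 / n ^ 2 ≤ 3.6 / n ^ 2 := by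
    rw [div_div, mul_comm, ← div_div, ← add_div]; gcongr; norm_num
  linarith

theorem sin_ratio {t t0 : ℝ} (h0 : 0 < t0) (ht : t0 ≤ t) (h1 : t0 ^ 2 ≤ 0.03) :
    |sin t| ≤ t * (1 - 0.1663 * t0 ^ 2) := by
  have htp : 0 < t := by linarith
  have hsq : t0 ^ 2 ≤ t ^ 2 := by gcongr
  rcases le_total t 1 with h | h
  · rw [abs_of_nonneg (sin_nonneg_of_nonneg_of_le_pi htp.le (by linarith [pi_gt_three]))]
    have h2 := (abs_le.1 (sin_bound (x := t) (by rw [abs_of_pos htp]; exact h))).2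
    rw [abs_of_pos htp] at h2
    have h3 : 0.1663 * t0 ^ 2 ≤ t ^ 2 / 6 - (t ^ 2) ^ 2 / 100 := by
      have s1 : t ^ 2 ≤ 1 := by nlinarith
      rcases le_total (t ^ 2) 0.03 with g | g
      · nlinarith
      rcases le_total (t ^ 2) 0.04 with g' | g'
      · nlinarith
      · nlinarith
    have h4 := mul_le_mul_of_nonneg_left h3 htp.le
    nlinarith
  rcases le_total t 2 with h' | h'
  · rw [abs_of_nonneg (sin_nonneg_of_nonneg_of_le_pi htp.le (by linarith [pi_gt_three]))]
    have h2 := (abs_le.1 (sin_bound (x := t / 2) (by rw [abs_of_pos (by linarith)]; linarith))).2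
    rw [abs_of_pos (by linarith)] at h2
    have e : sin t = 2 * sin (t / 2) * cos (t / 2) := by rw [← sin_two_mul]; congr 1; ring
    have hc := cos_le_one (t / 2)
    have hs : 0 ≤ sin (t / 2) := sin_nonneg_of_nonneg_of_le_pi (by linarith) (by linarith [pi_gt_three])
    have h5 : sin t ≤ 2 * sin (t / 2) := by rw [e]; nlinarith
    have h3 : 0.1663 * t0 ^ 2 ≤ t ^ 2 / 24 - (t ^ 2) ^ 2 / 1600 := by
      have s1 : t ^ 2 ≤ 4 := by nlinarith
      have s2 : 1 ≤ t ^ 2 := by nlinarith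
      nlinarith
    have h4 := mul_le_mul_of_nonneg_left h3 htp.le
    nlinarith
  · have := abs_sin_le_one t
    nlinarith

theorem window_c (hn : 900 ≤ n) (hj : j ≤ 1) (H : SLC (vv n j) (ss n j) (2 * π) (n / 12) c) {a : ℝ}
    (ha : 0 < a) (ha2 : a ^ 2 = 12 / n) : 0 < c - a ∧ c + a < 2 * π := by
  have p1 := pi_lo
  have p2 := pi_hi
  have hlo := mode_lo (by omega) H
  have hhi := mode_hi (by omega) hj H
  have hn9 : (900:ℝ) ≤ n := by exact_mod_cast hn
  have : a ≤ 1 := by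
    have : a ^ 2 ≤ 1 := by rw [ha2, div_le_one (by linarith)]; linarith
    nlinarith
  constructor <;> linarith

theorem var_lo (hn : 900 ≤ n) (H : SLC (vv n 0) (ss n 0) (2 * π) (n / 12) c) :
    0.708 / n ≤ var (vv n 0) (2 * π) := by
  have hn9 : (900:ℝ) ≤ n := by exact_mod_cast hn
  set a := √(12 / n) with ha
  have ha2 : a ^ 2 = 12 / n := sq_sqrt (by positivity)
  have ha0 : 0 < a := sqrt_pos.2 (by positivity)
  obtain ⟨c1, c2⟩ := window_c hn (by norm_num) H ha0 ha2
  have h := H.var_window (a := a) (K := n / 4) (by positivity)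
    (win (by omega) (by norm_num) H ha0 ha2.le) ha0 c1 c2
  have k := kappa_lo hn ha0 ha2
  refine le_trans ?_ h
  set q := exp (-((n / 4 : ℝ) * a ^ 2 / 2)) / √(π / ((n / 12 : ℝ) / 2))
  have e : q * (2 * a ^ 3 / 3) = q * (2 * a) * (4 / n) := by
    have : a ^ 3 = a * (12 / n) := by rw [← ha2]; ring
    rw [this]; ring
  rw [e]
  have : 0.708 / (n:ℝ) = 0.177 * (4 / n) := by ring
  rw [this]
  gcongr

theorem taylor_alg {T V u C S : ℝ} (hu0 : 0 < u) (hu1 : u ≤ 1 / 900) (hT1 : 0.3025 ≤ T) (hT2 : T ≤ 2.25)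
    (hv0 : 0.708 * u ≤ V) (hv1 : V ≤ 12 * u) (hC0 : 1 - T / 2 * V ≤ C)
    (hC : C ≤ 1 - T / 2 * V + T ^ 2 / 24 * (2304 * u ^ 2)) (hS2 : S ^ 2 ≤ 0.854 * T ^ 3 * u ^ 2) :
    C ^ 2 + S ^ 2 ≤ (1 - 0.0589 * V - 3.6 * u ^ 2 - 0.02 * u) ^ 2 := by
  have hT0 : 0 < T := by linarith
  have hV0 : 0 < V := lt_of_lt_of_le (by positivity) hv0
  have hTV : T * V ≤ 12 * (T * u) := by
    have := mul_le_mul_of_nonneg_left hv1 hT0.le; linarith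
  have hTu : T * u ≤ 0.0025 := by
    have : T * u ≤ 2.25 * (1 / 900) := by gcongr
    linarith
  have hTu0 : 0 < T * u := by positivity
  have hCp : 0 ≤ C := by linarith
  have k0 : u ^ 2 ≤ u * (1 / 900) := by rw [sq]; gcongr
  set W := u * T with hW
  have k2 : u ^ 2 * T ^ 2 ≤ (1 / 900) * (u * T ^ 2) := by
    have : u ^ 2 * T ^ 2 ≤ u * (1 / 900) * T ^ 2 := by gcongr
    linarith
  set R := u ^ 2 * T ^ 2 with hR
  have hR0 : 0 ≤ R := by positivity
  set q := T / 2 * V - 96 * R with hq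
  have hC2 : C ^ 2 ≤ (1 - q) ^ 2 := by
    have : C ≤ 1 - q := by rw [hq, hR]; linarith
    gcongr
  have hq2 : q ^ 2 ≤ 36 * R := by
    have q1 : q ≤ 6 * (T * u) := by rw [hq]; linarith
    have q2 : -(6 * (T * u)) ≤ q := by
      have e : R = (T * u) * (T * u) := by rw [hR]; ring
      have : R ≤ (T * u) * 0.0025 := by rw [e]; gcongr
      have : 0 ≤ T / 2 * V := by positivity
      rw [hq]
      linarith
    have := sq_le_sq' q2 q1
    have e : (6 * (T * u)) ^ 2 = 36 * R := by rw [hR]; ring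
    linarith
  have k1 : S ^ 2 ≤ u * (0.005 * T) := by
    have t3 : T ^ 3 ≤ 5.0625 * T := by
      have : T ^ 2 ≤ 2.25 ^ 2 := by gcongr
      nlinarith
    have : 0.854 * T ^ 3 * u ^ 2 ≤ 0.854 * (5.0625 * T) * (u * (1 / 900)) := by gcongr
    linarith
  have k3 : (1 - q) ^ 2 = 1 - T * V + 192 * R + q ^ 2 := by rw [hq]; ring
  have rhs : 1 - 2 * (0.0589 * V + 3.6 * u ^ 2 + 0.02 * u) ≤ (1 - 0.0589 * V - 3.6 * u ^ 2 - 0.02 * u) ^ 2 := by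
    have e : (1 - 0.0589 * V - 3.6 * u ^ 2 - 0.02 * u) ^ 2 =
      1 - 2 * (0.0589 * V + 3.6 * u ^ 2 + 0.02 * u) + (0.0589 * V + 3.6 * u ^ 2 + 0.02 * u) ^ 2 := by ring
    rw [e]
    have := sq_nonneg (0.0589 * V + 3.6 * u ^ 2 + 0.02 * u)
    linarith
  have f1 : (T - 0.1178) * (0.708 * u) ≤ (T - 0.1178) * V :=
    mul_le_mul_of_nonneg_left hv0 (by linarith)
  have f2 : 0.2559 * T ^ 2 + 0.005 * T + 0.05 ≤ (T - 0.1178) * 0.708 := by nlinarith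
  have f3 := mul_le_mul_of_nonneg_left f2 hu0.le
  linarith

theorem ampB_taylor (hn : 900 ≤ n) (H : SLC (vv n 0) (ss n 0) (2 * π) (n / 12) c) {w : ℝ}
    (h1 : 0.55 ≤ w) (h2 : w ≤ 1.5) :
    |Ex (vv n 0) (2 * π) (fun x => sin (w * x))| ≤
      1 - 0.0589 * var (vv n 0) (2 * π) - 3.6 / n ^ 2 - 0.02 / n := by
  have hn9 : (900:ℝ) ≤ n := by exact_mod_cast hn
  have hn0 : (0:ℝ) < n := by linarith
  have hS := sin_tau_abs (by omega) H (by linarith : 0 ≤ w)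
  have hC0 := H.cos_tau_lower w
  have hC := H.cos_tau_upper w
  have hsq := H.Ex_sin_sq w
  have hv0 := var_lo hn H
  have hv1 := H.var_le
  set e := mean (vv n 0) (2 * π) with hee
  set C := Ex (vv n 0) (2 * π) (fun x => cos (w * (x - e)))
  set S := Ex (vv n 0) (2 * π) (fun x => sin (w * (x - e)))
  set V := var (vv n 0) (2 * π)
  obtain ⟨u, hu⟩ : ∃ u : ℝ, u = 1 / n := ⟨_, rfl⟩
  have hu0 : 0 < u := by rw [hu]; positivity
  have hu1 : u ≤ 1 / 900 := by rw [hu]; gcongr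
  have E1 : 1 / ((n:ℝ) / 12) = 12 * u := by rw [hu]; field_simp
  have E2 : 16 / ((n:ℝ) / 12) ^ 2 = 2304 * u ^ 2 := by rw [hu]; field_simp; norm_num
  have E3 : 0.708 / (n:ℝ) = 0.708 * u := by rw [hu]; ring
  have E4 : 0.924 * w ^ 3 / n = 0.924 * w ^ 3 * u := by rw [hu]; ring
  have E5 : 3.6 / (n:ℝ) ^ 2 = 3.6 * u ^ 2 := by rw [hu]; ring
  have E6 : 0.02 / (n:ℝ) = 0.02 * u := by rw [hu]; ring
  rw [E1] at hv1
  rw [E2] at hC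
  rw [E3] at hv0
  rw [E4] at hS
  rw [E5, E6]
  set T := w ^ 2 with hT
  have hT1 : 0.3025 ≤ T := by rw [hT]; nlinarith
  have hT2 : T ≤ 2.25 := by rw [hT]; nlinarith
  have e4 : w ^ 4 = T ^ 2 := by rw [hT]; ring
  rw [e4] at hC
  have hS2 : S ^ 2 ≤ 0.854 * T ^ 3 * u ^ 2 := by
    rw [← sq_abs]
    have : |S| ^ 2 ≤ (0.924 * w ^ 3 * u) ^ 2 := by gcongr
    refine this.trans ?_
    have e : (0.924 * w ^ 3 * u) ^ 2 = 0.853776 * T ^ 3 * u ^ 2 := by rw [hT]; ring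
    rw [e]
    gcongr; norm_num
  exact abs_le_of_sq_le_sq (hsq.trans (taylor_alg hu0 hu1 hT1 hT2 hv0 hv1 hC0 hC hS2)) (by nlinarith)

theorem ampB_window (hn : 900 ≤ n) (H : SLC (vv n 0) (ss n 0) (2 * π) (n / 12) c) {w : ℝ}
    (h1 : 1.5 ≤ w) :
    |Ex (vv n 0) (2 * π) (fun x => sin (w * x))| ≤
      1 - 0.0589 * var (vv n 0) (2 * π) - 3.6 / n ^ 2 - 0.02 / n := by
  have hn9 : (900:ℝ) ≤ n := by exact_mod_cast hn
  have hn0 : (0:ℝ) < n := by linarith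
  set a := √(12 / n) with ha
  have ha2 : a ^ 2 = 12 / n := sq_sqrt (by positivity)
  have ha0 : 0 < a := sqrt_pos.2 (by positivity)
  obtain ⟨c1, c2⟩ := window_c hn (by norm_num) H ha0 ha2
  have h := H.sin_window (a := a) (K := n / 4) (w := w) (by positivity)
    (win (by omega) (by norm_num) H ha0 ha2.le) ha0 c1 c2 (by linarith)
  have k := kappa_lo hn ha0 ha2
  refine h.trans ?_
  set q := exp (-((n / 4 : ℝ) * a ^ 2 / 2)) / √(π / ((n / 12 : ℝ) / 2))
  have hq : 0 ≤ q := by positivity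
  have e0 : (1.5 * a) ^ 2 = 27 / n := by rw [mul_pow, ha2]; ring
  have hr := sin_ratio (t := w * a) (t0 := 1.5 * a) (by positivity) (by gcongr)
    (by rw [e0, div_le_iff₀ hn0]; linarith)
  rw [e0] at hr
  have h2 : 2 * |sin (w * a)| / w ≤ 2 * a * (1 - 0.1663 * (27 / n)) := by
    rw [div_le_iff₀ (by linarith)]
    nlinarith
  have h3 : q * (2 * a - 2 * a * (1 - 0.1663 * (27 / n))) ≤ q * (2 * a - 2 * |sin (w * a)| / w) := by
    gcongr
  have e1 : q * (2 * a - 2 * a * (1 - 0.1663 * (27 / n))) = q * (2 * a) * (4.4901 / n) := by ring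
  have h4 : 0.177 * (4.4901 / n) ≤ q * (2 * a) * (4.4901 / n) := by gcongr
  have hv1 := H.var_le
  have e2 : 1 / ((n:ℝ) / 12) = 12 / n := by field_simp
  rw [e2] at hv1
  have h5 : 3.6 / (n:ℝ) ^ 2 ≤ 0.004 / n := by
    rw [div_le_div_iff₀ (by positivity) hn0]; nlinarith
  have h6 : 0.0589 * (12 / (n:ℝ)) + 0.004 / n + 0.02 / n ≤ 0.177 * (4.4901 / n) := by
    have : 0 < 1 / (n:ℝ) := by positivity
    have e3 : 0.0589 * (12 / (n:ℝ)) + 0.004 / n + 0.02 / n = 0.7308 * (1 / n) := by ring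
    have e4 : 0.177 * (4.4901 / (n:ℝ)) = 0.7947477 * (1 / n) := by ring
    rw [e3, e4]
    linarith
  linarith

end QP

namespace QP

open Set Real

/-- product of sines -/
theorem prod_sin (m : ℕ) :
    ∏ k ∈ Finset.range m, (2 * sin ((k + 1 : ℕ) * (π / (m + 1 : ℕ)))) = (m + 1 : ℕ) := by
  have h := IsPrimitiveRoot.prod_one_sub_pow_eq_order (Complex.isPrimitiveRoot_exp (m + 1) (by omega))
  have h2 := congrArg norm h
  rw [norm_prod] at h2
  have h3 : ‖(m : ℂ) + 1‖ = ((m + 1 : ℕ) : ℝ) := by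
    rw [← Nat.cast_one, ← Nat.cast_add, Complex.norm_natCast]
  rw [h3] at h2
  refine Eq.trans ?_ h2
  refine Finset.prod_congr rfl fun k hk => ?_
  have hk' := Finset.mem_range.1 hk
  have hm : (0:ℝ) < (m + 1 : ℕ) := by positivity
  rw [← Complex.exp_nat_mul, norm_sub_rev]
  have e : ((k + 1 : ℕ) : ℂ) * (2 * π * Complex.I / (m + 1 : ℕ)) =
      Complex.I * ((2 * ((k + 1 : ℕ) * (π / (m + 1 : ℕ))) : ℝ) : ℂ) := by
    push_cast; ring
  rw [e, Complex.norm_exp_I_mul_ofReal_sub_one, norm_eq_abs]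
  rw [abs_of_nonneg]
  · congr 2; ring
  · have : 0 ≤ sin ((k + 1 : ℕ) * (π / (m + 1 : ℕ))) := by
      apply sin_nonneg_of_nonneg_of_le_pi
      · positivity
      · rw [← mul_div_assoc, div_le_iff₀ hm, mul_comm]
        apply mul_le_mul_of_nonneg_left _ pi_pos.le
        exact_mod_cast (by omega : k + 1 ≤ m + 1)
    have e2 : (2 * ((k + 1 : ℕ) * (π / (m + 1 : ℕ))) : ℝ) / 2 = (k + 1 : ℕ) * (π / (m + 1 : ℕ)) := by ring
    rw [e2]; positivity

/-- factorial upper bound -/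
theorem fact_le (J : ℕ) : ((J + 1).factorial : ℝ) ≤ exp 1 * (J + 1) * ((J + 1) / exp 1) ^ (J + 1) := by
  induction J with
  | zero => 
    have := exp_pos 1
    norm_num
  | succ k ih =>
    rw [Nat.factorial_succ]
    push_cast
    have e0 := exp_pos 1
    have hk : (0:ℝ) < k + 1 := by positivity
    have h1 : exp 1 * ((k:ℝ) + 1) ^ (k + 2) ≤ (k + 1 + 1) ^ (k + 2) := by
      have hx : 1 - ((k:ℝ) + 1) / (k + 2) = 1 / (k + 2) := by field_simp; ring
      have h2 : ((k:ℝ) + 1) / (k + 2) ≤ exp (-(1 / (k + 2))) := by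
        have := add_one_le_exp (-(1 / ((k:ℝ) + 2)))
        linarith
      have h3 : (((k:ℝ) + 1) / (k + 2)) ^ (k + 2) ≤ exp (-1) := by
        calc _ ≤ (exp (-(1 / ((k:ℝ) + 2)))) ^ (k + 2) := by gcongr
          _ = exp (-1) := by
            rw [← exp_nat_mul]; congr 1; push_cast; field_simp
      rw [div_pow, div_le_iff₀ (by positivity), exp_neg] at h3
      have e3 : (k:ℝ) + 1 + 1 = k + 2 := by ring
      rw [e3]
      calc exp 1 * ((k:ℝ) + 1) ^ (k + 2) ≤ exp 1 * ((exp 1)⁻¹ * (k + 2) ^ (k + 2)) := by gcongr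
        _ = _ := by field_simp
    calc ((k:ℝ) + 1 + 1) * ((k + 1).factorial : ℝ) 
        ≤ (k + 1 + 1) * (exp 1 * (k + 1) * ((k + 1) / exp 1) ^ (k + 1)) := by gcongr
      _ = (k + 1 + 1) * (exp 1 * ((k:ℝ) + 1) ^ (k + 2)) / exp 1 ^ (k + 1) := by
          rw [div_pow]; ring
      _ ≤ (k + 1 + 1) * ((k + 1 + 1) ^ (k + 2)) / exp 1 ^ (k + 1) := by gcongr
      _ = _ := by rw [div_pow]; field_simp; ring

theorem exp_771 : exp 0.771 ≤ 5 * exp 1 / (2 * π) := by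
  have p2 := pi_hi
  have p0 := pi_pos
  have e0 := exp_pos 1
  have h : (1 + 0.229 + 0.229 ^ 2 / 2 + 0.229^3/6) ≤ exp (0.229:ℝ) := by
    have := Real.sum_le_exp_of_nonneg (x := 0.229) (by norm_num) 4
    simp only [Finset.sum_range_succ, Finset.sum_range_zero, Nat.factorial] at this
    norm_num at this ⊢
    linarith
  have e1 : exp 1 = exp 0.771 * exp 0.229 := by rw [← exp_add]; norm_num
  rw [le_div_iff₀ (by positivity), e1]
  have := exp_pos 0.771
  have h2 : 2 * π ≤ 5 * exp 0.229 := by norm_num at h ⊢; linarith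
  calc exp 0.771 * (2 * π) ≤ exp 0.771 * (5 * exp 0.229) := by gcongr
    _ = _ := by ring

theorem peak {n : ℕ} (hn : 900 ≤ n) :
    exp (0.1927 * n) ≤ ∏ k ∈ Finset.range n, (2 * sin ((k + 1 : ℕ) * (π / (n + n / 4 + 1 : ℕ)))) := by
  obtain ⟨J, hJ⟩ : ∃ J, n / 4 = J + 1 := ⟨n / 4 - 1, by omega⟩
  rw [hJ]
  have p0 := pi_pos
  have hp := prod_sin (n + (J + 1))
  set Mm : ℕ := n + (J + 1) + 1 with hMm
  have hM0 : (0:ℝ) < Mm := by rw [hMm]; positivity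
  rw [Finset.prod_range_add] at hp
  set A := ∏ k ∈ Finset.range n, (2 * sin ((k + 1 : ℕ) * (π / Mm))) with hA
  set B := ∏ x ∈ Finset.range (J + 1), (2 * sin ((n + x + 1 : ℕ) * (π / Mm))) with hB
  have hs : ∀ x ∈ Finset.range (J + 1), 0 ≤ 2 * sin ((n + x + 1 : ℕ) * (π / Mm)) := by
    intro x hx
    have hx' := Finset.mem_range.1 hx
    have := sin_nonneg_of_nonneg_of_le_pi (x := (n + x + 1 : ℕ) * (π / Mm)) (by positivity) (by
      rw [← mul_div_assoc, div_le_iff₀ hM0, mul_comm]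
      apply mul_le_mul_of_nonneg_left _ pi_pos.le
      exact_mod_cast (by omega : n + x + 1 ≤ Mm))
    positivity
  have hB0 : 0 ≤ B := Finset.prod_nonneg hs
  have hB1 : B ≤ (2 * π / Mm) ^ (J + 1) * (J + 1).factorial := by
    have hr : (2 * π / Mm) ^ (J + 1) * ((J + 1).factorial : ℝ) = ∏ x ∈ Finset.range (J + 1), (2 * π / Mm * (x + 1 : ℕ)) := by
      rw [Finset.prod_mul_distrib, Finset.prod_const, Finset.card_range, ← Finset.prod_range_add_one_eq_factorial]
      push_cast; rfl
    rw [hr, hB, ← Finset.prod_range_reflect (fun x => 2 * sin ((n + x + 1 : ℕ) * (π / Mm)))]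
    refine Finset.prod_le_prod (fun x hx => ?_) fun x hx => ?_
    · have hx' := Finset.mem_range.1 hx
      exact hs _ (Finset.mem_range.2 (by omega))
    · have hx' := Finset.mem_range.1 hx
      have e : ((n + (J + 1 - 1 - x) + 1 : ℕ) : ℝ) * (π / Mm) = π - (x + 1 : ℕ) * (π / Mm) := by
        have : (Mm : ℝ) = (n + (J + 1 - 1 - x) + 1 : ℕ) + (x + 1 : ℕ) := by
          exact_mod_cast (by omega : Mm = (n + (J + 1 - 1 - x) + 1 ) + (x + 1 ))
        have h2 : π = Mm * (π / Mm) := by field_simp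
        nth_rewrite 2 [h2]
        rw [this]; ring
      rw [e, sin_pi_sub]
      have := sin_le (x := (x + 1 : ℕ) * (π / Mm)) (by positivity)
      calc _ ≤ 2 * ((x + 1 : ℕ) * (π / Mm)) := by linarith
        _ = _ := by ring
  have hA0 : 0 ≤ A := by
    apply Finset.prod_nonneg
    intro x hx
    have hx' := Finset.mem_range.1 hx
    have := sin_nonneg_of_nonneg_of_le_pi (x := (x + 1 : ℕ) * (π / Mm)) (by positivity) (by
      rw [← mul_div_assoc, div_le_iff₀ hM0, mul_comm]
      apply mul_le_mul_of_nonneg_left _ pi_pos.le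
      exact_mod_cast (by omega : x + 1 ≤ Mm))
    positivity
  have hM5 : 5 * ((J:ℝ) + 1) ≤ Mm := by
    exact_mod_cast (by omega : 5 * (J + 1) ≤ Mm)
  have hJ0 : (0:ℝ) < (J:ℝ) + 1 := by positivity
  have e0 := exp_pos 1
  have hB2 : B ≤ exp 1 * (J + 1) * (exp (-0.771)) ^ (J + 1) := by
    calc B ≤ (2 * π / Mm) ^ (J + 1) * (exp 1 * (J + 1) * ((J + 1) / exp 1) ^ (J + 1)) :=
          hB1.trans (by gcongr; exact fact_le J)
      _ = exp 1 * (J + 1) * (2 * π / Mm * ((J + 1) / exp 1)) ^ (J + 1) := by rw [mul_pow]; ring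
      _ ≤ _ := by
        gcongr
        rw [exp_neg]
        have h7 := exp_771
        have h8 : (5 * exp 1 / (2 * π))⁻¹ ≤ (exp 0.771)⁻¹ := by
          gcongr
        refine le_trans ?_ h8
        rw [inv_div, div_mul_div_comm, div_le_div_iff₀ (by positivity) (by positivity)]
        calc 2 * π * (J + 1) * (5 * exp 1) = (2 * π * exp 1) * (5 * (J + 1)) := by ring
          _ ≤ (2 * π * exp 1) * Mm := by gcongr
          _ = _ := by ring
  have h1 : (5 * ((J:ℝ) + 1)) ≤ A * (exp 1 * (J + 1) * (exp (-0.771)) ^ (J + 1)) := by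
    calc _ ≤ A * B := by rw [hp]; exact hM5
      _ ≤ _ := by gcongr
  have h2 : 5 ≤ A * (exp 1 * (exp (-0.771)) ^ (J + 1)) := by
    by_contra hc
    push Not at hc
    have := mul_lt_mul_of_pos_right hc hJ0
    nlinarith
  rw [← exp_nat_mul, ← exp_add] at h2
  have h3 : exp 1.6 ≤ 5 := by
    have := exp_one_lt_d9
    have e5 : exp 1.6 ^ 5 = exp 1 ^ 8 := by rw [← exp_nat_mul, ← exp_nat_mul]; norm_num
    have : exp 1 ^ 8 ≤ 2.7182818286 ^ 8 := by gcongr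
    refine le_of_pow_le_pow_left₀ (n := 5) (by norm_num) (by norm_num) ?_
    rw [e5]
    refine this.trans (by norm_num)
  have h4 : exp 1.6 * exp (-(1 + ((J + 1 : ℕ):ℝ) * -0.771)) ≤ A := by
    rw [exp_neg, ← div_eq_mul_inv, div_le_iff₀ (exp_pos _)]
    exact h3.trans h2
  refine le_trans ?_ h4
  rw [← exp_add]
  apply exp_le_exp.2
  have : (n:ℝ) ≤ 4 * (J + 1) + 3 := by exact_mod_cast (by omega : n ≤ 4 * (J + 1) + 3)
  push_cast
  norm_num
  linarith

theorem exp_poly {n : ℕ} (hn : 900 ≤ n) : 3 * (n:ℝ) ^ 4 ≤ exp (0.0337 * n) := by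
  have hn9 : (900:ℝ) ≤ n := by exact_mod_cast hn
  have h7 : (1095:ℝ) ≤ exp 7 := by
    have h := exp_one_gt_d9
    have e : exp 7 = exp 1 ^ 7 := by rw [← exp_nat_mul]; norm_num
    have : (2.718:ℝ) ^ 7 ≤ exp 1 ^ 7 := by gcongr; linarith
    rw [e]; norm_num at this ⊢; linarith
  have h1 : 1.317 * (n:ℝ) ≤ exp (0.008425 * n) := by
    have e : exp (0.008425 * n) = exp 7 * exp (0.008425 * n - 7) := by rw [← exp_add]; ring_nf
    have := add_one_le_exp (0.008425 * (n:ℝ) - 7)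
    have h8 : 1095 * (0.008425 * (n:ℝ) - 6) ≤ exp 7 * exp (0.008425 * n - 7) := by
      apply mul_le_mul h7 (by linarith) (by linarith) (by positivity)
    rw [e]; linarith
  have e : exp (0.0337 * n) = exp (0.008425 * n) ^ 4 := by rw [← exp_nat_mul]; congr 1; push_cast; ring
  rw [e]
  calc 3 * (n:ℝ) ^ 4 ≤ (1.317 * n) ^ 4 := by rw [mul_pow]; gcongr; norm_num
    _ ≤ _ := by gcongr

variable {n j : ℕ} {c : ℝ}

theorem Z_ge_n (hn : 900 ≤ n) (hj : j ≤ 1) (H : SLC (vv n j) (ss n j) (2 * π) (n / 12) c) :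
    46 / n * vv n j (2 * π * n / (n + n / 4 + 1 : ℕ)) ≤ ∫ x in (0:ℝ)..(2 * π), vv n j x := by
  have hn9 : (900:ℝ) ≤ n := by exact_mod_cast hn
  have hn0 : (0:ℝ) < n := by linarith
  have p0 := pi_pos
  set a := √(12 / (n:ℝ)) with ha
  have ha2 : a ^ 2 = 12 / n := sq_sqrt (by positivity)
  have ha0 : 0 < a := sqrt_pos.2 (by positivity)
  obtain ⟨w1, w2⟩ := window_c hn hj H ha0 ha2
  have hZ := H.Z_ge (by positivity) (win (by omega) hj H ha0 ha2.le) ha0 w1 w2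
  have e1 : (n:ℝ) / 4 * a ^ 2 / 2 = 3 / 2 := by rw [ha2]; field_simp; norm_num
  rw [e1] at hZ
  have h3 : (0.2231:ℝ) ≤ exp (-(3/2)) := by
    have h := exp_one_lt_d9
    have e : exp (-(3/2)) ^ 2 = (exp 1 ^ 3)⁻¹ := by
      rw [← exp_nat_mul, ← exp_nat_mul, ← exp_neg]; norm_num
    have : exp 1 ^ 3 ≤ 2.7182818286 ^ 3 := by gcongr
    refine le_of_pow_le_pow_left₀ (n := 2) (by norm_num) (exp_pos _).le ?_
    rw [e, le_inv_comm₀ (by norm_num) (by positivity)]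
    refine this.trans (by norm_num)
  have ha3 : 103.9 / n ≤ a := by
    refine le_of_pow_le_pow_left₀ (n := 2) (by norm_num) ha0.le ?_
    rw [ha2, div_pow, div_le_div_iff₀ (by positivity) hn0]
    nlinarith
  have hM0 : (0:ℝ) < (n + n / 4 + 1 : ℕ) := by positivity
  have hX : vv n j (2 * π * n / (n + n / 4 + 1 : ℕ)) ≤ vv n j c := by
    have := H.v_le (x := 2 * π * n / (n + n / 4 + 1 : ℕ)) (by positivity) (by
      rw [div_lt_iff₀ hM0]
      gcongr
      omega)
    refine this.trans ?_
    have hc : 0 < vv n j c := H.pos c H.hc0 H.hcb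
    apply mul_le_of_le_one_right hc.le
    apply exp_le_one_iff.2
    have : 0 ≤ (n:ℝ) / 12 / 2 * (2 * π * n / (n + n / 4 + 1 : ℕ) - c) ^ 2 := by positivity
    linarith
  have hc : 0 < vv n j c := H.pos c H.hc0 H.hcb
  refine le_trans ?_ hZ
  calc _ ≤ 46 / n * vv n j c := by gcongr
    _ ≤ vv n j c * (0.2231 * (2 * (103.9 / n))) := by
      have : 46 / (n:ℝ) ≤ (0.2231 * (2 * (103.9 / n))) := by
        rw [show (0.2231 * (2 * (103.9 / (n:ℝ)))) = 46.36018 / n by ring]; gcongr; norm_num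
      nlinarith
    _ ≤ vv n j c * (exp (-(3/2)) * (2 * a)) := by gcongr
    _ = _ := by ring

theorem Z0_big (hn : 900 ≤ n) (H : SLC (vv n 0) (ss n 0) (2 * π) (n / 12) c) :
    330 * n ^ 2 * exp (0.159 * n) ≤ ∫ x in (0:ℝ)..(2 * π), vv n 0 x := by
  have hn9 : (900:ℝ) ≤ n := by exact_mod_cast hn
  have hn0 : (0:ℝ) < n := by linarith
  refine le_trans ?_ (Z_ge_n hn (by norm_num) H)
  have e : vv n 0 (2 * π * n / (n + n / 4 + 1 : ℕ)) = 
    ∏ k ∈ Finset.range n, (2 * sin ((k + 1 : ℕ) * (π / (n + n / 4 + 1 : ℕ)))) := by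
    rw [vv, pow_zero, one_mul]
    congr! 4
    field_simp
  rw [e]
  have h1 := peak hn
  have h2 := exp_poly hn
  have e2 : exp (0.1927 * n) = exp (0.0337 * n) * exp (0.159 * n) := by rw [← exp_add]; congr 1; ring
  calc 330 * n ^ 2 * exp (0.159 * n) ≤ 46 / n * (3 * n ^ 4) * exp (0.159 * n) := by
        refine mul_le_mul_of_nonneg_right ?_ (exp_pos _).le
        rw [show 46 / (n:ℝ) * (3 * n ^ 4) = 138 * n * n ^ 2 by field_simp; ring]
        gcongr
        linarith
    _ ≤ 46 / n * exp (0.0337 * n) * exp (0.159 * n) := by gcongr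
    _ = 46 / n * exp (0.1927 * n) := by rw [e2]; ring
    _ ≤ _ := by gcongr

theorem Z1_big (hn : 900 ≤ n) (H : SLC (vv n 1) (ss n 1) (2 * π) (n / 12) c) :
    200 * n ^ 2 * exp (0.159 * n) ≤ ∫ x in (0:ℝ)..(2 * π), vv n 1 x := by
  have hn9 : (900:ℝ) ≤ n := by exact_mod_cast hn
  have hn0 : (0:ℝ) < n := by linarith
  refine le_trans ?_ (Z_ge_n hn (by norm_num) H)
  have hM0 : (0:ℝ) < (n + n / 4 + 1 : ℕ) := by positivity
  have p0 := pi_pos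
  have e : vv n 1 (2 * π * n / (n + n / 4 + 1 : ℕ)) = sin (π / (n + n / 4 + 1 : ℕ)) *
    ∏ k ∈ Finset.range n, (2 * sin ((k + 1 : ℕ) * (π / (n + n / 4 + 1 : ℕ)))) := by
    have e5 : 2 * π * n / (n + n / 4 + 1 : ℕ) / 2 / n = π / (n + n / 4 + 1 : ℕ) := by field_simp
    rw [vv, pow_one, e5]
  rw [e]
  have h1 := peak hn
  have h2 := exp_poly hn
  have e2 : exp (0.1927 * n) = exp (0.0337 * n) * exp (0.159 * n) := by rw [← exp_add]; congr 1; ring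
  have hMn : ((n + n / 4 + 1 : ℕ) : ℝ) ≤ 1.26 * n := by
    have : ((4 * (n + n / 4 + 1) : ℕ) : ℝ) ≤ ((4 * n + n + 4 : ℕ) : ℝ) := by exact_mod_cast (by omega)
    push_cast at this ⊢
    linarith
  have hs : 1.5 / n ≤ sin (π / (n + n / 4 + 1 : ℕ)) := by
    have h2M : (2:ℝ) ≤ (n + n / 4 + 1 : ℕ) := by exact_mod_cast (by omega)
    have := Real.mul_le_sin (x := π / (n + n / 4 + 1 : ℕ)) (by positivity) (by gcongr)
    refine le_trans ?_ this
    rw [div_mul_div_cancel₀ p0.ne', div_le_div_iff₀ hn0 hM0]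
    linarith
  have hs0 : 0 ≤ sin (π / (n + n / 4 + 1 : ℕ)) := le_trans (by positivity) hs
  calc 200 * n ^ 2 * exp (0.159 * n) ≤ 46 / n * (1.5 / n) * (3 * n ^ 4) * exp (0.159 * n) := by
        refine mul_le_mul_of_nonneg_right ?_ (exp_pos _).le
        rw [show 46 / (n:ℝ) * (1.5 / n) * (3 * n ^ 4) = 207 * n ^ 2 by field_simp; ring]
        nlinarith
    _ ≤ 46 / n * (1.5 / n) * exp (0.0337 * n) * exp (0.159 * n) := by gcongr
    _ = 46 / n * (1.5 / n * exp (0.1927 * n)) := by rw [e2]; ring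
    _ ≤ _ := by gcongr

end QP

namespace QP

open Set Real intervalIntegral MeasureTheory

noncomputable def PP (n : ℕ) (θ : ℝ) : ℝ := ∏ k ∈ Finset.range n, (2 * sin ((k + 1 : ℕ) * (θ / 2)))

noncomputable def SS (n : ℕ) (D : ℝ) : ℝ := ∫ θ in (0:ℝ)..π, PP n θ * sin (D * θ)

theorem PP_cont (n : ℕ) : Continuous (PP n) := by
  unfold PP
  fun_prop

theorem SS_neg (n : ℕ) (D : ℝ) : SS n (-D) = - SS n D := by
  unfold SS
  rw [← intervalIntegral.integral_neg]
  congr 1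
  funext θ
  rw [neg_mul, sin_neg]; ring

theorem exp_half (y : ℝ) : Complex.exp (Complex.I * y) - 1 =
    Complex.exp (Complex.I * (y / 2 : ℝ)) * (Complex.I * (2 * sin (y / 2) : ℝ)) := by
  have e : Complex.I * y = Complex.I * (y / 2 : ℝ) + Complex.I * (y / 2 : ℝ) := by push_cast; ring
  rw [e, Complex.exp_add]
  rw [mul_comm Complex.I ((y / 2 : ℝ) : ℂ), Complex.exp_mul_I, ← Complex.ofReal_cos, ← Complex.ofReal_sin]
  have h := sin_sq_add_cos_sq (y / 2)
  generalize sin (y / 2) = u at *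
  generalize cos (y / 2) = v at *
  apply Complex.ext
  · simp
    nlinarith
  · simp
    ring

theorem prod_exp (n : ℕ) (θ : ℝ) : ∏ k ∈ Finset.range n, (Complex.exp (Complex.I * θ) ^ (k + 1) - 1) =
    Complex.exp (Complex.I * ((n * (n + 1) / 4 : ℝ) * θ : ℝ)) * Complex.I ^ n * (PP n θ : ℝ) := by
  induction n with
  | zero => simp [PP]
  | succ m ih =>
    rw [Finset.prod_range_succ, ih]
    have e : Complex.exp (Complex.I * θ) ^ (m + 1) = Complex.exp (Complex.I * (((m + 1 : ℕ) : ℝ) * θ : ℝ)) := by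
      rw [← Complex.exp_nat_mul]; congr 1; push_cast; ring
    rw [e, exp_half]
    have e2 : PP (m + 1) θ = PP m θ * (2 * sin (((m + 1 : ℕ) : ℝ) * θ / 2)) := by
      unfold PP
      rw [Finset.prod_range_succ, mul_div_assoc]
    have e3 : Complex.exp (Complex.I * ((((m + 1 : ℕ):ℝ) * (((m + 1 : ℕ):ℝ) + 1) / 4 : ℝ) * θ : ℝ)) =
      Complex.exp (Complex.I * (((m:ℝ) * (m + 1) / 4 : ℝ) * θ : ℝ)) * Complex.exp (Complex.I * ((((m + 1 : ℕ) : ℝ) * θ) / 2 : ℝ)) := by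
      rw [← Complex.exp_add]; congr 1; push_cast; ring
    rw [e2, e3, pow_succ]
    push_cast
    ring

theorem real_id {n t : ℕ} (hn : n = 2 * t + 1) (l : ℕ) (θ : ℝ) :
    ∑ j ∈ Finset.range (n * (n + 1) / 2 + 1), ((Q n).coeff j : ℝ) * cos (((j:ℝ) - l) * θ) =
    - (-1) ^ t * (PP n θ * sin ((n * (n + 1) / 4 - l) * θ)) := by
  have h1 : Polynomial.eval₂ (Int.castRingHom ℂ) (Complex.exp (Complex.I * θ)) (Q n) =
      ∏ k ∈ Finset.range n, (Complex.exp (Complex.I * θ) ^ (k + 1) - 1) := by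
    unfold Q
    rw [Polynomial.eval₂_finsetProd]
    simp
  rw [Polynomial.eval₂_eq_sum_range' _ (Nat.lt_succ_of_le (Q_deg n)), prod_exp] at h1
  have h2 := congrArg (fun z => (z * Complex.exp (Complex.I * (-(l:ℝ) * θ : ℝ))).re) h1
  simp only [Finset.sum_mul] at h2
  rw [Complex.re_sum] at h2
  have e1 : ∀ j, ((Int.castRingHom ℂ) ((Q n).coeff j) * Complex.exp (Complex.I * θ) ^ j * Complex.exp (Complex.I * (-(l:ℝ) * θ : ℝ))).re
      = ((Q n).coeff j : ℝ) * cos (((j:ℝ) - l) * θ) := by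
    intro j
    rw [mul_assoc, ← Complex.exp_nat_mul, ← Complex.exp_add]
    have : (j:ℂ) * (Complex.I * θ) + Complex.I * (-(l:ℝ) * θ : ℝ) = ((((j:ℝ) - l) * θ : ℝ) : ℂ) * Complex.I := by
      push_cast; ring
    have h0 : (Int.castRingHom ℂ) ((Q n).coeff j) = (((Q n).coeff j : ℝ) : ℂ) := by simp
    rw [this, h0, Complex.re_ofReal_mul, Complex.exp_ofReal_mul_I_re]
  simp only [e1] at h2
  rw [Nat.succ_eq_add_one] at h2
  rw [h2]
  have e2 : Complex.exp (Complex.I * ((n * (n + 1) / 4 : ℝ) * θ : ℝ)) * Complex.I ^ n * (PP n θ : ℝ) * Complex.exp (Complex.I * (-(l:ℝ) * θ : ℝ))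
     = Complex.exp ((((n * (n + 1) / 4 - l : ℝ) * θ : ℝ) : ℂ) * Complex.I) * (((-1) ^ t * PP n θ : ℝ) * Complex.I) := by
    have : ((((n * (n + 1) / 4 - l : ℝ) * θ : ℝ) : ℂ) * Complex.I) = Complex.I * ((n * (n + 1) / 4 : ℝ) * θ : ℝ) + Complex.I * (-(l:ℝ) * θ : ℝ) := by
      push_cast; ring
    have hI : Complex.I ^ n = ((-1 : ℝ) ^ t : ℝ) * Complex.I := by
      rw [hn, pow_succ, pow_mul, Complex.I_sq]; push_cast; ring
    rw [this, Complex.exp_add, hI]; push_cast; ring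
  rw [e2, ← mul_assoc, Complex.mul_I_re, Complex.im_mul_ofReal, Complex.exp_ofReal_mul_I_im]
  ring

theorem int_cos (m : ℤ) : ∫ θ in (0:ℝ)..π, cos ((m:ℝ) * θ) = if m = 0 then π else 0 := by
  split_ifs with h
  · subst h; simp
  · have hm : (m:ℝ) ≠ 0 := by exact_mod_cast h
    rw [intervalIntegral.integral_comp_mul_left (fun x => cos x) hm, integral_cos]
    simp [sin_int_mul_pi]

theorem fourier {n : ℕ} (ho : Odd n) (l : ℕ) :
    π * ((a n l).natAbs : ℝ) = |SS n (n * (n + 1) / 4 - l)| := by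
  obtain ⟨t, ht⟩ := ho
  have h1 : ∫ θ in (0:ℝ)..π, ∑ j ∈ Finset.range (n * (n + 1) / 2 + 1), ((Q n).coeff j : ℝ) * cos (((j:ℝ) - l) * θ)
      = ∫ θ in (0:ℝ)..π, - (-1) ^ t * (PP n θ * sin ((n * (n + 1) / 4 - l) * θ)) := by
    congr 1; funext θ; exact real_id ht l θ
  rw [intervalIntegral.integral_const_mul, intervalIntegral.integral_finsetSum] at h1
  · have e : ∀ j : ℕ, ∫ θ in (0:ℝ)..π, ((Q n).coeff j : ℝ) * cos (((j:ℝ) - l) * θ) = if j = l then π * ((Q n).coeff l : ℝ) else 0 := by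
      intro j
      rw [intervalIntegral.integral_const_mul]
      have := int_cos ((j:ℤ) - l)
      push_cast at this
      rw [this]
      by_cases hj : j = l
      · subst hj; simp [mul_comm]
      · rw [if_neg hj, if_neg (by omega), mul_zero]
    simp only [e] at h1
    rw [Finset.sum_ite_eq'] at h1
    have h2 : π * ((Q n).coeff l : ℝ) = - (-1) ^ t * SS n (n * (n + 1) / 4 - l) := by
      unfold SS
      rw [← h1]
      split_ifs with hl
      · rfl
      · rw [Finset.mem_range, not_lt] at hl
        rw [Polynomial.coeff_eq_zero_of_natDegree_lt (lt_of_le_of_lt (Q_deg n) (by omega))]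
        simp
    have h3 := congrArg abs h2
    rw [abs_mul, abs_mul, abs_neg, abs_pow, abs_neg, abs_one, one_pow, one_mul, abs_of_pos pi_pos] at h3
    rw [← h3, a_natAbs, Nat.cast_natAbs]
    push_cast
    rfl
  · intro j _
    apply Continuous.intervalIntegrable
    fun_prop

theorem split {n : ℕ} (hn : 900 ≤ n) (ho : Odd n) {g : ℝ → ℝ} (hg : Continuous g) {B : ℝ} (hB : ∀ x, |g x| ≤ B) :
    |(∫ θ in (0:ℝ)..π, PP n θ * g θ) - (1 / n) * ∫ x in (0:ℝ)..(2 * π), vv n 0 x * g (x / n)| ≤ B * exp (0.159 * n) * π := by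
  have hn9 : (900:ℝ) ≤ n := by exact_mod_cast hn
  have hn0 : (0:ℝ) < n := by linarith
  have p0 := pi_pos
  have hc : Continuous fun θ => PP n θ * g θ := (PP_cont n).mul hg
  have hB0 : 0 ≤ B := (abs_nonneg _).trans (hB 0)
  have h2 : 2 * π / n ≤ π := by rw [div_le_iff₀ hn0]; nlinarith
  have h20 : 0 ≤ 2 * π / n := by positivity
  rw [← intervalIntegral.integral_add_adjacent_intervals (b := 2 * π / n) (hc.intervalIntegrable _ _) (hc.intervalIntegrable _ _)]
  have e : ∫ x in (0:ℝ)..(2 * π), vv n 0 x * g (x / n) = n * ∫ θ in (0:ℝ)..(2 * π / n), PP n θ * g θ := by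
    have := intervalIntegral.integral_comp_div (a := 0) (b := 2 * π) (fun θ => PP n θ * g θ) hn0.ne'
    rw [zero_div, smul_eq_mul] at this
    rw [← this]
    congr 1
    funext x
    unfold vv PP
    rw [pow_zero, one_mul, div_right_comm]
  rw [e, ← mul_assoc, one_div, inv_mul_cancel₀ hn0.ne', one_mul, add_sub_cancel_left]
  have hI := intervalIntegral.norm_integral_le_of_norm_le_const (a := 2 * π / n) (b := π) (f := fun θ => PP n θ * g θ) (C := B * exp (0.159 * n)) (by
    intro θ hθ
    rw [uIoc_of_le h2] at hθ
    have := minor hn ho (θ := θ) (by 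
      have := hθ.1.le
      rw [div_le_iff₀ hn0] at this
      linarith) hθ.2
    rw [norm_mul, mul_comm B]
    apply mul_le_mul this (hB θ) (abs_nonneg _) (exp_pos _).le)
  refine hI.trans ?_
  rw [abs_of_nonneg (by linarith)]
  gcongr
  linarith

variable {n : ℕ} {c : ℝ}

theorem S_bound (hn : 900 ≤ n) (ho : Odd n) (H : SLC (vv n 0) (ss n 0) (2 * π) (n / 12) c) (D : ℝ) :
    |SS n D - (1 / n) * ((∫ x in (0:ℝ)..(2 * π), vv n 0 x) * Ex (vv n 0) (2 * π) (fun x => sin (D / n * x)))| 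
     ≤ π * exp (0.159 * n) := by
  have h := split hn ho (g := fun θ => sin (D * θ)) (by fun_prop) (B := 1) (fun x => abs_sin_le_one _)
  have hZ := H.Zpos
  rw [Ex, mul_div_cancel₀ _ hZ.ne']
  rw [one_mul, mul_comm (exp _) π] at h
  have e : ∫ x in (0:ℝ)..(2 * π), sin (D / n * x) * vv n 0 x = ∫ x in (0:ℝ)..(2 * π), vv n 0 x * sin (D * (x / n)) := by
    congr 1; funext x; rw [mul_comm]; congr 2; ring
  rw [e]
  exact h

theorem diff_bound (hn : 900 ≤ n) (ho : Odd n) (H : SLC (vv n 1) (ss n 1) (2 * π) (n / 12) c) (D : ℝ) :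
    |SS n (D + 1) - SS n D - (2 / n) * ((∫ x in (0:ℝ)..(2 * π), vv n 1 x) * Ex (vv n 1) (2 * π) (fun x => cos ((D + 1 / 2) / n * x)))| 
     ≤ 2 * π * exp (0.159 * n) := by
  have h := split hn ho (g := fun θ => 2 * (cos ((D + 1 / 2) * θ) * sin (θ / 2))) (by fun_prop) (B := 2) (fun x => by
    rw [abs_mul, abs_mul, abs_two]
    have := mul_le_mul (abs_cos_le_one ((D + 1 / 2) * x)) (abs_sin_le_one (x / 2)) (abs_nonneg _) zero_le_one
    linarith)
  have hZ := H.Zpos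
  rw [Ex, mul_div_cancel₀ _ hZ.ne']
  have e : ∫ x in (0:ℝ)..(2 * π), vv n 0 x * (2 * (cos ((D + 1 / 2) * (x / n)) * sin (x / n / 2)))
     = 2 * ∫ x in (0:ℝ)..(2 * π), cos ((D + 1 / 2) / n * x) * vv n 1 x := by
    rw [← intervalIntegral.integral_const_mul]
    congr 1; funext x
    unfold vv
    rw [pow_zero, one_mul, pow_one, div_right_comm x (n:ℝ) 2, div_mul_eq_mul_div, mul_div_assoc]
    ring
  have e2 : SS n (D + 1) - SS n D = ∫ θ in (0:ℝ)..π, PP n θ * (2 * (cos ((D + 1 / 2) * θ) * sin (θ / 2))) := by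
    unfold SS
    rw [← intervalIntegral.integral_sub]
    · congr 1; funext θ
      rw [← mul_sub, sin_sub_sin]
      have e3 : ((D + 1) * θ - D * θ) / 2 = θ / 2 := by ring
      have e4 : ((D + 1) * θ + D * θ) / 2 = (D + 1 / 2) * θ := by ring
      rw [e3, e4]; ring
    · apply Continuous.intervalIntegrable
      have := PP_cont n
      fun_prop
    · apply Continuous.intervalIntegrable
      have := PP_cont n
      fun_prop
  rw [e, ← e2] at h
  have e5 : 1 / (n:ℝ) * (2 * ∫ x in (0:ℝ)..(2 * π), cos ((D + 1 / 2) / n * x) * vv n 1 x) = 2 / n * ∫ x in (0:ℝ)..(2 * π), cos ((D + 1 / 2) / n * x) * vv n 1 x := by ring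
  rw [e5] at h
  linarith

end QP

namespace QP

open Set Real

variable {n : ℕ}

theorem F1 (hn : 900 ≤ n) (ho : Odd n) {D : ℝ} (h0 : 0 ≤ D + 1 / 2) (h : D + 1 / 2 ≤ xx n - 0.028) :
    SS n D < SS n (D + 1) := by
  have hn9 : (900:ℝ) ≤ n := by exact_mod_cast hn
  have hn0 : (0:ℝ) < n := by linarith
  obtain ⟨c, H⟩ := vv_slc (n := n) 1 (by omega)
  have hb := diff_bound hn ho H D
  have hZ := Z1_big hn H
  have hE := signA_lo hn H (w := (D + 1 / 2) / n) (by positivity) (by rw [div_mul_cancel₀ _ hn0.ne']; exact h)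
  set Z := ∫ x in (0:ℝ)..(2 * π), vv n 1 x
  set E := Ex (vv n 1) (2 * π) (fun x => cos ((D + 1 / 2) / n * x))
  have hm := exp_pos (0.159 * (n:ℝ))
  have hZ0 : 0 < Z := lt_of_lt_of_le (by positivity) hZ
  have hk : 8 * exp (0.159 * n) ≤ 2 / n * (Z * E) := by
    calc 8 * exp (0.159 * n) = 2 / n * ((200 * n ^ 2 * exp (0.159 * n)) * (0.02 / n)) := by field_simp; norm_num
      _ ≤ _ := by gcongr
  have p2 := pi_hi
  have := (abs_le.1 hb).1
  nlinarith

theorem F2 (hn : 900 ≤ n) (ho : Odd n) {D : ℝ} (h : xx n + 0.028 ≤ D + 1 / 2) (h0 : D + 1 / 2 ≤ 0.56 * n) :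
    SS n (D + 1) < SS n D := by
  have hn9 : (900:ℝ) ≤ n := by exact_mod_cast hn
  have hn0 : (0:ℝ) < n := by linarith
  obtain ⟨c, H⟩ := vv_slc (n := n) 1 (by omega)
  have hb := diff_bound hn ho H D
  have hZ := Z1_big hn H
  have hE := signA_hi hn H (w := (D + 1 / 2) / n) (by rw [div_mul_cancel₀ _ hn0.ne']; exact h) (by rw [div_le_iff₀ hn0]; exact h0)
  set Z := ∫ x in (0:ℝ)..(2 * π), vv n 1 x
  set E := Ex (vv n 1) (2 * π) (fun x => cos ((D + 1 / 2) / n * x))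
  have hm := exp_pos (0.159 * (n:ℝ))
  have hE' : 0.02 / n ≤ - E := by linarith
  have hZ0 : 0 < Z := lt_of_lt_of_le (by positivity) hZ
  have hk : 8 * exp (0.159 * n) ≤ 2 / n * (Z * (-E)) := by
    calc 8 * exp (0.159 * n) = 2 / n * ((200 * n ^ 2 * exp (0.159 * n)) * (0.02 / n)) := by field_simp; norm_num
      _ ≤ _ := by gcongr
  have p2 := pi_hi
  have := (abs_le.1 hb).2
  have e : 2 / (n:ℝ) * (Z * (-E)) = - (2 / n * (Z * E)) := by ring
  nlinarith

theorem F3 (hn : 900 ≤ n) (ho : Odd n) {D D1 : ℝ} (h1 : |D1 - π * n / (2 * mean (vv n 0) (2 * π))| ≤ 1 / 2)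
    (h : 0.55 * n ≤ D) : |SS n D| < SS n D1 := by
  have hn9 : (900:ℝ) ≤ n := by exact_mod_cast hn
  have hn0 : (0:ℝ) < n := by linarith
  obtain ⟨c, H⟩ := vv_slc (n := n) 0 (by omega)
  have hb := S_bound hn ho H D
  have hb1 := S_bound hn ho H D1
  have hZ := Z0_big hn H
  have hE1 := ampB_peak hn H (w := D1 / n) (by rw [div_mul_cancel₀ _ hn0.ne']; exact h1)
  have hE : |Ex (vv n 0) (2 * π) (fun x => sin (D / n * x))| ≤ 1 - 0.0589 * var (vv n 0) (2 * π) - 3.6 / n ^ 2 - 0.02 / n := by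
    have hw : 0.55 ≤ D / n := by rw [le_div_iff₀ hn0]; exact h
    by_cases hc : D / n ≤ 1.5
    · exact ampB_taylor hn H hw hc
    · exact ampB_window hn H (by linarith)
  set Z := ∫ x in (0:ℝ)..(2 * π), vv n 0 x
  set E := Ex (vv n 0) (2 * π) (fun x => sin (D / n * x))
  set E1 := Ex (vv n 0) (2 * π) (fun x => sin (D1 / n * x))
  have hm := exp_pos (0.159 * (n:ℝ))
  have hd : 0.02 / n ≤ E1 - |E| := by linarith
  have hZ0 : 0 < Z := lt_of_lt_of_le (by positivity) hZ
  have hk : 6.6 * exp (0.159 * n) ≤ 1 / n * (Z * (E1 - |E|)) := by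
    calc 6.6 * exp (0.159 * n) = 1 / n * ((330 * n ^ 2 * exp (0.159 * n)) * (0.02 / n)) := by field_simp; norm_num
      _ ≤ _ := by gcongr
  have p2 := pi_hi
  have t1 := (abs_le.1 hb1).1
  have t2 : |SS n D| ≤ π * exp (0.159 * n) + 1 / n * (Z * |E|) := by
    have := abs_sub_abs_le_abs_sub (SS n D) (1 / n * (Z * E))
    rw [abs_mul (1 / (n:ℝ)), abs_mul Z, abs_of_pos hZ0, abs_of_pos (by positivity : (0:ℝ) < 1 / n)] at this
    linarith
  have e : 1 / (n:ℝ) * (Z * (E1 - |E|)) = 1 / n * (Z * E1) - 1 / n * (Z * |E|) := by ring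
  nlinarith

theorem a_le_M (n l : ℕ) : (a n l).natAbs ≤ M n := by
  by_cases h : l < n * (n + 1) / 2 + 1
  · exact Finset.le_sup (f := fun i => (a n i).natAbs) (Finset.mem_range.2 h)
  · rw [a_natAbs, Polynomial.coeff_eq_zero_of_natDegree_lt (lt_of_le_of_lt (Q_deg n) (by omega))]
    simp

theorem exists_max (n : ℕ) : ∃ l, l ≤ n * (n + 1) / 2 ∧ (a n l).natAbs = M n := by
  obtain ⟨i, hi, h⟩ := Finset.exists_mem_eq_sup (Finset.range (n * (n + 1) / 2 + 1)) ⟨0, by simp⟩ fun i => (a n i).natAbs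
  exact ⟨i, by have := Finset.mem_range.1 hi; omega, h.symm⟩

theorem L_spec (n : ℕ) : (a n (L n)).natAbs = M n := by
  obtain ⟨l, _, h⟩ := exists_max n
  exact Nat.sInf_mem (s := {i : ℕ | (a n i).natAbs = M n}) ⟨l, h⟩

theorem L_le {n l : ℕ} (h : (a n l).natAbs = M n) : L n ≤ l := Nat.sInf_le h

theorem xx_bounds (hn : 900 ≤ n) : 0.299 * n ≤ xx n ∧ xx n ≤ 0.343 * n := by
  have hn0 : (0:ℝ) < n := by exact_mod_cast (by omega : 0 < n)
  obtain ⟨c, H⟩ := vv_slc (n := n) 1 (by omega)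
  obtain ⟨b1, b2⟩ := mean_bounds (by omega) (by norm_num) H
  have p1 := pi_lo
  have p2 := pi_hi
  unfold xx
  rw [le_div_iff₀ (by linarith), div_le_iff₀ (by linarith)]
  constructor <;> nlinarith

theorem S_nonneg (hn : 900 ≤ n) (ho : Odd n) : ∀ k : ℕ, (k:ℝ) / 2 - 1 / 2 ≤ xx n - 0.028 → 0 ≤ SS n (k / 2)
  | 0, _ => by simp [SS]
  | 1, h => by
    have := F1 hn ho (D := -(1/2)) (by norm_num) (by push_cast at h; linarith)
    rw [SS_neg] at this
    norm_num at this ⊢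
    linarith
  | k + 2, h => by
    push_cast at h
    have h2 := S_nonneg hn ho k (by linarith)
    have := F1 hn ho (D := (k:ℝ) / 2) (by positivity) (by linarith)
    push_cast
    rw [show ((k:ℝ) + 2) / 2 = k / 2 + 1 by ring]
    linarith

theorem loc (hn : 900 ≤ n) (ho : Odd n) :
    xx n - 0.528 < (n:ℝ) * (n + 1) / 4 - L n ∧ (n:ℝ) * (n + 1) / 4 - L n < xx n + 0.528 := by
  have hn9 : (900:ℝ) ≤ n := by exact_mod_cast hn
  have p0 := pi_pos
  obtain ⟨x1, x2⟩ := xx_bounds hn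
  set D : ℝ := (n:ℝ) * (n + 1) / 4 - L n with hD
  have hmx : ∀ l : ℕ, |SS n ((n:ℝ) * (n + 1) / 4 - l)| ≤ |SS n D| := by
    intro l
    rw [hD, ← fourier ho, ← fourier ho, L_spec]
    have : ((a n l).natAbs : ℝ) ≤ M n := by exact_mod_cast a_le_M n l
    gcongr
  have hmax : ∀ k : ℤ, D + k ≤ n → |SS n (D + k)| ≤ |SS n D| := by
    intro k hk
    have h1 : (0:ℝ) ≤ ((L n : ℤ) - k : ℤ) := by
      push_cast
      have : (n:ℝ) ≤ (n:ℝ) * (n + 1) / 4 := by nlinarith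
      linarith
    have h2 : 0 ≤ (L n : ℤ) - k := by exact_mod_cast h1
    obtain ⟨l, hl⟩ := Int.eq_ofNat_of_zero_le h2
    have h3 : D + k = (n:ℝ) * (n + 1) / 4 - l := by
      have : ((L n : ℤ) - k : ℝ) = l := by exact_mod_cast hl
      push_cast at this
      rw [hD]; linarith
    rw [h3]; exact hmx l
  obtain ⟨N, hN⟩ : ∃ N, n * (n + 1) / 2 = N := ⟨_, rfl⟩
  have hN2 : n * (n + 1) = 2 * N := by
    have := (Nat.even_mul_succ_self n).two_dvd
    omega
  have hNr : (n:ℝ) * (n + 1) / 4 = N / 2 := by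
    have : (n:ℝ) * (n + 1) = 2 * N := by exact_mod_cast hN2
    linarith
  have hLN : L n ≤ N := by
    obtain ⟨l, h1, h2⟩ := exists_max n
    exact (L_le h2).trans (h1.trans hN.le)
  have hD0 : 2 * L n ≤ N := by
    by_contra hc
    push Not at hc
    have h1 : (a n (N - L n)).natAbs = M n := by
      rw [← L_spec]
      have h2 := fourier ho (N - L n)
      rw [Nat.cast_sub hLN, show (n:ℝ) * (n + 1) / 4 - (N - L n) = - D by rw [hD, hNr]; ring, SS_neg, abs_neg, hD, ← fourier ho] at h2
      have h3 := mul_left_cancel₀ p0.ne' h2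
      exact_mod_cast h3
    have := L_le h1
    omega
  obtain ⟨k, hk⟩ := Nat.exists_eq_add_of_le hD0
  have hDk : D = (k:ℝ) / 2 := by
    have : (N:ℝ) = 2 * L n + k := by exact_mod_cast hk
    rw [hD, hNr, this]; ring
  have hDnn : 0 ≤ D := by rw [hDk]; positivity
  constructor
  · by_contra hc
    push Not at hc
    have h1 := F1 hn ho (D := D) (by linarith) (by linarith)
    have h2 : 0 ≤ SS n D := by
      rw [hDk]; apply S_nonneg hn ho; rw [← hDk]; linarith
    have h3 := hmax 1 (by push_cast; linarith)
    push_cast at h3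
    rw [abs_of_nonneg h2] at h3
    have := le_abs_self (SS n (D + 1))
    linarith
  · by_contra hc
    push Not at hc
    obtain ⟨c, H⟩ := vv_slc (n := n) 0 (by omega)
    obtain ⟨b1, b2⟩ := mean_bounds (by omega) (by norm_num) H
    have p2 := pi_hi
    set t := π * n / (2 * mean (vv n 0) (2 * π)) with ht
    have ht1 : t ≤ 0.343 * n := by
      rw [ht, div_le_iff₀ (by linarith)]; nlinarith
    have hr := abs_sub_round (t - D)
    set r := round (t - D)
    have hr2 : |D + r - t| ≤ 1 / 2 := by
      rw [abs_sub_comm]; rw [show t - (D + r) = t - D - r by ring]; exact hr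
    have hr3 := hmax r (by have := (abs_le.1 hr2).2; linarith)
    have hr4 := le_abs_self (SS n (D + r))
    by_cases h55 : 0.55 * n ≤ D
    · have := F3 hn ho hr2 h55
      linarith
    · push Not at h55
      have h1 := F2 hn ho (D := D - 1) (by linarith) (by linarith)
      rw [sub_add_cancel] at h1
      by_cases hs : 0 ≤ SS n D
      · have h2 := hmax (-1) (by push_cast; linarith)
        push_cast at h2
        rw [abs_of_nonneg hs, ← sub_eq_add_neg] at h2
        have := le_abs_self (SS n (D - 1))
        linarith
      · push Not at hs
        have chain : ∀ m : ℕ, D + m - 1 / 2 ≤ 0.56 * n → SS n (D + m) ≤ SS n D := by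
          intro m
          induction m with
          | zero => intro _; simp
          | succ m ih =>
            intro hm
            push_cast at hm
            have h2 := ih (by linarith)
            have hm0 : (0:ℝ) ≤ m := by positivity
            have h3 := F2 hn ho (D := D + m) (by linarith) (by linarith)
            push_cast
            rw [← add_assoc]
            linarith
        have c1 := Nat.le_ceil (0.55 * (n:ℝ) - D)
        have c2 := Nat.ceil_lt_add_one (a := 0.55 * (n:ℝ) - D) (by linarith)
        have h2 := chain ⌈0.55 * (n:ℝ) - D⌉₊ (by linarith)
        have h3 := F3 hn ho (D := D + ⌈0.55 * (n:ℝ) - D⌉₊) hr2 (by linarith)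
        have h4 := neg_le_abs (SS n (D + ⌈0.55 * (n:ℝ) - D⌉₊))
        rw [abs_of_neg hs] at hr3
        linarith

theorem large {p : ℕ} (hp : 900 ≤ p) (ho : Odd p) :
    (2 * ((p + 2 : ℕ) : ℤ) - 1 + 2 * (L p : ℤ) - 2 * (L (p + 2) : ℤ)) ∈ ({1, 3} : Set ℤ) := by
  obtain ⟨a1, a2⟩ := loc hp ho
  obtain ⟨b1, b2⟩ := loc (n := p + 2) (by omega) (by obtain ⟨t, ht⟩ := ho; exact ⟨t + 1, by omega⟩)
  obtain ⟨c1, c2⟩ := xx_step hp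
  push_cast at b1 b2
  have h1 : (-1 : ℝ) < ((2 * ((p + 2 : ℕ) : ℤ) - 1 + 2 * (L p : ℤ) - 2 * (L (p + 2) : ℤ) : ℤ) : ℝ) := by
    push_cast; nlinarith
  have h2 : ((2 * ((p + 2 : ℕ) : ℤ) - 1 + 2 * (L p : ℤ) - 2 * (L (p + 2) : ℤ) : ℤ) : ℝ) < (5:ℝ) := by
    push_cast; nlinarith
  have h1' : -1 < (2 * ((p + 2 : ℕ) : ℤ) - 1 + 2 * (L p : ℤ) - 2 * (L (p + 2) : ℤ) : ℤ) := by exact_mod_cast h1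
  have h2' : (2 * ((p + 2 : ℕ) : ℤ) - 1 + 2 * (L p : ℤ) - 2 * (L (p + 2) : ℤ) : ℤ) < 5 := by exact_mod_cast h2
  simp only [Set.mem_insert_iff, Set.mem_singleton_iff]
  omega

end QP

/-- For odd `n` with `61 ≤ n ≤ 75000`,
`Ẽ n = (2n - 1) + 2·L(n-2) - 2·L(n) ∈ {1, 3}`. -/
theorem stmt_14 (n : ℕ) (hodd : Odd n) (h1 : 61 ≤ n) (h2 : n ≤ 75000) :
    (2 * (n : ℤ) - 1 + 2 * (L (n - 2) : ℤ) - 2 * (L n : ℤ)) ∈ ({1, 3} : Set ℤ) := by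
  by_cases h : n ≤ 901
  · exact QP.small n hodd h1 h
  · obtain ⟨p, rfl⟩ : ∃ p, n = p + 2 := ⟨n - 2, by omega⟩
    have ho : Odd p := by
      obtain ⟨t, ht⟩ := hodd
      exact ⟨t - 1, by omega⟩
    exact QP.large (by omega) ho
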